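/- arXiv:2104.00778 — 3 statements merged into one kernel-verified Lean document; each statement's English description precedes it below -/
import Mathlib

section
/- Let n, k, d, t be integers with d ≥ 2, t ≥ 1, k ≥ t+d-1, n ≥ k+1 and 2n > (t+d+1)(k-t-d+3). If 𝓕 is a nonempty nontrivial d-wise t-intersecting family of k-element subsets of [n], then |𝓕| ≤ max{|H(n,k,t+d-1)|, |A(n,k,t+d-1)|}; moreover, equality holds only if 𝓕 is the image of A(n,k,t+d-1) or of H(n,k,t+d-1) under a permutation of [n]. -/
/-- `famA n k d` is the family `A(n,k,d) = {A ⊆ [n] : |A| = k, |A ∩ [d+1]| ≥ d}`. -/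
def famA (n k d : ℕ) : Finset (Finset ℕ) :=
  ((Finset.Icc 1 n).powersetCard k).filter (fun A => d ≤ (A ∩ Finset.Icc 1 (d + 1)).card)

/-- `famH n k d` is the family
`H(n,k,d) = {A ⊆ [n] : |A| = k, [d-1] ⊆ A, A ∩ [d,k+1] ≠ ∅} ∪ {[k+1] \ {i} : i ∈ [d-1]}`. -/
def famH (n k d : ℕ) : Finset (Finset ℕ) :=
  ((Finset.Icc 1 n).powersetCard k).filter
    (fun A => Finset.Icc 1 (d - 1) ⊆ A ∧ (A ∩ Finset.Icc d (k + 1)).Nonempty)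
    ∪ (Finset.Icc 1 (d - 1)).image (fun i => Finset.Icc 1 (k + 1) \ {i})

namespace NontrivialIntersecting

open Finset

variable {α : Type*} [Fintype α] [DecidableEq α]

/-- A `k`-uniform `t`-intersecting family whose members have no common `t`-subset. -/
structure IsNontrivialInter (k t : ℕ) (𝓕 : Finset (Finset α)) : Prop where
  card_eq : ∀ F ∈ 𝓕, F.card = k
  inter : ∀ A ∈ 𝓕, ∀ B ∈ 𝓕, t ≤ (A ∩ B).card
  nontrivial : ∀ T : Finset α, T.card = t → ∃ F ∈ 𝓕, ¬ T ⊆ F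

/-- A largest nontrivial `t`-intersecting family. -/
structure IsExtremal (k t : ℕ) (𝓕 : Finset (Finset α)) : Prop
    extends IsNontrivialInter k t 𝓕 where
  card_le : ∀ 𝒢 : Finset (Finset α), IsNontrivialInter k t 𝒢 → 𝒢.card ≤ 𝓕.card

/-- The `k`-sets that contain `T` and meet `D \ T`, or contain `D` minus one point of `T`. -/
def hilt (k : ℕ) (T D : Finset α) : Finset (Finset α) :=
  (powersetCard k univ).filter
    (fun F => (T ⊆ F ∧ (F ∩ (D \ T)).Nonempty) ∨ ∃ x ∈ T, D.erase x ⊆ F)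

lemma mem_hilt {k : ℕ} {T D F : Finset α} : F ∈ hilt k T D ↔
    F.card = k ∧ ((T ⊆ F ∧ (F ∩ (D \ T)).Nonempty) ∨ ∃ x ∈ T, D.erase x ⊆ F) := by
  simp [hilt, mem_powersetCard]

lemma card_filter_inter_eq {k : ℕ} {U E : Finset α} (hE : E ⊆ U) (hk : E.card ≤ k) :
    ((powersetCard k (univ : Finset α)).filter (fun F => F ∩ U = E)).card =
      (Fintype.card α - U.card).choose (k - E.card) := by
  rw [← card_compl, ← card_powersetCard]
  refine card_nbij' (fun F => F \ U) (fun X => E ∪ X) ?_ ?_ ?_ ?_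
  · intro F hF
    simp only [mem_coe, mem_filter, mem_powersetCard] at hF ⊢
    refine ⟨fun z hz => by simp_all, ?_⟩
    have := card_sdiff_add_card_inter F U
    rw [hF.2] at this
    omega
  · intro X hX
    simp only [mem_coe, mem_filter, mem_powersetCard, subset_univ, true_and] at hX ⊢
    have hd : Disjoint E X := disjoint_left.2 fun z h1 h2 => by
      have := hX.1 h2
      simp at this
      exact this (hE h1)
    rw [card_union_of_disjoint hd]
    refine ⟨by omega, ?_⟩
    ext z
    have h1 := @hX.1 z
    have h2 := @hE z
    simp at h1 h2 ⊢
    tauto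
  · intro F hF
    simp only [mem_coe, mem_filter] at hF
    obtain ⟨-, rfl⟩ := hF
    ext z
    simp
    tauto
  · intro X hX
    simp only [mem_coe, mem_powersetCard] at hX
    ext z
    have h1 := @hX.1 z
    have h2 := @hE z
    simp at h1 h2 ⊢
    tauto

lemma exists_extensions {k t : ℕ} (hkn : k ≤ Fintype.card α)
    (hn : 2 * k + 1 ≤ Fintype.card α + t)
    {E₁ E₂ : Finset α} (h₁ : E₁.card ≤ k) (h₂ : E₂.card ≤ k) (h : (E₁ ∩ E₂).card < t) :
    ∃ G₁ G₂ : Finset α, E₁ ⊆ G₁ ∧ E₂ ⊆ G₂ ∧ G₁.card = k ∧ G₂.card = k ∧ (G₁ ∩ G₂).card < t := by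
  let P : Finset (Finset α × Finset α) :=
    univ.filter fun G => E₁ ⊆ G.1 ∧ E₂ ⊆ G.2 ∧ G.1.card = k ∧ G.2.card = k
  have hne : P.Nonempty := by
    rw [← card_univ] at hkn
    obtain ⟨G₁, a1, -, a2⟩ := exists_subsuperset_card_eq (subset_univ E₁) h₁ hkn
    obtain ⟨G₂, b1, -, b2⟩ := exists_subsuperset_card_eq (subset_univ E₂) h₂ hkn
    exact ⟨(G₁, G₂), by simp [P, *]⟩
  obtain ⟨⟨G₁, G₂⟩, hG, hmin⟩ := exists_min_image P (fun G => (G.1 ∩ G.2).card) hne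
  simp only [P, mem_filter, mem_univ, true_and] at hG hmin
  obtain ⟨a1, a2, a3, a4⟩ := hG
  refine ⟨G₁, G₂, a1, a2, a3, a4, ?_⟩
  by_contra! hge
  obtain ⟨z, hz⟩ : ∃ z, z ∉ G₁ ∪ G₂ := by
    by_contra! hall
    have : G₁ ∪ G₂ = univ := eq_univ_iff_forall.2 hall
    have h3 := card_union_add_card_inter G₁ G₂
    rw [this, card_univ] at h3
    omega
  obtain ⟨p, hp, hpE⟩ : ∃ p ∈ G₁ ∩ G₂, p ∉ E₁ ∩ E₂ :=
    exists_mem_notMem_of_card_lt_card (by omega)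
  simp only [mem_union, not_or, mem_inter] at hz hp
  have key : (G₁ ∩ G₂).card - 1 < (G₁ ∩ G₂).card := by omega
  by_cases hp1 : p ∈ E₁
  · have hp2 : p ∉ E₂ := fun h => hpE (mem_inter.2 ⟨hp1, h⟩)
    have := hmin (G₁, insert z (G₂.erase p)) ⟨a1, ?_, a3, ?_⟩
    · have h4 : G₁ ∩ insert z (G₂.erase p) = (G₁ ∩ G₂).erase p := by
        ext w; simp; grind
      rw [h4, card_erase_of_mem (mem_inter.2 hp)] at this
      omega
    · intro w hw
      have := a2 hw
      grind
    · rw [card_insert_of_notMem (by simp [hz.2]), card_erase_of_mem hp.2]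
      have : 0 < G₂.card := card_pos.2 ⟨p, hp.2⟩
      omega
  · have := hmin (insert z (G₁.erase p), G₂) ⟨?_, a2, ?_, a4⟩
    · have h4 : insert z (G₁.erase p) ∩ G₂ = (G₁ ∩ G₂).erase p := by
        ext w; simp; grind
      rw [h4, card_erase_of_mem (mem_inter.2 hp)] at this
      omega
    · intro w hw
      have := a1 hw
      grind
    · rw [card_insert_of_notMem (by simp [hz.1]), card_erase_of_mem hp.1]
      have : 0 < G₁.card := card_pos.2 ⟨p, hp.1⟩
      omega

lemma exists_trace_avoiding {k : ℕ} {U E : Finset α} {p : α} (hE : E ⊆ U) (hEk : E.card ≤ k)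
    (hp : p ∉ E) (hn : U.card + k + 1 ≤ Fintype.card α + E.card) :
    ∃ G : Finset α, G.card = k ∧ G ∩ U = E ∧ p ∉ G := by
  have h1 : E ⊆ (E ∪ Uᶜ).erase p := by
    intro z hz
    simp only [mem_erase, mem_union, hz, true_or, and_true]
    rintro rfl
    exact hp hz
  have hd : Disjoint E Uᶜ := disjoint_left.2 fun z h1 h2 => by
    simp at h2
    exact h2 (hE h1)
  obtain ⟨G, a1, a2, a3⟩ := exists_subsuperset_card_eq h1 hEk (by
    have h3 := pred_card_le_card_erase (s := E ∪ Uᶜ) (a := p)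
    rw [card_union_of_disjoint hd, card_compl] at h3
    have := card_le_univ U
    omega)
  refine ⟨G, a3, ?_, fun h => by simpa using a2 h⟩
  ext z
  have h2 := @a1 z
  have h3 := @a2 z
  have h4 := @hE z
  simp at h2 h3 h4 ⊢
  tauto

/-- The generators of `𝓕` inside `U`. -/
def gens (k : ℕ) (𝓕 : Finset (Finset α)) (U : Finset α) : Finset (Finset α) :=
  U.powerset.filter fun E => E.card ≤ k ∧ ∀ G : Finset α, G.card = k → E ⊆ G → G ∈ 𝓕

/-- The generators containing `p` which are no longer generators after removing `p`. -/
def pivots (k : ℕ) (𝓕 : Finset (Finset α)) (U : Finset α) (p : α) : Finset (Finset α) :=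
  (gens k 𝓕 U).filter fun E => p ∈ E ∧ E.erase p ∉ gens k 𝓕 U

/-- The `k`-sets whose trace on `U` lies in `𝒱`. -/
def traceFam (k : ℕ) (U : Finset α) (𝒱 : Finset (Finset α)) : Finset (Finset α) :=
  (powersetCard k univ).filter fun F => F ∩ U ∈ 𝒱

lemma mem_gens {k : ℕ} {𝓕 : Finset (Finset α)} {U E : Finset α} : E ∈ gens k 𝓕 U ↔
    E ⊆ U ∧ E.card ≤ k ∧ ∀ G : Finset α, G.card = k → E ⊆ G → G ∈ 𝓕 := by
  simp [gens]

lemma mem_pivots {k : ℕ} {𝓕 : Finset (Finset α)} {U E : Finset α} {p : α} :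
    E ∈ pivots k 𝓕 U p ↔ E ∈ gens k 𝓕 U ∧ p ∈ E ∧ E.erase p ∉ gens k 𝓕 U := by
  simp [pivots]

lemma mem_traceFam {k : ℕ} {U F : Finset α} {𝒱 : Finset (Finset α)} :
    F ∈ traceFam k U 𝒱 ↔ F.card = k ∧ F ∩ U ∈ 𝒱 := by
  simp [traceFam, mem_powersetCard]

lemma card_traceFam {k : ℕ} {U : Finset α} {𝒱 : Finset (Finset α)}
    (h : ∀ E ∈ 𝒱, E ⊆ U ∧ E.card ≤ k) : (traceFam k U 𝒱).card =
      ∑ E ∈ 𝒱, (Fintype.card α - U.card).choose (k - E.card) := by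
  rw [card_eq_sum_card_fiberwise (f := fun F => F ∩ U) (t := 𝒱)
    (fun F hF => (mem_traceFam.1 hF).2)]
  refine sum_congr rfl fun E hE => ?_
  rw [← card_filter_inter_eq (h E hE).1 (h E hE).2]
  congr 1
  ext F
  simp only [mem_filter, mem_traceFam, mem_powersetCard, subset_univ, true_and]
  constructor
  · rintro ⟨⟨a, b⟩, c⟩
    exact ⟨a, c⟩
  · rintro ⟨a, rfl⟩
    exact ⟨⟨a, hE⟩, rfl⟩

/-- `𝓕` is an extremal family determined by traces on `U`, not determined by traces on
`U \ {p}`, and closed under replacing `p` by other elements of `U`. -/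
structure IsPivotal (k t : ℕ) (𝓕 : Finset (Finset α)) (U : Finset α) (p : α) : Prop where
  extremal : IsExtremal k t 𝓕
  det : ∀ F ∈ 𝓕, ∀ G : Finset α, G.card = k → F ∩ U ⊆ G → G ∈ 𝓕
  mem : p ∈ U
  not_det : ∃ F ∈ 𝓕, ∃ G : Finset α, G.card = k ∧ F ∩ U.erase p ⊆ G ∧ G ∉ 𝓕
  shift : ∀ F ∈ 𝓕, p ∈ F → ∀ x ∈ U, x ∉ F → insert x (F.erase p) ∈ 𝓕
  lt_k : t + 1 ≤ k
  k_le : k ≤ Fintype.card α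
  large : 2 * k + 2 ≤ Fintype.card α + t

lemma inter_gens {k t : ℕ} {𝓕 : Finset (Finset α)} {U : Finset α}
    (h𝓕 : IsNontrivialInter k t 𝓕) (hk : k ≤ Fintype.card α)
    (hn : 2 * k + 1 ≤ Fintype.card α + t) {E B : Finset α} (hE : E ∈ gens k 𝓕 U)
    (hB : B ∈ gens k 𝓕 U) : t ≤ (E ∩ B).card := by
  by_contra! hlt
  rw [mem_gens] at hE hB
  obtain ⟨G₁, G₂, a1, a2, a3, a4, a5⟩ := exists_extensions hk hn hE.2.1 hB.2.1 hlt
  have := h𝓕.inter G₁ (hE.2.2 G₁ a3 a1) G₂ (hB.2.2 G₂ a4 a2)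
  omega

lemma trace_mem_gens {k t : ℕ} {𝓕 : Finset (Finset α)} {U : Finset α}
    (h𝓕 : IsNontrivialInter k t 𝓕)
    (det : ∀ F ∈ 𝓕, ∀ G : Finset α, G.card = k → F ∩ U ⊆ G → G ∈ 𝓕) {F : Finset α}
    (hF : F ∈ 𝓕) : F ∩ U ∈ gens k 𝓕 U :=
  mem_gens.2 ⟨inter_subset_right, (card_le_card inter_subset_left).trans (h𝓕.card_eq F hF).le,
    det F hF⟩

lemma lt_card_of_mem_gens {k t : ℕ} {𝓕 : Finset (Finset α)} {U : Finset α}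
    (h𝓕 : IsNontrivialInter k t 𝓕) (hk : k ≤ Fintype.card α)
    (hn : 2 * k + 1 ≤ Fintype.card α + t)
    (det : ∀ F ∈ 𝓕, ∀ G : Finset α, G.card = k → F ∩ U ⊆ G → G ∈ 𝓕) {E : Finset α}
    (hE : E ∈ gens k 𝓕 U) : t + 1 ≤ E.card := by
  have h1 := inter_gens h𝓕 hk hn hE hE
  rw [inter_self] at h1
  by_contra! hlt
  have hEt : E.card = t := by omega
  obtain ⟨F, hF, hn'⟩ := h𝓕.nontrivial E hEt
  have h2 := inter_gens h𝓕 hk hn hE (trace_mem_gens h𝓕 det hF)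
  have h3 : E ∩ (F ∩ U) = E := eq_of_subset_of_card_le inter_subset_left (by omega)
  exact hn' fun z hz => by
    rw [← h3] at hz
    simp at hz
    exact hz.2.1

namespace IsPivotal

variable {k t : ℕ} {𝓕 : Finset (Finset α)} {U : Finset α} {p : α}

lemma gens_inter (h : IsPivotal k t 𝓕 U p) {E B : Finset α} (hE : E ∈ gens k 𝓕 U)
    (hB : B ∈ gens k 𝓕 U) : t ≤ (E ∩ B).card :=
  inter_gens h.extremal.toIsNontrivialInter h.k_le (by have := h.large; omega) hE hB

lemma gens_card (h : IsPivotal k t 𝓕 U p) {E : Finset α} (hE : E ∈ gens k 𝓕 U) :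
    t + 1 ≤ E.card :=
  lt_card_of_mem_gens h.extremal.toIsNontrivialInter h.k_le (by have := h.large; omega) h.det hE

lemma trace_mem (h : IsPivotal k t 𝓕 U p) {F : Finset α} (hF : F ∈ 𝓕) :
    F ∩ U ∈ gens k 𝓕 U :=
  trace_mem_gens h.extremal.toIsNontrivialInter h.det hF

lemma mem_iff (h : IsPivotal k t 𝓕 U p) {F : Finset α} :
    F ∈ 𝓕 ↔ F.card = k ∧ F ∩ U ∈ gens k 𝓕 U :=
  ⟨fun hF => ⟨h.extremal.card_eq F hF, h.trace_mem hF⟩,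
    fun hF => (mem_gens.1 hF.2).2.2 F hF.1 inter_subset_left⟩

lemma eq_traceFam (h : IsPivotal k t 𝓕 U p) : 𝓕 = traceFam k U (gens k 𝓕 U) := by
  ext F
  rw [h.mem_iff, mem_traceFam]

lemma shift_gens (h : IsPivotal k t 𝓕 U p) {E : Finset α} (hE : E ∈ gens k 𝓕 U)
    (hp : p ∈ E) {x : α} (hx : x ∈ U) (hxE : x ∉ E) : insert x (E.erase p) ∈ gens k 𝓕 U := by
  rw [mem_gens] at hE ⊢
  obtain ⟨h1, h2, h3⟩ := hE
  refine ⟨?_, ?_, fun G hG hs => ?_⟩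
  · intro z hz
    simp only [mem_insert, mem_erase] at hz
    rcases hz with rfl | hz
    exacts [hx, h1 hz.2]
  · rw [card_insert_of_notMem (by simp [hxE]), card_erase_of_mem hp]
    have := card_pos.2 ⟨p, hp⟩
    omega
  · have hxG : x ∈ G := hs (mem_insert_self _ _)
    by_cases hpG : p ∈ G
    · refine h3 G hG fun z hz => ?_
      by_cases hzp : z = p
      · exact hzp ▸ hpG
      · exact hs (by simp [hz, hzp])
    · have hne : x ≠ p := fun h => hpG (h ▸ hxG)
      have h4 := h3 (insert p (G.erase x)) (by
        rw [card_insert_of_notMem (by simp [hpG]), card_erase_of_mem hxG]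
        have := card_pos.2 ⟨x, hxG⟩
        omega) (fun z hz => by
          by_cases hzp : z = p
          · simp [hzp]
          · have : z ≠ x := fun h => hxE (h ▸ hz)
            simp [hzp, this]
            exact hs (by simp [hz, hzp]))
      have h5 := h.shift _ h4 (mem_insert_self _ _) x hx (by simp [hne])
      rwa [erase_insert (by simp [hpG]), insert_erase hxG] at h5

lemma eq_of_erase_inter (h : IsPivotal k t 𝓕 U p) {E B : Finset α} (hE : E ∈ pivots k 𝓕 U p)
    (hB : B ∈ gens k 𝓕 U) (hlt : (E.erase p ∩ B).card < t) :
    B ∈ pivots k 𝓕 U p ∧ E ∪ B = U ∧ (E ∩ B).card = t := by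
  rw [mem_pivots] at hE ⊢
  obtain ⟨hE, hpE, hE'⟩ := hE
  have h1 := h.gens_inter hE hB
  have hpB : p ∈ B := by
    by_contra hpB
    rw [erase_inter, erase_eq_of_notMem (by simp [hpB])] at hlt
    omega
  have hc : (E ∩ B).card = t := by
    rw [erase_inter, card_erase_of_mem (by simp [hpE, hpB])] at hlt
    omega
  refine ⟨⟨hB, hpB, fun hB' => ?_⟩, ?_, hc⟩
  · have h2 := h.gens_inter hE hB'
    rw [inter_erase, ← erase_inter] at h2
    omega
  · refine subset_antisymm (union_subset (mem_gens.1 hE).1 (mem_gens.1 hB).1) fun x hx => ?_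
    by_contra hxn
    simp only [mem_union, not_or] at hxn
    have h2 := h.gens_inter hE (h.shift_gens hB hpB hx hxn.2)
    rw [inter_insert_of_notMem hxn.1, inter_erase, ← erase_inter] at h2
    omega

lemma exists_partner (h : IsPivotal k t 𝓕 U p) {E : Finset α} (hE : E ∈ pivots k 𝓕 U p) :
    ∃ B ∈ pivots k 𝓕 U p, E ∪ B = U ∧ (E ∩ B).card = t := by
  by_contra! hno
  have key : ∀ B ∈ gens k 𝓕 U, t ≤ (E.erase p ∩ B).card := fun B hB => by
    by_contra! hlt
    have := h.eq_of_erase_inter hE hB hlt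
    exact hno B this.1 this.2.1 this.2.2
  rw [mem_pivots] at hE
  obtain ⟨hE, hpE, hE'⟩ := hE
  rw [mem_gens] at hE hE'
  have : ∃ G : Finset α, G.card = k ∧ E.erase p ⊆ G ∧ G ∉ 𝓕 := by
    by_contra! hall
    exact hE' ⟨(erase_subset _ _).trans hE.1, (card_le_card (erase_subset _ _)).trans hE.2.1,
      hall⟩
  obtain ⟨G, hG, hsub, hG𝓕⟩ := this
  have hGF : ∀ F ∈ 𝓕, t ≤ (G ∩ F).card := fun F hF =>
    (key _ (h.trace_mem hF)).trans (card_le_card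
      (inter_subset_inter hsub inter_subset_left))
  have := h.extremal.card_le (insert G 𝓕) ⟨?_, ?_, ?_⟩
  · rw [card_insert_of_notMem hG𝓕] at this
    omega
  · simp only [mem_insert, forall_eq_or_imp]
    exact ⟨hG, h.extremal.card_eq⟩
  · simp only [mem_insert, forall_eq_or_imp]
    refine ⟨⟨by rw [inter_self, hG]; have := h.lt_k; omega, hGF⟩, fun A hA => ⟨?_, ?_⟩⟩
    · rw [inter_comm]; exact hGF A hA
    · exact h.extremal.inter A hA
  · intro T hT
    obtain ⟨F, hF, hn⟩ := h.extremal.nontrivial T hT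
    exact ⟨F, mem_insert_of_mem hF, hn⟩

omit [Fintype α] in
lemma card_add_card {E B : Finset α} (h1 : E ∪ B = U) (h2 : (E ∩ B).card = t) :
    E.card + B.card = U.card + t := by
  rw [← card_union_add_card_inter, h1, h2]

lemma pivots_nonempty (h : IsPivotal k t 𝓕 U p) : (pivots k 𝓕 U p).Nonempty := by
  obtain ⟨F, hF, G, hG, hs, hGF⟩ := h.not_det
  have hpF : p ∈ F := by
    by_contra hp
    refine hGF (h.det F hF G hG ?_)
    rwa [inter_erase, erase_eq_of_notMem (by simp [hp])] at hs
  refine ⟨F ∩ U, mem_pivots.2 ⟨h.trace_mem hF, by simp [hpF, h.mem], fun hm => hGF ?_⟩⟩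
  rw [← inter_erase] at hm
  exact (mem_gens.1 hm).2.2 G hG hs

lemma erase_injOn : Set.InjOn (fun E : Finset α => E.erase p) (pivots k 𝓕 U p : Set _) := by
  intro A hA B hB hAB
  have hA' := (mem_pivots.1 hA).2.1
  have hB' := (mem_pivots.1 hB).2.1
  rw [← insert_erase hA', ← insert_erase hB']
  simp only at hAB
  rw [hAB]

/-- Replacing the pivots in `Q` by the sets `E \ {p}`, `E ∈ S`, keeps the intersection property. If
this makes the family larger, then the new family has a common `t`-subset. -/
lemma exists_common (h : IsPivotal k t 𝓕 U p) {S Q : Finset (Finset α)}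
    (hS : S ⊆ pivots k 𝓕 U p) (hQ : Q ⊆ pivots k 𝓕 U p)
    (hSQ : ∀ E ∈ S, ∀ B ∈ pivots k 𝓕 U p, E ∪ B = U → (E ∩ B).card = t → B ∈ Q)
    (hSS : ∀ E ∈ S, ∀ B ∈ S, E ∪ B = U → (E ∩ B).card ≠ t)
    (hgain : ∑ E ∈ Q, (Fintype.card α - U.card).choose (k - E.card) <
      ∑ E ∈ S, (Fintype.card α - U.card).choose (k - (E.erase p).card)) :
    ∃ T : Finset α, T.card = t ∧ ∀ G : Finset α, G.card = k →
      G ∩ U ∈ (gens k 𝓕 U \ Q) ∪ S.image (fun E => E.erase p) → T ⊆ G := by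
  by_contra! hno
  have hS1 : ∀ E ∈ S, E ∈ gens k 𝓕 U := fun E hE => (mem_pivots.1 (hS hE)).1
  have hQ1 : Q ⊆ gens k 𝓕 U := fun E hE => (mem_pivots.1 (hQ hE)).1
  have hSB : ∀ E ∈ S, ∀ B ∈ gens k 𝓕 U \ Q, t ≤ (E.erase p ∩ B).card := fun E hE B hB => by
    by_contra! hlt
    obtain ⟨a, b, c⟩ := h.eq_of_erase_inter (hS hE) (mem_sdiff.1 hB).1 hlt
    exact (mem_sdiff.1 hB).2 (hSQ E hE B a b c)
  have := h.extremal.card_le (traceFam k U ((gens k 𝓕 U \ Q) ∪ S.image (fun E => E.erase p)))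
    ⟨fun F hF => (mem_traceFam.1 hF).1, ?_, ?_⟩
  · nth_rw 2 [h.eq_traceFam] at this
    rw [card_traceFam, card_traceFam, sum_union, sum_image] at this
    · have h3 := sum_sdiff (f := fun E : Finset α =>
        (Fintype.card α - U.card).choose (k - E.card)) hQ1
      omega
    · exact erase_injOn.mono hS
    · rw [disjoint_right]
      intro E hE hE2
      obtain ⟨E', hE', rfl⟩ := mem_image.1 hE
      exact (mem_pivots.1 (hS hE')).2.2 (mem_sdiff.1 hE2).1
    · exact fun E hE => ⟨(mem_gens.1 hE).1, (mem_gens.1 hE).2.1⟩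
    · intro E hE
      rcases mem_union.1 hE with hE | hE
      · have := mem_gens.1 (mem_sdiff.1 hE).1
        exact ⟨this.1, this.2.1⟩
      · obtain ⟨E', hE', rfl⟩ := mem_image.1 hE
        have := mem_gens.1 (hS1 E' hE')
        exact ⟨(erase_subset _ _).trans this.1, (card_le_card (erase_subset _ _)).trans this.2.1⟩
  · intro A hA B hB
    have hsub : ((A ∩ U) ∩ (B ∩ U)).card ≤ (A ∩ B).card :=
      card_le_card (inter_subset_inter inter_subset_left inter_subset_left)
    refine le_trans ?_ hsub
    have hA := (mem_traceFam.1 hA).2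
    have hB := (mem_traceFam.1 hB).2
    generalize A ∩ U = A' at *
    generalize B ∩ U = B' at *
    rcases mem_union.1 hA with hA | hA <;> rcases mem_union.1 hB with hB | hB
    · exact h.gens_inter (mem_sdiff.1 hA).1 (mem_sdiff.1 hB).1
    · obtain ⟨E, hE, rfl⟩ := mem_image.1 hB
      rw [inter_comm]
      exact hSB E hE _ hA
    · obtain ⟨E, hE, rfl⟩ := mem_image.1 hA
      exact hSB E hE _ hB
    · obtain ⟨E, hE, rfl⟩ := mem_image.1 hA
      obtain ⟨B, hBS, rfl⟩ := mem_image.1 hB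
      by_contra! hlt
      simp only [inter_erase, erase_inter, erase_idem] at hlt
      rw [← erase_inter] at hlt
      obtain ⟨a, b, c⟩ := h.eq_of_erase_inter (hS hE) (hS1 B hBS) hlt
      exact hSS E hE B hBS b c
  · intro T hT
    obtain ⟨G, hG, hG2, hTG⟩ := hno T hT
    exact ⟨G, mem_traceFam.2 ⟨hG, hG2⟩, hTG⟩

/-- A member not containing the common `t`-set has a trace in `Q` which misses at most one point. -/
lemma trace_mem_of_not_subset (h : IsPivotal k t 𝓕 U p) {S Q : Finset (Finset α)} {T : Finset α}
    (hQ : Q ⊆ pivots k 𝓕 U p)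
    (hT : ∀ G : Finset α, G.card = k →
      G ∩ U ∈ (gens k 𝓕 U \ Q) ∪ S.image (fun E => E.erase p) → T ⊆ G)
    {F : Finset α} (hF : F ∈ 𝓕) (hTF : ¬ T ⊆ F) :
    F ∩ U ∈ Q ∧ ∀ x ∈ U, x ∉ F → x ∈ T ∧ p ∉ T ∧ U.erase x ⊆ F := by
  have hFc := h.extremal.card_eq F hF
  have hFQ : F ∩ U ∈ Q := by
    by_contra hn
    exact hTF (hT F hFc (mem_union_left _ (mem_sdiff.2 ⟨h.trace_mem hF, hn⟩)))
  have hpF : p ∈ F := (mem_inter.1 (mem_pivots.1 (hQ hFQ)).2.1).1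
  have key : ∀ x ∈ U, x ∉ F → T ⊆ insert x (F.erase p) := fun x hx hxF => by
    have hm := h.shift F hF hpF x hx hxF
    refine hT _ (h.extremal.card_eq _ hm) (mem_union_left _ (mem_sdiff.2 ⟨h.trace_mem hm, ?_⟩))
    intro hmQ
    have := (mem_inter.1 (mem_pivots.1 (hQ hmQ)).2.1).1
    simp at this
    exact hxF (this ▸ hpF)
  refine ⟨hFQ, fun x hx hxF => ⟨?_, ?_, ?_⟩⟩
  · by_contra hxT
    refine hTF fun z hz => ?_
    have := key x hx hxF hz
    simp at this
    rcases this with rfl | this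
    exacts [absurd hz hxT, this.2]
  · intro hpT
    have := key x hx hxF hpT
    simp at this
    exact hxF (this ▸ hpF)
  · intro y hy
    simp only [mem_erase] at hy
    by_contra hyF
    refine hTF fun z hz => ?_
    have h1 := key x hx hxF hz
    have h2 := key y hy.2 hyF hz
    simp at h1 h2
    grind

end IsPivotal

lemma isNontrivialInter_hilt {k t : ℕ} {T D : Finset α} (ht : 1 ≤ t) (hTD : T ⊆ D)
    (hT : T.card = t) (hD : t + 2 ≤ D.card) (hDk : D.card ≤ k + 1)
    (hk : k + 1 ≤ Fintype.card α) : IsNontrivialInter k t (hilt k T D) := by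
  have hDT : (D \ T).card = D.card - t := by rw [card_sdiff_of_subset hTD, hT]
  refine ⟨fun F hF => (mem_hilt.1 hF).1, ?_, ?_⟩
  · have mixed : ∀ A B : Finset α, T ⊆ A → (A ∩ (D \ T)).Nonempty → ∀ x ∈ T, D.erase x ⊆ B →
        t ≤ (A ∩ B).card := by
      rintro A B h1 ⟨y, hy⟩ x hx h2
      have hs : insert y (T.erase x) ⊆ A ∩ B := by
        intro z hz
        simp only [mem_insert, mem_erase, mem_inter, mem_sdiff] at hz hy ⊢
        rcases hz with rfl | hz
        · exact ⟨hy.1, h2 (mem_erase.2 ⟨fun h => hy.2.2 (h ▸ hx), hy.2.1⟩)⟩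
        · exact ⟨h1 hz.2, h2 (mem_erase.2 ⟨hz.1, hTD hz.2⟩)⟩
      have := card_le_card hs
      rw [card_insert_of_notMem, card_erase_of_mem hx, hT] at this
      · omega
      · simp only [mem_inter, mem_sdiff] at hy
        simp [hy.2.2]
    intro A hA B hB
    rcases (mem_hilt.1 hA).2 with ⟨a1, a2⟩ | ⟨x, hx, a⟩ <;>
      rcases (mem_hilt.1 hB).2 with ⟨b1, b2⟩ | ⟨y, hy, b⟩
    · rw [← hT]
      exact card_le_card (subset_inter a1 b1)
    · exact mixed A B a1 a2 y hy b
    · rw [inter_comm]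
      exact mixed B A b1 b2 x hx a
    · have hs : (D.erase x).erase y ⊆ A ∩ B := fun z hz => by
        simp only [mem_erase] at hz
        exact mem_inter.2 ⟨a (mem_erase.2 hz.2), b (mem_erase.2 ⟨hz.1, hz.2.2⟩)⟩
      have h1 := card_le_card hs
      have h2 := pred_card_le_card_erase (s := D.erase x) (a := y)
      have h3 := pred_card_le_card_erase (s := D) (a := x)
      omega
  · intro X hX
    obtain ⟨z, hz⟩ : X.Nonempty := card_pos.1 (by omega)
    have avoid : ∀ E : Finset α, z ∉ E → E.card ≤ k →
        ∃ F : Finset α, F.card = k ∧ E ⊆ F ∧ z ∉ F := fun E hE hEk => by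
      obtain ⟨F, a1, a2, a3⟩ := exists_subsuperset_card_eq
        (s := E) (t := univ.erase z) (fun w hw => by
          simp only [mem_erase, mem_univ, and_true]
          rintro rfl
          exact hE hw) hEk
        (by rw [card_erase_of_mem (mem_univ z), card_univ]; omega)
      exact ⟨F, a3, a1, fun h => by simpa using a2 h⟩
    by_cases hzT : z ∈ T
    · obtain ⟨F, a1, a2, a3⟩ := avoid (D.erase z) (by simp)
        (by rw [card_erase_of_mem (hTD hzT)]; omega)
      exact ⟨F, mem_hilt.2 ⟨a1, Or.inr ⟨z, hzT, a2⟩⟩, fun h => a3 (h hz)⟩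
    · obtain ⟨a, ha, haz⟩ := exists_mem_ne (s := D \ T) (by omega) z
      obtain ⟨F, a1, a2, a3⟩ := avoid (insert a T) (by simp [hzT, Ne.symm haz])
        (by rw [card_insert_of_notMem (mem_sdiff.1 ha).2]; omega)
      exact ⟨F, mem_hilt.2 ⟨a1, Or.inl ⟨(subset_insert _ _).trans a2,
        a, mem_inter.2 ⟨a2 (mem_insert_self _ _), ha⟩⟩⟩, fun h => a3 (h hz)⟩

lemma IsExtremal.eq_hilt_of_subset {k t : ℕ} {𝓕 : Finset (Finset α)} (h : IsExtremal k t 𝓕)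
    {T D : Finset α} (ht : 1 ≤ t) (hTD : T ⊆ D)
    (hT : T.card = t) (hD : t + 2 ≤ D.card) (hDk : D.card ≤ k + 1)
    (hk : k + 1 ≤ Fintype.card α) (hsub : 𝓕 ⊆ hilt k T D) : 𝓕 = hilt k T D :=
  eq_of_subset_of_card_le hsub (h.card_le _ (isNontrivialInter_hilt ht hTD hT hD hDk hk))

lemma choose_gain {a b M u v : ℕ} (ha : 0 < a) (_ : 0 < b) (hM : u + v + 2 ≤ M) :
    b * M.choose v < a * M.choose (u + 1) ∨ a * M.choose u < b * M.choose (v + 1) := by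
  by_contra! hc
  obtain ⟨h1, h2⟩ := hc
  have e1 := Nat.choose_succ_right_eq M u
  have e2 := Nat.choose_succ_right_eq M v
  have p1 : 0 < a * M.choose u := Nat.mul_pos ha (Nat.choose_pos (by omega))
  have q1 : M.choose u * (v + 2) ≤ M.choose (u + 1) * (u + 1) := by
    rw [e1]; exact Nat.mul_le_mul_left _ (by omega)
  have q2 : M.choose v * (u + 2) ≤ M.choose (v + 1) * (v + 1) := by
    rw [e2]; exact Nat.mul_le_mul_left _ (by omega)
  have r1 := Nat.mul_le_mul_left a q1
  have r2 := Nat.mul_le_mul_left b q2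
  have r3 := Nat.mul_le_mul_right (u + 1) h1
  have r4 := Nat.mul_le_mul_right (v + 1) h2
  nlinarith

lemma choose_gain_balanced {c s M u t r : ℕ} (hc : 0 < c) (ht : 1 ≤ t) (hr : 2 ≤ r)
    (hsc : s ≤ c) (hM : u ≤ M) (hs : r * c ≤ (t + 2 * r - 1) * s)
    (hn : (t + 3) * (r + u + 1) < 2 * M + 2 * t + 4 * r) :
    (c - s) * M.choose u < s * M.choose (u + 1) := by
  obtain ⟨t, rfl⟩ := Nat.exists_eq_add_of_le' ht
  obtain ⟨r, rfl⟩ := Nat.exists_eq_add_of_le' hr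
  obtain ⟨w, rfl⟩ := Nat.exists_eq_add_of_le hsc
  rw [Nat.add_sub_cancel_left]
  have e : t + 1 + 2 * (r + 2) - 1 = t + 2 * r + 4 := by omega
  rw [e] at hs
  have key : (t + 2 * r + 4) * (u + 1) < (r + 2) * (M + 1) := by
    have h0 : (t + 4) * (u + 1) + t * r < 2 * (M + 1) := by linarith
    have h1 : (r + 2) * ((t + 4) * (u + 1) + t * r) < (r + 2) * (2 * (M + 1)) := by gcongr
    linarith [Nat.zero_le (t * r * u), Nat.zero_le (t * r), Nat.zero_le (t * r * r)]
  have h1 : (s + w) * (u + 1) < s * (M + 1) := by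
    have a1 := Nat.mul_lt_mul_of_pos_left key hc
    have a2 := Nat.mul_le_mul_right (M + 1) hs
    refine Nat.lt_of_mul_lt_mul_left (a := t + 2 * r + 4) ?_
    nlinarith
  have hp : 0 < M.choose u := Nat.choose_pos hM
  have h2 : (M + 1) * M.choose u = (M + 1).choose (u + 1) * (u + 1) :=
    Nat.add_one_mul_choose_eq M u
  rw [Nat.choose_succ_succ] at h2
  have h3 := Nat.mul_lt_mul_of_pos_right h1 hp
  refine Nat.lt_of_mul_lt_mul_left (a := u + 1) ?_
  have h4 : s * ((M + 1) * M.choose u) = s * ((M.choose u + M.choose (u + 1)) * (u + 1)) := by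
    rw [h2]
  nlinarith

namespace IsPivotal

variable {k t : ℕ} {𝓕 : Finset (Finset α)} {U : Finset α} {p : α}

lemma eq_hilt_of_gain (h : IsPivotal k t 𝓕 U p) (ht : 1 ≤ t) (hU : t + 3 ≤ U.card) {i j : ℕ}
    (hij : i + j = U.card + t) (hne : i ≠ j)
    (hi : ((pivots k 𝓕 U p).filter fun E => E.card = i).Nonempty)
    (hgain : ((pivots k 𝓕 U p).filter fun E => E.card = j).card *
        (Fintype.card α - U.card).choose (k - j) <
      ((pivots k 𝓕 U p).filter fun E => E.card = i).card *
        (Fintype.card α - U.card).choose (k - i + 1)) :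
    ∃ T ⊆ U, T.card = t ∧ U.card ≤ k + 1 ∧ 𝓕 = hilt k T U := by
  obtain ⟨T, hT, hTG⟩ := h.exists_common
    (S := (pivots k 𝓕 U p).filter fun E => E.card = i)
    (Q := (pivots k 𝓕 U p).filter fun E => E.card = j) (filter_subset _ _) (filter_subset _ _)
    (fun E hE B hB h1 h2 => by
      have h3 := card_add_card h1 h2
      rw [mem_filter] at hE ⊢
      exact ⟨hB, by omega⟩)
    (fun E hE B hB h1 h2 => by
      have h3 := card_add_card h1 h2
      rw [mem_filter] at hE hB
      omega)
    (by
      rw [sum_congr rfl (g := fun _ => (Fintype.card α - U.card).choose (k - j))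
          (fun E hE => by rw [(mem_filter.1 hE).2]),
        sum_congr rfl (s₁ := (pivots k 𝓕 U p).filter fun E => E.card = i)
          (g := fun _ => (Fintype.card α - U.card).choose (k - i + 1)) (fun E hE => ?_)]
      · simpa using hgain
      · obtain ⟨hE, hEi⟩ := mem_filter.1 hE
        obtain ⟨hE, hpE, -⟩ := mem_pivots.1 hE
        have := card_pos.2 ⟨p, hpE⟩
        have := (mem_gens.1 hE).2.1
        rw [card_erase_of_mem hpE]
        congr 1
        omega)
  have hlarge := h.large
  obtain ⟨B, hB⟩ := hi
  obtain ⟨hB, hBi⟩ := mem_filter.1 hB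
  have hBg := (mem_pivots.1 hB).1
  have hpB := (mem_pivots.1 hB).2.1
  have hit := h.gens_card hBg
  have hBE : (B.erase p).card = i - 1 := by rw [card_erase_of_mem hpB, hBi]
  have missing : ∀ F ∈ 𝓕, ¬ T ⊆ F → (F ∩ U).card = j ∧
      ∃ x ∈ U, x ∉ F ∧ x ∈ T ∧ U.erase x ⊆ F := fun F hF hTF => by
    obtain ⟨h1, h2⟩ := h.trace_mem_of_not_subset (filter_subset _ _) hTG hF hTF
    have h3 := (mem_filter.1 h1).2
    obtain ⟨x, hx, hxF⟩ := exists_mem_notMem_of_card_lt_card (s := F ∩ U) (t := U) (by omega)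
    have hxF' : x ∉ F := fun h => hxF (mem_inter.2 ⟨h, hx⟩)
    exact ⟨h3, x, hx, hxF', (h2 x hx hxF').1, (h2 x hx hxF').2.2⟩
  obtain ⟨F, hF, hTF⟩ := h.extremal.nontrivial T hT
  obtain ⟨hFj, x, hx, hxF, hxT, hsub⟩ := missing F hF hTF
  have hFx : F ∩ U = U.erase x := by
    ext z
    have := @hsub z
    simp at this ⊢
    grind
  have hj : U.card = j + 1 := by
    rw [hFx, card_erase_of_mem hx] at hFj
    have := card_pos.2 ⟨x, hx⟩
    omega
  have hjk : j ≤ k := by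
    rw [← hFj, ← h.extremal.card_eq F hF]
    exact card_le_card inter_subset_left
  have hTB : T ⊆ B.erase p := fun q hq => by
    by_contra hqB
    obtain ⟨G, g1, g2, g3⟩ := exists_trace_avoiding (k := k) (U := U) (E := B.erase p) (p := q)
      ((erase_subset _ _).trans (mem_gens.1 hBg).1) (by have := h.lt_k; omega) hqB (by omega)
    refine g3 (hTG G g1 (mem_union_right _ ?_) hq)
    rw [g2]
    exact mem_image_of_mem (fun E : Finset α => E.erase p) (mem_filter.2 ⟨hB, hBi⟩)
  have hTU : T ⊆ U := hTB.trans ((erase_subset _ _).trans (mem_gens.1 hBg).1)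
  refine ⟨T, hTU, hT, by omega, h.extremal.eq_hilt_of_subset ht hTU hT (by omega) (by omega)
    (by have := h.lt_k; omega) fun A hA => mem_hilt.2 ⟨h.extremal.card_eq A hA, ?_⟩⟩
  by_cases hTA : T ⊆ A
  · refine Or.inl ⟨hTA, ?_⟩
    by_contra hemp
    rw [not_nonempty_iff_eq_empty] at hemp
    have h1 := h.gens_inter (h.trace_mem hA) (h.trace_mem hF)
    have h2 : (A ∩ U) ∩ (F ∩ U) ⊆ T.erase x := fun z hz => by
      simp only [mem_inter] at hz
      have hzT : z ∈ T := by
        by_contra hzT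
        have : z ∈ A ∩ (U \ T) := by simp [hz, hzT]
        simp [hemp] at this
      exact mem_erase.2 ⟨fun h => hxF (h ▸ hz.2.1), hzT⟩
    have h3 := card_le_card h2
    rw [card_erase_of_mem hxT] at h3
    omega
  · obtain ⟨-, y, -, -, hyT, hys⟩ := missing A hA hTA
    exact Or.inr ⟨y, hyT, hys⟩

lemma not_balanced (h : IsPivotal k t 𝓕 U p) (ht : 1 ≤ t) (hU : t + 3 ≤ U.card)
    (hn : (t + 3) * (k + 1) < 2 * Fintype.card α + (t + 3) * t) {i : ℕ}
    (hij : i + i = U.card + t)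
    (hi : ((pivots k 𝓕 U p).filter fun E => E.card = i).Nonempty) : False := by
  set R := (pivots k 𝓕 U p).filter fun E => E.card = i with hR
  have hRi : ∀ E ∈ R, E ⊆ U ∧ p ∈ E ∧ E.card = i ∧ i ≤ k := fun E hE => by
    obtain ⟨hE, hEi⟩ := mem_filter.1 hE
    obtain ⟨hE, hpE, -⟩ := mem_pivots.1 hE
    obtain ⟨a, b, -⟩ := mem_gens.1 hE
    exact ⟨a, hpE, hEi, hEi ▸ b⟩
  have hUp : (U.erase p).card = U.card - 1 := card_erase_of_mem h.mem
  obtain ⟨m, hm, hms⟩ : ∃ m ∈ U.erase p, (i - t) * R.card ≤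
      (U.erase p).card * (R.filter fun E => m ∉ E).card := by
    have hcount : ∑ m ∈ U.erase p, (R.filter fun E => m ∉ E).card = (i - t) * R.card := by
      have h1 := sum_card_bipartiteAbove_eq_sum_card_bipartiteBelow (s := U.erase p) (t := R)
        (fun (m : α) (E : Finset α) => m ∉ E)
      simp only [bipartiteAbove, bipartiteBelow] at h1
      rw [h1, sum_congr rfl (g := fun _ => i - t), sum_const, smul_eq_mul, mul_comm]
      intro E hE
      obtain ⟨a, b, c, d⟩ := hRi E hE
      have : ((U.erase p).filter fun m => m ∉ E) = U \ E := by
        ext z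
        simp only [mem_filter, mem_erase, mem_sdiff]
        grind
      rw [this, card_sdiff_of_subset a, c]
      omega
    by_contra! hlt
    have h2 : ∑ m ∈ U.erase p, (U.erase p).card * (R.filter fun E => m ∉ E).card <
        ∑ m ∈ U.erase p, (i - t) * R.card :=
      sum_lt_sum_of_nonempty (card_pos.1 (by omega)) hlt
    rw [← mul_sum, hcount, sum_const, smul_eq_mul] at h2
    exact lt_irrefl _ h2
  have hmU : m ∈ U := mem_of_mem_erase hm
  obtain ⟨E₀, hE₀⟩ := hi
  have hik := (hRi E₀ hE₀).2.2.2
  have hlarge := h.large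
  have hUn := card_le_univ U
  obtain ⟨T, hT, hTG⟩ := h.exists_common (S := R.filter fun E => m ∉ E)
    (Q := R \ R.filter fun E => m ∉ E)
    ((filter_subset _ _).trans (filter_subset _ _)) (sdiff_subset.trans (filter_subset _ _))
    (fun E hE B hB h1 h2 => by
      have h3 := card_add_card h1 h2
      obtain ⟨hE, hmE⟩ := mem_filter.1 hE
      have := (hRi E hE).2.2.1
      rw [← h1, mem_union] at hmU
      exact mem_sdiff.2 ⟨mem_filter.2 ⟨hB, by omega⟩, fun hB' =>
        (mem_filter.1 hB').2 (hmU.resolve_left hmE)⟩)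
    (fun E hE B hB h1 h2 => by
      rw [← h1, mem_union] at hmU
      exact hmU.elim (mem_filter.1 hE).2 (mem_filter.1 hB).2)
    (by
      rw [sum_congr rfl (g := fun _ => (Fintype.card α - U.card).choose (k - i))
          (fun E hE => by rw [(hRi E (mem_sdiff.1 hE).1).2.2.1]),
        sum_congr rfl (s₁ := R.filter fun E => m ∉ E)
          (g := fun _ => (Fintype.card α - U.card).choose (k - i + 1)) (fun E hE => ?_)]
      · rw [sum_const, sum_const, smul_eq_mul, smul_eq_mul,
          card_sdiff_of_subset (filter_subset _ _)]
        refine choose_gain_balanced (t := t) (r := i - t) (card_pos.2 ⟨E₀, hE₀⟩) ht (by omega)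
          (card_le_card (filter_subset _ _)) (by omega) ?_ ?_
        · have : t + 2 * (i - t) - 1 = (U.erase p).card := by omega
          rwa [this]
        · have e1 : i - t + (k - i) + 1 = k + 1 - t := by omega
          rw [e1, Nat.mul_sub]
          have : (t + 3) * t ≤ (t + 3) * (k + 1) :=
            Nat.mul_le_mul_left _ (by have := h.lt_k; omega)
          omega
      · obtain ⟨hE, -⟩ := mem_filter.1 hE
        obtain ⟨-, hpE, hEi, -⟩ := hRi E hE
        have := card_pos.2 ⟨p, hpE⟩
        rw [card_erase_of_mem hpE]
        congr 1
        omega)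
  obtain ⟨F, hF, hTF⟩ := h.extremal.nontrivial T hT
  obtain ⟨h1, h2⟩ := h.trace_mem_of_not_subset (sdiff_subset.trans (filter_subset _ _)) hTG hF hTF
  have h3 := (hRi _ (mem_sdiff.1 h1).1).2.2.1
  have h4 : 1 < (U \ F).card := by
    have := card_sdiff_add_card_inter U F
    rw [inter_comm] at this
    omega
  obtain ⟨x, hx, y, hy, hxy⟩ := one_lt_card.1 h4
  rw [mem_sdiff] at hx hy
  exact hy.2 ((h2 x hx.1 hx.2).2.2 (mem_erase.2 ⟨hxy.symm, hy.1⟩))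

theorem eq_hilt (h : IsPivotal k t 𝓕 U p) (ht : 1 ≤ t) (hU : t + 3 ≤ U.card)
    (hn : (t + 3) * (k + 1) < 2 * Fintype.card α + (t + 3) * t) :
    ∃ T ⊆ U, T.card = t ∧ U.card ≤ k + 1 ∧ 𝓕 = hilt k T U := by
  obtain ⟨E, hE⟩ := h.pivots_nonempty
  obtain ⟨B, hB, h1, h2⟩ := h.exists_partner hE
  have h3 := card_add_card h1 h2
  have hEk := (mem_gens.1 (mem_pivots.1 hE).1).2.1
  have hBk := (mem_gens.1 (mem_pivots.1 hB).1).2.1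
  have hEn : ((pivots k 𝓕 U p).filter fun F => F.card = E.card).Nonempty :=
    ⟨E, mem_filter.2 ⟨hE, rfl⟩⟩
  have hBn : ((pivots k 𝓕 U p).filter fun F => F.card = B.card).Nonempty :=
    ⟨B, mem_filter.2 ⟨hB, rfl⟩⟩
  have hlarge := h.large
  by_cases hEB : E.card = B.card
  · exact (h.not_balanced ht hU hn (i := E.card) (by omega) hEn).elim
  · rcases choose_gain (card_pos.2 hEn) (card_pos.2 hBn) (M := Fintype.card α - U.card)
      (u := k - E.card) (v := k - B.card) (by omega) with hg | hg
    · exact h.eq_hilt_of_gain ht hU h3 hEB hEn hg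
    · exact h.eq_hilt_of_gain ht hU (by omega) (Ne.symm hEB) hBn hg

end IsPivotal

lemma IsExtremal.eq_hilt_of_det {k t : ℕ} {𝓕 : Finset (Finset α)} {U : Finset α}
    (h : IsExtremal k t 𝓕) (ht : 1 ≤ t) (hk : t + 1 ≤ k) (hkn : k + 1 ≤ Fintype.card α)
    (hn : 2 * k + 2 ≤ Fintype.card α + t)
    (det : ∀ F ∈ 𝓕, ∀ G : Finset α, G.card = k → F ∩ U ⊆ G → G ∈ 𝓕) (hU : U.card = t + 2) :
    ∃ T ⊆ U, T.card = t ∧ 𝓕 = hilt k T U := by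
  obtain ⟨T, hTU, hT⟩ := exists_subset_card_eq (s := U) (n := t) (by omega)
  refine ⟨T, hTU, hT, h.eq_hilt_of_subset ht hTU hT hU.ge (by omega) hkn fun F hF => ?_⟩
  have h1 := lt_card_of_mem_gens h.toIsNontrivialInter (by omega) (by omega) det
    (trace_mem_gens h.toIsNontrivialInter det hF)
  refine mem_hilt.2 ⟨h.card_eq F hF, ?_⟩
  have hUF : (U \ F).card ≤ 1 := by
    have := card_sdiff_add_card_inter U F
    rw [inter_comm] at this
    omega
  by_cases hTF : T ⊆ F
  · left
    refine ⟨hTF, ?_⟩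
    have h2 : T.card < (F ∩ U).card := by omega
    obtain ⟨z, hz, hzT⟩ := exists_mem_notMem_of_card_lt_card h2
    rw [mem_inter] at hz
    exact ⟨z, by simp [hz, hzT]⟩
  · right
    obtain ⟨x, hxT, hxF⟩ := not_subset.1 hTF
    refine ⟨x, hxT, fun z hz => ?_⟩
    rw [mem_erase] at hz
    by_contra hzF
    exact hz.1 (card_le_one.1 hUF z (mem_sdiff.2 ⟨hz.2, hzF⟩) x (mem_sdiff.2 ⟨hTU hxT, hxF⟩))

lemma card_filter_rank_lt {β : Type*} [Fintype β] (e : β ≃ Fin (Fintype.card β)) {ℓ : ℕ} (hℓ : ℓ ≤ Fintype.card β) :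
    (univ.filter fun x => (e x : ℕ) < ℓ).card = ℓ := by
  rw [← card_map e.toEmbedding]
  have : (univ.filter fun x => (e x : ℕ) < ℓ).map e.toEmbedding =
      univ.filter fun i : Fin (Fintype.card β) => (i : ℕ) < ℓ := by
    ext i
    simp only [mem_map, mem_filter, mem_univ, true_and, Equiv.coe_toEmbedding]
    exact ⟨fun ⟨x, hx, hxi⟩ => hxi ▸ hx, fun hi => ⟨e.symm i, by simpa using hi, by simp⟩⟩
  rw [this, Fin.card_filter_val_lt]
  omega

lemma IsExtremal.eq_hilt_of_ordered {k t : ℕ} {𝓕 : Finset (Finset α)}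
    (h : IsExtremal k t 𝓕) (ht : 1 ≤ t) (hk : t + 1 ≤ k) (hkn : k + 1 ≤ Fintype.card α)
    (hn : 2 * k + 2 ≤ Fintype.card α + t)
    (hn' : (t + 3) * (k + 1) < 2 * Fintype.card α + (t + 3) * t)
    (e : α ≃ Fin (Fintype.card α))
    (hs : ∀ x y, e x < e y → t + 2 ≤ (e y : ℕ) → ∀ F ∈ 𝓕, y ∈ F → x ∉ F →
      insert x (F.erase y) ∈ 𝓕) :
    ∃ T D : Finset α, T ⊆ D ∧ T.card = t ∧ t + 2 ≤ D.card ∧ D.card ≤ k + 1 ∧ 𝓕 = hilt k T D := by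
  let U : ℕ → Finset α := fun ℓ => univ.filter fun x => (e x : ℕ) < ℓ
  let P : ℕ → Prop := fun ℓ => t + 2 ≤ ℓ ∧ ℓ ≤ Fintype.card α ∧
    ∀ F ∈ 𝓕, ∀ G : Finset α, G.card = k → F ∩ U ℓ ⊆ G → G ∈ 𝓕
  have hex : ∃ ℓ, P ℓ := by
    refine ⟨Fintype.card α, by omega, le_rfl, fun F hF G hG hs => ?_⟩
    have : U (Fintype.card α) = univ := by simp [U]
    rw [this, inter_univ] at hs
    rwa [← eq_of_subset_of_card_le hs (by rw [hG, h.card_eq F hF])]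
  classical
  obtain ⟨h1, h2, h3⟩ := Nat.find_spec hex
  have hmin := fun m => Nat.find_min hex (m := m)
  set ℓ := Nat.find hex
  have hcard : (U ℓ).card = ℓ := card_filter_rank_lt e h2
  rcases Nat.eq_or_lt_of_le h1 with h4 | h4
  · obtain ⟨T, a, b, c⟩ := h.eq_hilt_of_det ht hk hkn hn h3 (by omega)
    exact ⟨T, U ℓ, a, b, by omega, by omega, c⟩
  · have hlt : ℓ - 1 < Fintype.card α := by omega
    set p : α := e.symm ⟨ℓ - 1, hlt⟩ with hp
    have hep : (e p : ℕ) = ℓ - 1 := by simp [hp]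
    have hU : (U ℓ).erase p = U (ℓ - 1) := by
      ext x
      have : x = p ↔ (e x : ℕ) = ℓ - 1 := by
        rw [hp, Equiv.eq_symm_apply, Fin.ext_iff]
      simp only [U, mem_erase, mem_filter, mem_univ, true_and, ne_eq, this]
      omega
    have hpiv : IsPivotal k t 𝓕 (U ℓ) p := by
      refine ⟨h, h3, by simp [U, hep]; omega, ?_, ?_, hk, by omega, hn⟩
      · by_contra! hc
        refine hmin (ℓ - 1) (by omega) ⟨by omega, by omega, fun F hF G hG hs => ?_⟩
        exact hc F hF G hG (by rwa [hU])
      · intro F hF hpF x hx hxF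
        refine hs x p ?_ (by omega) F hF hpF hxF
        have h5 : x ≠ p := by rintro rfl; exact hxF hpF
        have h6 : x ∈ U (ℓ - 1) := hU ▸ mem_erase.2 ⟨h5, hx⟩
        simp only [U, mem_filter, mem_univ, true_and] at h6
        rw [Fin.lt_def]
        omega
    obtain ⟨T, a, b, c, d⟩ := hpiv.eq_hilt ht (by omega) hn'
    exact ⟨T, U ℓ, a, b, by omega, c, d⟩

lemma choose_le_contra {t p q m : ℕ} (hm : p + q + 2 ≤ m + 1)
    (h1 : m.choose p ≤ t * m.choose q)
    (h2 : t * (m + 1).choose (q + 1) ≤ (m + 1).choose p) : False := by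
  have e1 := Nat.add_one_mul_choose_eq m q
  have e2 := Nat.choose_mul_succ_eq m p
  obtain ⟨r, hr⟩ : ∃ r, m + 1 - p = q + 1 + (r + 1) := ⟨m - p - q - 1, by omega⟩
  rw [hr] at e2
  have hp : 0 < (m + 1).choose p := Nat.choose_pos (by omega)
  have a1 := Nat.mul_le_mul_right (m + 1) h1
  have a2 := Nat.mul_le_mul_right (q + 1) h2
  have a3 : t * m.choose q * (m + 1) = t * (m + 1).choose (q + 1) * (q + 1) := by
    rw [mul_assoc, mul_comm (m.choose q), e1, mul_assoc]
  have a4 : (m + 1).choose p * (q + 1) < (m + 1).choose p * (q + 1 + (r + 1)) :=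
    Nat.mul_lt_mul_of_pos_left (by omega) hp
  omega

lemma card_hilt_insert_sdiff {k : ℕ} {T D : Finset α} {y : α} (hTD : T ⊂ D) (hy : y ∉ D)
    (hk : T.card + 1 ≤ k) : (hilt k T (insert y D) \ hilt k T D).card =
      (Fintype.card α - (D.card + 1)).choose (k - (T.card + 1)) := by
  have hyT : y ∉ T := fun h => hy (hTD.1 h)
  have e : hilt k T (insert y D) \ hilt k T D = traceFam k (insert y D) {insert y T} := by
    ext F
    rw [mem_sdiff, mem_hilt, mem_hilt, mem_traceFam, mem_singleton]
    obtain ⟨z, hzD, hzT⟩ := exists_of_ssubset hTD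
    constructor
    · rintro ⟨⟨h1, h2⟩, h3⟩
      refine ⟨h1, ?_⟩
      simp only [h1, true_and, not_or, not_and, not_exists, not_nonempty_iff_eq_empty] at h3
      rcases h2 with ⟨h2, w, hw⟩ | ⟨x, hx, h2⟩
      · have h4 := eq_empty_iff_forall_notMem.1 (h3.1 h2)
        have h5 : y ∈ F := by
          have := h4 w
          simp only [mem_inter, mem_sdiff, mem_insert] at hw this
          grind
        ext v
        have h6 := h4 v
        have h7 := @h2 v
        have h8 := @hTD.1 v
        simp only [mem_inter, mem_sdiff, mem_insert] at h6 ⊢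
        grind
      · exact absurd ((erase_subset_erase x (subset_insert y D)).trans h2) (h3.2 x hx)
    · rintro ⟨h1, h2⟩
      have h3 : ∀ v, (v ∈ F ∧ (v = y ∨ v ∈ D)) ↔ (v = y ∨ v ∈ T) := fun v => by
        have := congrArg (v ∈ ·) h2
        simpa using this
      have h4 : T ⊆ F := fun v hv => ((h3 v).2 (Or.inr hv)).1
      refine ⟨⟨h1, Or.inl ⟨h4, y, ?_⟩⟩, ?_⟩
      · have := (h3 y).2 (Or.inl rfl)
        simp [this.1, hyT]
      · rintro ⟨-, ⟨-, w, hw⟩ | ⟨x, hx, h5⟩⟩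
        · have := h3 w
          simp only [mem_inter, mem_sdiff] at hw
          grind
        · have h6 := h3 z
          have h7 := @h5 z
          rw [mem_erase] at h7
          grind
  have hc : (insert y T).card = T.card + 1 := card_insert_of_notMem hyT
  rw [e, card_traceFam, sum_singleton, hc, card_insert_of_notMem hy]
  rintro E hE
  rw [mem_singleton.1 hE, hc]
  exact ⟨insert_subset_insert _ hTD.1, hk⟩

lemma card_hilt_sdiff_insert {k : ℕ} {T D : Finset α} {y : α} (hTD : T ⊂ D) (hy : y ∉ D)
    (hk : D.card - 1 ≤ k) : (hilt k T D \ hilt k T (insert y D)).card =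
      T.card * (Fintype.card α - (D.card + 1)).choose (k - (D.card - 1)) := by
  have e : hilt k T D \ hilt k T (insert y D) =
      traceFam k (insert y D) (T.image fun x => D.erase x) := by
    ext F
    rw [mem_sdiff, mem_hilt, mem_hilt, mem_traceFam, mem_image]
    obtain ⟨z, hzD, hzT⟩ := exists_of_ssubset hTD
    constructor
    · rintro ⟨⟨h1, h2⟩, h3⟩
      refine ⟨h1, ?_⟩
      simp only [h1, true_and, not_or, not_and, not_exists] at h3
      rcases h2 with ⟨h2, w, hw⟩ | ⟨x, hx, h2⟩
      · refine absurd ⟨w, ?_⟩ (h3.1 h2)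
        simp only [mem_inter, mem_sdiff, mem_insert] at hw ⊢
        tauto
      · refine ⟨x, hx, ?_⟩
        have h4 : ∀ v, v ∈ D → v ≠ x → v ∈ F := fun v h h' => h2 (mem_erase.2 ⟨h', h⟩)
        have h5 : x ∉ F := fun hxF => h3.1 (fun v hv => by
          by_cases hvx : v = x
          · exact hvx ▸ hxF
          · exact h4 v (hTD.1 hv) hvx) ⟨z, by
            simp only [mem_inter, mem_sdiff, mem_insert]
            exact ⟨h4 z hzD (fun h => hzT (h ▸ hx)), Or.inr hzD, hzT⟩⟩
        have h6 : y ∉ F := fun hyF => h3.2 x hx fun v hv => by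
          simp only [mem_erase, mem_insert] at hv
          rcases hv with ⟨h7, rfl | h8⟩
          · exact hyF
          · exact h4 v h8 h7
        ext v
        have := h4 v
        simp only [mem_inter, mem_erase, mem_insert]
        grind
    · rintro ⟨h1, x, hx, h2⟩
      have h3 : ∀ v, (v ≠ x ∧ v ∈ D) ↔ (v ∈ F ∧ (v = y ∨ v ∈ D)) := fun v => by
        have := congrArg (v ∈ ·) h2
        simpa using this
      refine ⟨⟨h1, Or.inr ⟨x, hx, fun v hv => ((h3 v).1 (mem_erase.1 hv)).1⟩⟩, ?_⟩
      have h4 : y ∉ F := fun h => hy ((h3 y).2 ⟨h, Or.inl rfl⟩).2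
      rintro ⟨-, ⟨h5, -⟩ | ⟨x', hx', h5⟩⟩
      · exact ((h3 x).2 ⟨h5 hx, Or.inr (hTD.1 hx)⟩).1 rfl
      · refine h4 (h5 (mem_erase.2 ⟨?_, mem_insert_self y D⟩))
        rintro rfl
        exact hy (hTD.1 hx')
  have hc : ∀ E ∈ T.image fun x => D.erase x, E.card = D.card - 1 := by
    intro E hE
    obtain ⟨x, hx, rfl⟩ := mem_image.1 hE
    exact card_erase_of_mem (hTD.1 hx)
  rw [e, card_traceFam, sum_congr rfl fun E hE => by rw [hc E hE], sum_const, smul_eq_mul,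
    card_image_of_injOn, card_insert_of_notMem hy]
  · exact fun a ha b hb hab => erase_injOn D (hTD.1 ha) (hTD.1 hb) hab
  · intro E hE
    refine ⟨?_, (hc E hE).trans_le hk⟩
    obtain ⟨x, hx, rfl⟩ := mem_image.1 hE
    exact (erase_subset x D).trans (subset_insert y D)

lemma IsExtremal.card_eq_or_card_eq {k t : ℕ} {T D : Finset α}
    (h : IsExtremal k t (hilt k T D)) (ht : 1 ≤ t) (hk : t + 1 ≤ k) (hkn : k + 1 ≤ Fintype.card α)
    (hn : 2 * k + 2 ≤ Fintype.card α + t) (hTD : T ⊆ D) (hT : T.card = t)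
    (hD : t + 2 ≤ D.card) (hDk : D.card ≤ k + 1) : D.card = t + 2 ∨ D.card = k + 1 := by
  by_contra! hc
  have hss : T ⊂ D := Finset.ssubset_iff_subset_ne.2 ⟨hTD, fun h => by rw [h] at hT; omega⟩
  obtain ⟨y, hy⟩ : ∃ y, y ∉ D := by
    by_contra! hall
    rw [eq_univ_iff_forall.2 hall, card_univ] at hDk hc
    omega
  have hyT : y ∉ T := fun h => hy (hTD h)
  obtain ⟨z, hzD, hzT⟩ := exists_of_ssubset hss
  have hy1 := card_insert_of_notMem hy
  have hz1 := card_erase_of_mem hzD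
  have hss' : T ⊂ D.erase z := Finset.ssubset_iff_subset_ne.2
    ⟨fun v hv => mem_erase.2 ⟨fun h => hzT (h ▸ hv), hTD hv⟩, fun h => by
      rw [← h, hT] at hz1; omega⟩
  have h1 := h.card_le _ (isNontrivialInter_hilt ht (hTD.trans (subset_insert y D)) hT
    (by omega) (by omega) hkn)
  have h2 := h.card_le _ (isNontrivialInter_hilt (D := D.erase z) ht hss'.1 hT
    (by omega) (by omega) hkn)
  rw [← card_sdiff_le_card_sdiff_iff, card_hilt_insert_sdiff hss hy (by omega),
    card_hilt_sdiff_insert hss hy (by omega)] at h1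
  have e := insert_erase hzD
  have h3 := card_hilt_insert_sdiff (k := k) hss' (notMem_erase z D) (by omega)
  have h4 := card_hilt_sdiff_insert (k := k) hss' (notMem_erase z D) (by omega)
  rw [← card_sdiff_le_card_sdiff_iff] at h2
  rw [e] at h3 h4
  rw [h3, h4] at h2
  have hDn : D.card < Fintype.card α := by omega
  refine choose_le_contra (t := t) (p := k - (t + 1)) (q := k - (D.card - 1))
    (m := Fintype.card α - (D.card + 1)) (by omega) ?_ ?_
  · rwa [hT] at h1
  · rw [hT] at h2
    convert h2 using 3 <;> omega

/-- The image of `G` under the transposition of `x` and `y`. -/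
def sw (x y : α) (G : Finset α) : Finset α := G.map (Equiv.swap x y).toEmbedding

/-- Replace `y` by `x` in the members of `𝓕`, whenever this gives a set outside `𝓕`. -/
def shiftFam (x y : α) (𝓕 : Finset (Finset α)) : Finset (Finset α) :=
  𝓕.image fun G => if y ∈ G ∧ x ∉ G ∧ sw x y G ∉ 𝓕 then sw x y G else G

section Swap

variable {β : Type*} [DecidableEq β] {x y z : β} {G G' : Finset β}

lemma mem_sw : z ∈ sw x y G ↔ Equiv.swap x y z ∈ G := by
  rw [sw, mem_map_equiv, Equiv.symm_swap]

lemma left_mem_sw : x ∈ sw x y G ↔ y ∈ G := by simp [mem_sw]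

lemma right_mem_sw : y ∈ sw x y G ↔ x ∈ G := by simp [mem_sw]

lemma mem_sw_of_ne (hx : z ≠ x) (hy : z ≠ y) : z ∈ sw x y G ↔ z ∈ G := by
  rw [mem_sw, Equiv.swap_apply_of_ne_of_ne hx hy]

lemma sw_sw : sw x y (sw x y G) = G := by ext z; simp [mem_sw]

lemma card_sw : (sw x y G).card = G.card := card_map _

lemma sw_inter_sw : sw x y G ∩ sw x y G' = sw x y (G ∩ G') := by
  ext z
  simp [mem_sw]

lemma sw_injective : Function.Injective (sw x y) := map_injective _

lemma sw_subset_sw : sw x y G ⊆ sw x y G' ↔ G ⊆ G' := map_subset_map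

lemma sw_eq_self (h : x ∈ G ↔ y ∈ G) : sw x y G = G := by
  ext z
  by_cases hx : z = x
  · rw [hx, left_mem_sw, h]
  · by_cases hy : z = y
    · rw [hy, right_mem_sw, h]
    · exact mem_sw_of_ne hx hy

lemma sw_eq_insert_erase (hy : y ∈ G) (hx : x ∉ G) : sw x y G = insert x (G.erase y) := by
  ext z
  by_cases h1 : z = x
  · rw [h1, left_mem_sw]
    simp [hy]
  · by_cases h2 : z = y
    · rw [h2, right_mem_sw]
      subst h2
      simp [hx, h1]
    · rw [mem_sw_of_ne h1 h2]
      simp [h1, h2]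

end Swap

section ShiftFam

variable {β : Type*} [DecidableEq β] {x y z : β} {F G : Finset β} {𝓕 : Finset (Finset β)}

lemma mem_shiftFam : G ∈ shiftFam x y 𝓕 ↔ (G ∈ 𝓕 ∧ (y ∈ G → x ∉ G → sw x y G ∈ 𝓕)) ∨
    (x ∈ G ∧ y ∉ G ∧ sw x y G ∈ 𝓕) := by
  rw [shiftFam, mem_image]
  constructor
  · rintro ⟨F, hF, rfl⟩
    split_ifs with h
    · right
      rw [left_mem_sw, right_mem_sw, sw_sw]
      exact ⟨h.1, h.2.1, hF⟩
    · left
      refine ⟨hF, fun h1 h2 => ?_⟩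
      tauto
  · rintro (⟨h1, h2⟩ | ⟨h1, h2, h3⟩)
    · refine ⟨G, h1, if_neg ?_⟩
      tauto
    · by_cases hG : G ∈ 𝓕
      · exact ⟨G, hG, if_neg fun h => h2 h.1⟩
      · refine ⟨sw x y G, h3, ?_⟩
        rw [if_pos, sw_sw]
        rw [left_mem_sw, right_mem_sw, sw_sw]
        exact ⟨h1, h2, hG⟩

lemma mem_shiftFam_left (hx : x ∈ G) (hy : y ∉ G) :
    G ∈ shiftFam x y 𝓕 ↔ G ∈ 𝓕 ∨ sw x y G ∈ 𝓕 := by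
  rw [mem_shiftFam]
  tauto

lemma mem_shiftFam_right (hx : x ∉ G) (hy : y ∈ G) :
    G ∈ shiftFam x y 𝓕 ↔ G ∈ 𝓕 ∧ sw x y G ∈ 𝓕 := by
  rw [mem_shiftFam]
  tauto

lemma mem_shiftFam_of_iff (h : x ∈ G ↔ y ∈ G) : G ∈ shiftFam x y 𝓕 ↔ G ∈ 𝓕 := by
  rw [mem_shiftFam]
  tauto

lemma shift_injOn (x y : β) (𝓕 : Finset (Finset β)) : Set.InjOn
    (fun G => if y ∈ G ∧ x ∉ G ∧ sw x y G ∉ 𝓕 then sw x y G else G) (𝓕 : Set (Finset β)) := by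
  intro A hA B hB hAB
  simp only [mem_coe] at hA hB hAB
  split_ifs at hAB with h1 h2 h2
  · exact sw_injective hAB
  · exact absurd (hAB ▸ hB) h1.2.2
  · exact absurd (hAB ▸ hA) h2.2.2
  · exact hAB

lemma card_shiftFam : (shiftFam x y 𝓕).card = 𝓕.card :=
  card_image_of_injOn (shift_injOn x y 𝓕)

lemma shiftFam_inter_aux {t : ℕ} (h : ∀ A ∈ 𝓕, ∀ B ∈ 𝓕, t ≤ (A ∩ B).card) {A B : Finset β}
    (hx : x ∈ A) (hy : y ∉ A) (hA : sw x y A ∈ 𝓕) (hB : B ∈ 𝓕)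
    (hB' : y ∈ B → x ∉ B → sw x y B ∈ 𝓕) : t ≤ (A ∩ B).card := by
  by_cases hB1 : y ∈ B ∧ x ∉ B
  · have h1 := h _ hA _ (hB' hB1.1 hB1.2)
    rwa [sw_inter_sw, card_sw] at h1
  · have h1 := h _ hA _ hB
    by_cases hB2 : x ∈ B ↔ y ∈ B
    · rw [← sw_eq_self hB2, sw_inter_sw, card_sw] at h1
      exact h1
    · refine h1.trans (card_le_card fun z hz => ?_)
      rw [mem_inter] at hz ⊢
      refine ⟨?_, hz.2⟩
      have h2 : z ≠ x := by
        rintro rfl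
        exact hy (left_mem_sw.1 hz.1)
      have h3 : z ≠ y := by
        rintro rfl
        tauto
      exact (mem_sw_of_ne h2 h3).1 hz.1

lemma shiftFam_inter {t : ℕ} (h : ∀ A ∈ 𝓕, ∀ B ∈ 𝓕, t ≤ (A ∩ B).card) :
    ∀ A ∈ shiftFam x y 𝓕, ∀ B ∈ shiftFam x y 𝓕, t ≤ (A ∩ B).card := by
  intro A hA B hB
  rcases mem_shiftFam.1 hA with ⟨a1, a2⟩ | ⟨a1, a2, a3⟩ <;>
    rcases mem_shiftFam.1 hB with ⟨b1, b2⟩ | ⟨b1, b2, b3⟩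
  · exact h A a1 B b1
  · rw [inter_comm]
    exact shiftFam_inter_aux h b1 b2 b3 a1 a2
  · exact shiftFam_inter_aux h a1 a2 a3 b1 b2
  · have h1 := h _ a3 _ b3
    rwa [sw_inter_sw, card_sw] at h1

lemma shiftFam_card_eq {k : ℕ} (h : ∀ F ∈ 𝓕, F.card = k) : ∀ F ∈ shiftFam x y 𝓕, F.card = k := by
  intro F hF
  rcases mem_shiftFam.1 hF with ⟨a1, -⟩ | ⟨-, -, a⟩
  · exact h F a1
  · rw [← h _ a, card_sw]

/-- The total rank of the members of `𝓕`. -/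
def weight (e : β → ℕ) (𝓕 : Finset (Finset β)) : ℕ := ∑ F ∈ 𝓕, ∑ z ∈ F, e z

lemma weight_shiftFam_lt {e : β → ℕ} (he : e x < e y) (hF : F ∈ 𝓕) (hy : y ∈ F) (hx : x ∉ F)
    (hsw : sw x y F ∉ 𝓕) : weight e (shiftFam x y 𝓕) < weight e 𝓕 := by
  have key : ∀ G : Finset β, y ∈ G → x ∉ G → ∑ z ∈ sw x y G, e z < ∑ z ∈ G, e z := by
    intro G hyG hxG
    rw [sw_eq_insert_erase hyG hxG, sum_insert (by simp [hxG]), ← add_sum_erase G e hyG]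
    omega
  rw [weight, shiftFam, sum_image (shift_injOn x y 𝓕), weight]
  refine sum_lt_sum (fun G _ => ?_) ⟨F, hF, ?_⟩
  · split_ifs with h
    · exact (key G h.1 h.2.1).le
    · exact le_rfl
  · rw [if_pos ⟨hy, hx, hsw⟩]
    exact key F hy hx

/-- If the shift of `𝓕` is `𝓖` and the sets affected by the shift all behave in the same way, then
`𝓕` is `𝓖` or its image under the transposition. -/
lemma eq_of_shiftFam_eq {𝓖 : Finset (Finset β)} (h : shiftFam x y 𝓕 = 𝓖)
    (hconst : (∀ G ∈ 𝓖, x ∈ G → y ∉ G → sw x y G ∉ 𝓖 → G ∈ 𝓕) ∨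
      ∀ G ∈ 𝓖, x ∈ G → y ∉ G → sw x y G ∉ 𝓖 → G ∉ 𝓕) :
    (∀ G, G ∈ 𝓕 ↔ G ∈ 𝓖) ∨ ∀ G, G ∈ 𝓕 ↔ sw x y G ∈ 𝓖 := by
  have h1 : ∀ G, x ∈ G → y ∉ G → (G ∈ 𝓖 ↔ G ∈ 𝓕 ∨ sw x y G ∈ 𝓕) := fun G a b => by
    rw [← h, mem_shiftFam_left a b]
  have h2 : ∀ G, x ∉ G → y ∈ G → (G ∈ 𝓖 ↔ G ∈ 𝓕 ∧ sw x y G ∈ 𝓕) := fun G a b => by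
    rw [← h, mem_shiftFam_right a b]
  have h3 : ∀ G : Finset β, (x ∈ G ↔ y ∈ G) → (G ∈ 𝓖 ↔ G ∈ 𝓕) := fun G a => by
    rw [← h, mem_shiftFam_of_iff a]
  have hsw : ∀ G : Finset β, sw x y (sw x y G) = G := fun _ => sw_sw
  have hl : ∀ G : Finset β, x ∈ sw x y G ↔ y ∈ G := fun _ => left_mem_sw
  have hr : ∀ G : Finset β, y ∈ sw x y G ↔ x ∈ G := fun _ => right_mem_sw
  rcases hconst with hc | hc
  · left
    intro G
    have a1 := h1 G
    have a2 := h2 G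
    have a3 := h3 G
    have b1 := h1 (sw x y G)
    have b2 := h2 (sw x y G)
    have c1 := hc G
    have c2 := hc (sw x y G)
    rw [hsw, hl, hr] at b1 b2 c2
    clear h1 h2 h3 hc hl hr hsw
    by_cases hx : x ∈ G <;> by_cases hy : y ∈ G <;>
      simp only [hx, hy, not_true_eq_false, not_false_eq_true, forall_true_left,
        false_implies, implies_true, iff_false] at a1 a2 a3 b1 b2 c1 c2 <;> tauto
  · right
    intro G
    by_cases hG : x ∈ G ↔ y ∈ G
    · rw [sw_eq_self hG, h3 G hG]
    · have a1 := h1 G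
      have a2 := h2 G
      have b1 := h1 (sw x y G)
      have b2 := h2 (sw x y G)
      have c1 := hc G
      have c2 := hc (sw x y G)
      rw [hsw, hl, hr] at b1 b2 c2
      clear h1 h2 h3 hc hl hr hsw
      by_cases hx : x ∈ G <;> by_cases hy : y ∈ G <;>
        simp only [hx, hy, not_true_eq_false, not_false_eq_true, forall_true_left,
          false_implies, implies_true] at a1 a2 b1 b2 c1 c2 hG <;> tauto

end ShiftFam

lemma sw_mem_hilt {k : ℕ} {x y : α} {T D G : Finset α} :
    sw x y G ∈ hilt k (sw x y T) (sw x y D) ↔ G ∈ hilt k T D := by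
  have h1 : sw x y D \ sw x y T = sw x y (D \ T) := by
    ext z
    simp [mem_sw]
  have h2 : (∃ z ∈ sw x y T, (sw x y D).erase z ⊆ sw x y G) ↔ ∃ z ∈ T, D.erase z ⊆ G := by
    have h3 : ∀ z, (sw x y D).erase (Equiv.swap x y z) = sw x y (D.erase z) := fun z =>
      (map_erase _ _ _).symm
    constructor
    · rintro ⟨z, hz, h⟩
      refine ⟨Equiv.swap x y z, mem_sw.1 hz, ?_⟩
      rw [← sw_subset_sw (x := x) (y := y), ← h3, Equiv.swap_apply_self]
      exact h
    · rintro ⟨z, hz, h⟩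
      refine ⟨Equiv.swap x y z, by rwa [mem_sw, Equiv.swap_apply_self], ?_⟩
      rw [h3]
      exact sw_subset_sw.2 h
  rw [mem_hilt, mem_hilt, card_sw, sw_subset_sw, h1, sw_inter_sw, h2]
  simp [sw, map_nonempty]

section Connectivity

variable {β : Type*} [DecidableEq β]

lemma iff_of_swap {Ω : Finset β} {r : ℕ} {Q : Finset β → Prop}
    (h : ∀ Z ⊆ Ω, Z.card = r → ∀ a ∈ Z, ∀ b ∈ Ω, b ∉ Z → (Q Z ↔ Q (insert b (Z.erase a))))
    {Z Z' : Finset β} (hZ : Z ⊆ Ω) (hZr : Z.card = r) (hZ' : Z' ⊆ Ω) (hZr' : Z'.card = r) :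
    Q Z ↔ Q Z' := by
  induction hm : (Z \ Z').card generalizing Z with
  | zero =>
    have h1 : Z ⊆ Z' := by rwa [card_eq_zero, sdiff_eq_empty_iff_subset] at hm
    rw [eq_of_subset_of_card_le h1 (by omega)]
  | succ m ih =>
    obtain ⟨a, ha⟩ : (Z \ Z').Nonempty := card_pos.1 (by omega)
    obtain ⟨b, hb⟩ : (Z' \ Z).Nonempty := card_pos.1 (by
      rw [card_sdiff_comm (by omega)]
      omega)
    rw [mem_sdiff] at ha hb
    rw [h Z hZ hZr a ha.1 b (hZ' hb.1) hb.2]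
    have hb' : b ∉ Z.erase a := fun h => hb.2 (mem_of_mem_erase h)
    refine ih ?_ ?_ ?_
    · exact insert_subset (hZ' hb.1) ((erase_subset a Z).trans hZ)
    · rw [card_insert_of_notMem hb', card_erase_of_mem ha.1]
      have := card_pos.2 ⟨a, ha.1⟩
      omega
    · have : insert b (Z.erase a) \ Z' = (Z \ Z').erase a := by
        ext z
        simp only [mem_sdiff, mem_insert, mem_erase]
        constructor
        · rintro ⟨rfl | hz, hz'⟩
          · exact absurd hb.1 hz'
          · exact ⟨hz.1, hz.2, hz'⟩
        · exact fun hz => ⟨Or.inr ⟨hz.1, hz.2.1⟩, hz.2.2⟩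
      rw [this, card_erase_of_mem (mem_sdiff.2 ha)]
      omega

/-- `X` is an `r`-subset of `Ω` which meets `L` without containing it. -/
def Splits (Ω L : Finset β) (r : ℕ) (X : Finset β) : Prop :=
  X ⊆ Ω ∧ X.card = r ∧ (X ∩ L).Nonempty ∧ ¬ L ⊆ X

variable {Ω L : Finset β} {r : ℕ} {Q : Finset β → Prop}

lemma iff_of_union_card_le (hΩ : 2 * r + 1 ≤ Ω.card)
    (hL : L ⊆ Ω) (hQ : ∀ X Y, Splits Ω L r X → Splits Ω L r Y → Disjoint X Y → (Q X ↔ Q Y))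
    {X X' : Finset β} (hX : Splits Ω L r X) (hX' : Splits Ω L r X')
    (hc : (X ∪ X').card ≤ r + 1) {b : β} (hb : b ∈ L) (hbX : b ∉ X ∪ X') :
    ∃ Y, Splits Ω L r Y ∧ b ∈ Y ∧ (Q X ↔ Q Y) ∧ (Q X' ↔ Q Y) := by
  obtain ⟨a, ha⟩ := hX.2.2.1
  rw [mem_inter] at ha
  obtain ⟨Y, h1, h2, h3⟩ := exists_subsuperset_card_eq (s := {b}) (t := Ω \ (X ∪ X')) (n := r)
    (singleton_subset_iff.2 (mem_sdiff.2 ⟨hL hb, hbX⟩))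
    (by rw [card_singleton, ← hX.2.1]; exact card_pos.2 ⟨a, ha.1⟩)
    (by have := le_card_sdiff (X ∪ X') Ω; omega)
  have hY : Y ⊆ Ω := h2.trans sdiff_subset
  have hd : Disjoint (X ∪ X') Y := (disjoint_sdiff).mono_right h2
  rw [disjoint_union_left] at hd
  have hS : Splits Ω L r Y := ⟨hY, h3, ⟨b, mem_inter.2 ⟨h1 (mem_singleton_self b), hb⟩⟩,
    fun h => disjoint_left.1 hd.1 ha.1 (h ha.2)⟩
  exact ⟨Y, hS, h1 (mem_singleton_self b), hQ X Y hX hS hd.1, hQ X' Y hX' hS hd.2⟩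

lemma iff_insert_erase (hΩ : 2 * r + 1 ≤ Ω.card)
    (hL : L ⊆ Ω) (hQ : ∀ X Y, Splits Ω L r X → Splits Ω L r Y → Disjoint X Y → (Q X ↔ Q Y))
    {X : Finset β} (hX : Splits Ω L r X) {a b z : β} (ha : a ∈ X) (haL : a ∈ L) (hb : b ∈ X)
    (hab : a ≠ b) (hz : z ∈ Ω) (hzX : z ∉ X) (hzL : z ∉ L) :
    Splits Ω L r (insert z (X.erase b)) ∧ (Q X ↔ Q (insert z (X.erase b))) := by
  obtain ⟨c, hcL, hcX⟩ := not_subset.1 hX.2.2.2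
  have hcz : c ≠ z := fun h => hzL (h ▸ hcL)
  have hz' : z ∉ X.erase b := fun h => hzX (mem_of_mem_erase h)
  have hS : Splits Ω L r (insert z (X.erase b)) := by
    refine ⟨insert_subset hz ((erase_subset b X).trans hX.1), ?_,
      ⟨a, by simp [ha, haL, hab]⟩, fun h => ?_⟩
    · rw [card_insert_of_notMem hz', card_erase_of_mem hb]
      have := card_pos.2 ⟨b, hb⟩
      have := hX.2.1
      omega
    · have := h hcL
      simp only [mem_insert, mem_erase] at this
      tauto
  refine ⟨hS, ?_⟩
  have hu : X ∪ insert z (X.erase b) ⊆ insert z X := by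
    intro v
    simp only [mem_union, mem_insert, mem_erase]
    tauto
  obtain ⟨Y, -, -, h1, h2⟩ := iff_of_union_card_le hΩ hL hQ hX hS
    ((card_le_card hu).trans (by rw [card_insert_of_notMem hzX, hX.2.1])) hcL
    (fun h => by
      have := hu h
      simp only [mem_insert] at this
      tauto)
  exact h1.trans h2.symm

lemma exists_iff_inter_eq_singleton (hΩ : 2 * r + 1 ≤ Ω.card) (hL : L ⊆ Ω) (hLr : L.card ≤ r + 1)
    (hQ : ∀ X Y, Splits Ω L r X → Splits Ω L r Y → Disjoint X Y → (Q X ↔ Q Y))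
    {X : Finset β} (hX : Splits Ω L r X) {a : β} (ha : a ∈ X) (haL : a ∈ L) :
    ∃ Y, Splits Ω L r Y ∧ Y ∩ L = {a} ∧ (Q X ↔ Q Y) := by
  induction hm : (X ∩ L).card using Nat.strong_induction_on generalizing X with
  | _ m ih =>
  by_cases h1 : X ∩ L = {a}
  · exact ⟨X, hX, h1, Iff.rfl⟩
  obtain ⟨b, hb, hba⟩ : ∃ b ∈ X ∩ L, b ≠ a := by
    by_contra! hc
    exact h1 (eq_singleton_iff_unique_mem.2 ⟨mem_inter.2 ⟨ha, haL⟩, hc⟩)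
  have h2 : 2 ≤ (X ∩ L).card := one_lt_card.2 ⟨b, hb, a, mem_inter.2 ⟨ha, haL⟩, hba⟩
  obtain ⟨z, hz, hz'⟩ := exists_mem_notMem_of_card_lt_card (s := X ∪ L) (t := Ω) (by
    have := card_union_add_card_inter X L
    have := hX.2.1
    omega)
  rw [mem_inter] at hb
  rw [mem_union, not_or] at hz'
  obtain ⟨h3, h4⟩ := iff_insert_erase hΩ hL hQ hX ha haL hb.1 (Ne.symm hba) hz hz'.1 hz'.2
  have h5 : insert z (X.erase b) ∩ L = (X ∩ L).erase b := by
    ext v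
    simp only [mem_inter, mem_insert, mem_erase]
    grind
  obtain ⟨Y, y1, y2, y3⟩ := ih _ (by
    rw [h5, card_erase_of_mem (mem_inter.2 hb)]
    omega) h3 (by simp [ha, Ne.symm hba]) rfl
  exact ⟨Y, y1, y2, h4.trans y3⟩

lemma iff_of_inter_eq_singleton (hΩ : 2 * r + 1 ≤ Ω.card) (hL : L ⊆ Ω)
    (hQ : ∀ X Y, Splits Ω L r X → Splits Ω L r Y → Disjoint X Y → (Q X ↔ Q Y))
    {X X' : Finset β} (hX : Splits Ω L r X) (hX' : Splits Ω L r X') {a : β} (h : X ∩ L = {a})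
    (h' : X' ∩ L = {a}) : Q X ↔ Q X' := by
  have key : ∀ X, Splits Ω L r X → X ∩ L = {a} → X.erase a ⊆ Ω \ L ∧ (X.erase a).card = r - 1 ∧
      insert a (X.erase a) = X := by
    intro X hX h
    have ha : a ∈ X ∩ L := h ▸ mem_singleton_self a
    rw [mem_inter] at ha
    refine ⟨fun z hz => ?_, ?_, insert_erase ha.1⟩
    · rw [mem_erase] at hz
      refine mem_sdiff.2 ⟨hX.1 hz.2, fun hzL => hz.1 ?_⟩
      exact mem_singleton.1 (h ▸ mem_inter.2 ⟨hz.2, hzL⟩)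
    · rw [card_erase_of_mem ha.1, hX.2.1]
  have ha : a ∈ X ∩ L := h ▸ mem_singleton_self a
  rw [mem_inter] at ha
  obtain ⟨c, hcL, hcX⟩ := not_subset.1 hX.2.2.2
  have hr : 0 < r := hX.2.1 ▸ card_pos.2 ⟨a, ha.1⟩
  obtain ⟨h1, h2, h3⟩ := key X hX h
  obtain ⟨h1', h2', h3'⟩ := key X' hX' h'
  have := iff_of_swap (Ω := Ω \ L) (r := r - 1) (Q := fun Z => Q (insert a Z))
    (fun Z hZ hZr b hb z hz hzZ => ?_) h1 h2 h1' h2'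
  · simpa only [h3, h3'] using this
  · rw [mem_sdiff] at hz
    have haZ : a ∉ Z := fun h => (mem_sdiff.1 (hZ h)).2 ha.2
    have hS : Splits Ω L r (insert a Z) := by
      refine ⟨insert_subset (hL ha.2) (hZ.trans sdiff_subset), ?_, ⟨a, by simp [ha.2]⟩,
        fun hs => ?_⟩
      · rw [card_insert_of_notMem haZ]
        omega
      · have h4 := hs hcL
        rw [mem_insert] at h4
        rcases h4 with rfl | h4
        · exact hcX ha.1
        · exact (mem_sdiff.1 (hZ h4)).2 hcL
    have hab : a ≠ b := fun h => haZ (h ▸ hb)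
    have hza : z ≠ a := fun h => hz.2 (h ▸ ha.2)
    have := (iff_insert_erase hΩ hL hQ hS (mem_insert_self a Z) ha.2 (mem_insert_of_mem hb) hab
      hz.1 (by simp [hza, hzZ]) hz.2).2
    rwa [erase_insert_of_ne hab, insert_comm] at this

lemma iff_of_splits (hΩ : 2 * r + 1 ≤ Ω.card) (hL : L ⊆ Ω) (hLr : L.card ≤ r + 1)
    (hQ : ∀ X Y, Splits Ω L r X → Splits Ω L r Y → Disjoint X Y → (Q X ↔ Q Y))
    {X X' : Finset β} (hX : Splits Ω L r X) (hX' : Splits Ω L r X') : Q X ↔ Q X' := by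
  obtain ⟨b, hb⟩ := hX'.2.2.1
  rw [mem_inter] at hb
  obtain ⟨Y', y1, y2, y3⟩ := exists_iff_inter_eq_singleton hΩ hL hLr hQ hX' hb.1 hb.2
  have key : ∀ W, Splits Ω L r W → b ∈ W → (Q W ↔ Q X') := fun W hW hbW => by
    obtain ⟨Y, z1, z2, z3⟩ := exists_iff_inter_eq_singleton hΩ hL hLr hQ hW hbW hb.2
    exact z3.trans ((iff_of_inter_eq_singleton hΩ hL hQ z1 y1 z2 y2).trans y3.symm)
  by_cases hbX : b ∈ X
  · exact key X hX hbX
  · obtain ⟨Y, z1, z2, z3, -⟩ := iff_of_union_card_le hΩ hL hQ hX hX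
      (by rw [union_self, hX.2.1]; omega) hb.2 (by rwa [union_self])
    exact z3.trans (key Y z1 z2)

end Connectivity

/-- `G` lies in `hilt k T D`, contains `x` but not `y`, and leaves `hilt k T D` when `x` is replaced
by `y`. -/
def Affected (k : ℕ) (T D : Finset α) (x y : α) (G : Finset α) : Prop :=
  G ∈ hilt k T D ∧ x ∈ G ∧ y ∉ G ∧ sw x y G ∉ hilt k T D

lemma mem_sw_iff {β : Type*} [DecidableEq β] {x y z : β} {G : Finset β} (hx : x ∈ G) (hy : y ∉ G) :
    z ∈ sw x y G ↔ z = y ∨ z ∈ G ∧ z ≠ x := by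
  by_cases h1 : z = x
  · subst h1
    rw [left_mem_sw]
    have : z ≠ y := fun h => hy (h ▸ hx)
    tauto
  · by_cases h2 : z = y
    · subst h2
      rw [right_mem_sw]
      tauto
    · rw [mem_sw_of_ne h1 h2]
      tauto

section Affected

variable {k t : ℕ} {T D G : Finset α} {x y : α} {P : Finset α → Prop}

lemma Affected.cases_of_mem (h : Affected k T D x y G) (hTD : T ⊆ D) (hxT : x ∈ T) :
    y ∉ T ∧ ((T ⊆ G ∧ (G ∩ (D \ T).erase y).Nonempty ∧ ¬ (D \ T).erase y ⊆ G) ∨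
      y ∉ D ∧ ∃ x' ∈ T, D.erase x' ⊆ G ∧ x' ∉ G) := by
  obtain ⟨h1, hx, hy, h2⟩ := h
  rw [mem_hilt] at h1 h2
  rw [card_sw] at h2
  have h3 : ∀ z, D.erase x ⊆ sw x y G → z ∈ (∅ : Finset α) := fun z h =>
    absurd ⟨h1.1, Or.inr ⟨x, hxT, h⟩⟩ h2
  have h4 : ¬ ∀ z ∈ D, z ≠ x → z = y ∨ z ∈ G := fun h => by
    refine absurd (h3 x fun z hz => ?_) (notMem_empty x)
    rw [mem_erase] at hz
    rw [mem_sw_iff hx hy]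
    have := h z hz.2 hz.1
    tauto
  by_cases hTG : T ⊆ G
  · refine ⟨fun h => hy (hTG h), Or.inl ⟨hTG, ?_, fun h => h4 fun z hz _ => ?_⟩⟩
    · rcases h1.2 with ⟨-, z, hz⟩ | ⟨x', hx', h⟩
      · refine ⟨z, ?_⟩
        rw [mem_inter] at hz
        rw [mem_inter, mem_erase]
        exact ⟨hz.1, fun h => hy (h ▸ hz.1), hz.2⟩
      · exfalso
        refine h4 fun z hz _ => Or.inr ?_
        by_cases hzx : z = x'
        · exact hzx ▸ hTG hx'
        · exact h (mem_erase.2 ⟨hzx, hz⟩)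
    · by_cases hzy : z = y
      · exact Or.inl hzy
      · right
        by_cases hzT : z ∈ T
        · exact hTG hzT
        · exact h (mem_erase.2 ⟨hzy, mem_sdiff.2 ⟨hz, hzT⟩⟩)
  · obtain ⟨x', hx', h⟩ : ∃ x ∈ T, D.erase x ⊆ G := by tauto
    have hx'G : x' ∉ G := fun h5 => hTG fun z hz => by
      by_cases hzx : z = x'
      · exact hzx ▸ h5
      · exact h (mem_erase.2 ⟨hzx, hTD hz⟩)
    have hyD : y ∉ D := fun h6 => h4 fun z hz _ => by
      have : y = x' := by
        by_contra h7
        exact hy (h (mem_erase.2 ⟨h7, h6⟩))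
      by_cases hzx : z = x'
      · left
        rw [hzx, this]
      · exact Or.inr (h (mem_erase.2 ⟨hzx, hz⟩))
    exact ⟨fun h => hyD (hTD h), Or.inr ⟨hyD, x', hx', h, hx'G⟩⟩

lemma Affected.cases_of_notMem (h : Affected k T D x y G) (hTD : T ⊆ D) (hTc : T.card + 2 ≤ D.card)
    (hxT : x ∉ T) : x ∈ D ∧ y ∉ D ∧ (G ∩ D = insert x T ∨ ∃ x' ∈ T, D.erase x' ⊆ G) := by
  obtain ⟨h1, hx, hy, h2⟩ := h
  rw [mem_hilt] at h1 h2
  rw [card_sw] at h2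
  have h3 : ¬ (T ⊆ sw x y G ∧ (sw x y G ∩ (D \ T)).Nonempty) := by tauto
  have h4 : ¬ ∃ x' ∈ T, D.erase x' ⊆ sw x y G := fun h => h2 ⟨h1.1, Or.inr h⟩
  have hxD : x ∈ D := by
    by_contra hxD
    rcases h1.2 with ⟨h5, z, hz⟩ | ⟨x', hx', h⟩
    · refine h3 ⟨fun w hw => (mem_sw_iff hx hy).2 (Or.inr ⟨h5 hw, fun h => hxT (h ▸ hw)⟩), z, ?_⟩
      rw [mem_inter, mem_sdiff] at hz
      rw [mem_inter, mem_sdiff, mem_sw_iff hx hy]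
      exact ⟨Or.inr ⟨hz.1, fun h => hxD (h ▸ hz.2.1)⟩, hz.2⟩
    · refine h4 ⟨x', hx', fun w hw => (mem_sw_iff hx hy).2 (Or.inr ⟨h hw, ?_⟩)⟩
      rintro rfl
      exact hxD (mem_of_mem_erase hw)
  refine ⟨hxD, ?_⟩
  by_cases hTG : T ⊆ G
  · have hTG' : T ⊆ sw x y G := fun w hw =>
      (mem_sw_iff hx hy).2 (Or.inr ⟨hTG hw, fun h => hxT (h ▸ hw)⟩)
    have h5 : ∀ z ∈ sw x y G, z ∈ D → z ∈ T := fun z hz hzD => by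
      by_contra hzT
      exact h3 ⟨hTG', z, mem_inter.2 ⟨hz, mem_sdiff.2 ⟨hzD, hzT⟩⟩⟩
    refine ⟨fun h => hy (hTG (h5 y ((mem_sw_iff hx hy).2 (Or.inl rfl)) h)), Or.inl ?_⟩
    ext z
    rw [mem_inter, mem_insert]
    constructor
    · intro hz
      by_cases hzx : z = x
      · exact Or.inl hzx
      · exact Or.inr (h5 z ((mem_sw_iff hx hy).2 (Or.inr ⟨hz.1, hzx⟩)) hz.2)
    · rintro (rfl | hz)
      · exact ⟨hx, hxD⟩
      · exact ⟨hTG hz, hTD hz⟩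
  · obtain ⟨x', hx', h⟩ : ∃ x ∈ T, D.erase x ⊆ G := by tauto
    refine ⟨fun hyD => h3 ⟨fun z hz => ?_, ?_⟩, Or.inr ⟨x', hx', h⟩⟩
    · rw [mem_sw_iff hx hy]
      have h6 : y = x' := by
        by_contra h7
        exact hy (h (mem_erase.2 ⟨h7, hyD⟩))
      by_cases hzx : z = x'
      · left
        rw [hzx, h6]
      · exact Or.inr ⟨h (mem_erase.2 ⟨hzx, hTD hz⟩), fun h => hxT (h ▸ hz)⟩
    · obtain ⟨z, hz⟩ : (D \ insert x T).Nonempty := by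
        rw [← card_pos]
        have := le_card_sdiff (insert x T) D
        have := card_insert_le x T
        omega
      rw [mem_sdiff, mem_insert, not_or] at hz
      refine ⟨z, mem_inter.2 ⟨(mem_sw_iff hx hy).2 (Or.inr ⟨h (mem_erase.2 ⟨?_, hz.1⟩), hz.2.1⟩),
        mem_sdiff.2 ⟨hz.1, hz.2.2⟩⟩⟩
      rintro rfl
      exact hz.2.2 hx'

omit [Fintype α] in
lemma card_sdiff_le_of_erase_subset (hG : G.card = k) {x' : α} (hx' : x' ∈ D) (h : D.erase x' ⊆ G) :
    (G \ D).card + D.card ≤ k + 1 := by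
  have h1 : D.erase x' ⊆ G ∩ D := subset_inter h (erase_subset x' D)
  have h2 := card_le_card h1
  rw [card_erase_of_mem hx'] at h2
  have h3 := card_sdiff_add_card_inter G D
  have := card_pos.2 ⟨x', hx'⟩
  omega

lemma Affected.iff_of_mem (hTD : T ⊆ D) (hT : T.card = t) (hD : t + 2 ≤ D.card)
    (hDk : D.card ≤ k + 1) (hn : 2 * k + 2 ≤ Fintype.card α + t) (hxT : x ∈ T)
    (hP : ∀ G G', Affected k T D x y G → Affected k T D x y G' → (G ∩ G').card ≤ t → (P G ↔ P G'))
    {G G' : Finset α} (hG : Affected k T D x y G) (hG' : Affected k T D x y G') : P G ↔ P G' := by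
  have hyT := (hG.cases_of_mem hTD hxT).1
  set L := (D \ T).erase y with hL
  set Ω : Finset α := univ \ insert y T with hΩ
  have haff : ∀ X, Splits Ω L (k - t) X → Affected k T D x y (T ∪ X) := by
    rintro X ⟨h1, h2, ⟨a, ha⟩, h4⟩
    rw [mem_inter, hL, mem_erase] at ha
    have hX : ∀ z ∈ X, z ≠ y ∧ z ∉ T := fun z hz => by
      have := h1 hz
      rw [hΩ, mem_sdiff, mem_insert] at this
      tauto
    have hx : x ∈ T ∪ X := mem_union_left _ hxT
    have hy : y ∉ T ∪ X := by
      rw [mem_union, not_or]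
      exact ⟨hyT, fun h => (hX y h).1 rfl⟩
    have hc : (T ∪ X).card = k := by
      rw [card_union_of_disjoint (disjoint_right.2 fun z hz => (hX z hz).2)]
      omega
    refine ⟨mem_hilt.2 ⟨hc, Or.inl ⟨subset_union_left, a, mem_inter.2
      ⟨mem_union_right _ ha.1, ha.2.2⟩⟩⟩, hx, hy, fun h => ?_⟩
    have hxs : x ∉ sw x y (T ∪ X) := by
      rw [left_mem_sw]
      exact hy
    rcases (mem_hilt.1 h).2 with ⟨h5, -⟩ | ⟨z, hz, h5⟩
    · exact hxs (h5 hxT)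
    · by_cases hzx : z = x
      · refine h4 fun w hw => ?_
        rw [hL, mem_erase, mem_sdiff] at hw
        have h6 := h5 (mem_erase.2 ⟨fun (h : w = z) => hw.2.2 (h ▸ hz), hw.2.1⟩)
        rw [mem_sw_iff hx hy, mem_union] at h6
        tauto
      · exact hxs (h5 (mem_erase.2 ⟨fun h => hzx h.symm, hTD hxT⟩))
  have hΩc : Ω.card + (t + 1) = Fintype.card α := by
    rw [hΩ, ← hT, ← card_insert_of_notMem hyT, ← card_univ]
    exact card_sdiff_add_card_eq_card (subset_univ _)
  have hDT : (D \ T).card + t = D.card := by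
    rw [← hT]
    exact card_sdiff_add_card_eq_card hTD
  have key : ∀ X X', Splits Ω L (k - t) X → Splits Ω L (k - t) X' → (P (T ∪ X) ↔ P (T ∪ X')) := by
    intro X X' hX hX'
    refine iff_of_splits (Q := fun X => P (T ∪ X)) (by omega) ?_ ?_ ?_ hX hX'
    · intro z hz
      rw [hL, mem_erase, mem_sdiff] at hz
      rw [hΩ, mem_sdiff, mem_insert]
      exact ⟨mem_univ z, by tauto⟩
    · have := card_le_card (erase_subset y (D \ T))
      rw [← hL] at this
      omega
    · intro X Y hX hY hXY
      refine hP _ _ (haff X hX) (haff Y hY) ?_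
      rw [← union_inter_distrib_left, disjoint_iff_inter_eq_empty.1 hXY, union_empty, hT]
  have hrep : ∀ G, Affected k T D x y G → ∃ X, Splits Ω L (k - t) X ∧ (P G ↔ P (T ∪ X)) := by
    intro G hG
    have hGc := (mem_hilt.1 hG.1).1
    rcases (hG.cases_of_mem hTD hxT).2 with ⟨h1, h2, h3⟩ | ⟨hyD, x', hx', h1, h2⟩
    · refine ⟨G \ T, ⟨fun z hz => ?_, ?_, ?_, fun h => h3 (h.trans sdiff_subset)⟩, ?_⟩
      · rw [mem_sdiff] at hz
        rw [hΩ, mem_sdiff, mem_insert, not_or]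
        exact ⟨mem_univ z, fun h => hG.2.2.1 (h ▸ hz.1), hz.2⟩
      · have := card_sdiff_add_card_eq_card h1
        omega
      · obtain ⟨z, hz⟩ := h2
        refine ⟨z, ?_⟩
        have hz' := hz
        rw [mem_inter, mem_erase, mem_sdiff] at hz'
        rw [mem_inter] at hz
        rw [mem_inter, mem_sdiff, hL]
        tauto
      · rw [union_sdiff_of_subset h1]
    · have hLD : L = D \ T := by
        rw [hL, erase_eq_of_notMem]
        exact fun h => hyD (mem_sdiff.1 h).1
      obtain ⟨a, ha⟩ : (D \ T).Nonempty := card_pos.1 (by omega)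
      have hW := card_sdiff_le_of_erase_subset hGc (hTD hx') h1
      obtain ⟨Z, hZ1, hZ2⟩ := exists_subset_card_eq
        (s := univ \ insert y (D ∪ G \ D)) (n := k - t - 1) (by
          have := le_card_sdiff (insert y (D ∪ G \ D)) univ
          have := card_insert_le y (D ∪ G \ D)
          have := card_union_le D (G \ D)
          rw [card_univ] at *
          omega)
      have hZ : ∀ z ∈ Z, z ≠ y ∧ z ∉ D ∧ z ∉ G := fun z hz => by
        have := hZ1 hz
        simp only [mem_sdiff, mem_insert, mem_union] at this
        tauto
      rw [mem_sdiff] at ha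
      have haZ : a ∉ Z := fun h => (hZ a h).2.1 ha.1
      have hay : a ≠ y := fun h => hyD (h ▸ ha.1)
      have hS : Splits Ω L (k - t) (insert a Z) := by
        refine ⟨fun z hz => ?_, ?_, ⟨a, ?_⟩, fun h => ?_⟩
        · rw [hΩ, mem_sdiff, mem_insert, not_or]
          rw [mem_insert] at hz
          rcases hz with rfl | hz
          · exact ⟨mem_univ z, hay, ha.2⟩
          · exact ⟨mem_univ z, (hZ z hz).1, fun h => (hZ z hz).2.1 (hTD h)⟩
        · rw [card_insert_of_notMem haZ]
          omega
        · rw [mem_inter, hLD, mem_sdiff]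
          exact ⟨mem_insert_self a Z, ha⟩
        · rw [hLD] at h
          have h5 : D \ T ⊆ {a} := fun z hz => by
            have := h hz
            rw [mem_insert] at this
            rcases this with h6 | h6
            · exact mem_singleton.2 h6
            · exact absurd (mem_sdiff.1 hz).1 (hZ z h6).2.1
          have := card_le_card h5
          rw [card_singleton] at this
          omega
      refine ⟨insert a Z, hS, hP _ _ hG (haff _ hS) ?_⟩
      have h6 : G ∩ (T ∪ insert a Z) ⊆ insert a (T.erase x') := fun z hz => by
        simp only [mem_inter, mem_union, mem_insert] at hz
        rw [mem_insert, mem_erase]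
        rcases hz with ⟨hzG, hz | hz | hz⟩
        · exact Or.inr ⟨fun h => h2 (h ▸ hzG), hz⟩
        · exact Or.inl hz
        · exact absurd hzG (hZ z hz).2.2
      have h7 := (card_le_card h6).trans (card_insert_le _ _)
      rw [card_erase_of_mem hx'] at h7
      have := card_pos.2 ⟨x', hx'⟩
      omega
  obtain ⟨X, hX, h1⟩ := hrep G hG
  obtain ⟨X', hX', h2⟩ := hrep G' hG'
  rw [h1, h2]
  exact key X X' hX hX'

lemma Affected.iff_of_notMem (ht : 1 ≤ t) (hTD : T ⊆ D) (hT : T.card = t) (hD : t + 2 ≤ D.card)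
    (hDk : D.card ≤ k + 1) (hn : 2 * k + 2 ≤ Fintype.card α + t) (hxT : x ∉ T)
    (hP : ∀ G G', Affected k T D x y G → Affected k T D x y G' → (G ∩ G').card ≤ t → (P G ↔ P G'))
    {G G' : Finset α} (hG : Affected k T D x y G) (hG' : Affected k T D x y G') : P G ↔ P G' := by
  obtain ⟨hxD, hyD, -⟩ := hG.cases_of_notMem hTD (by omega) hxT
  have hyT : y ∉ T := fun h => hyD (hTD h)
  have hxy : x ≠ y := fun h => hyD (h ▸ hxD)
  set Ω : Finset α := univ \ insert y D with hΩ
  have hmΩ : ∀ z, z ∈ Ω ↔ z ≠ y ∧ z ∉ D := fun z => by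
    rw [hΩ, mem_sdiff, mem_insert, not_or]
    simp
  have hΩc : Ω.card + (D.card + 1) = Fintype.card α := by
    rw [hΩ, ← card_insert_of_notMem hyD, ← card_univ]
    exact card_sdiff_add_card_eq_card (subset_univ _)
  have hnot : ∀ G : Finset α, x ∈ G → y ∉ G → (T ⊆ G → G ∩ D ⊆ insert x T) →
      sw x y G ∉ hilt k T D := by
    intro G hx hy h h1
    rcases (mem_hilt.1 h1).2 with ⟨h2, z, hz⟩ | ⟨z, hz, h2⟩
    · rw [mem_inter, mem_sdiff, mem_sw_iff hx hy] at hz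
      have h3 : T ⊆ G := fun w hw => by
        have := h2 hw
        rw [mem_sw_iff hx hy] at this
        rcases this with rfl | h4
        · exact absurd hw hyT
        · exact h4.1
      rcases hz with ⟨rfl | h4, h5, h6⟩
      · exact hyD h5
      · have := h h3 (mem_inter.2 ⟨h4.1, h5⟩)
        rw [mem_insert] at this
        tauto
    · have := h2 (mem_erase.2 ⟨fun (h : x = z) => hxT (h ▸ hz), hxD⟩)
      rw [left_mem_sw] at this
      exact hy this
  have haff1 : ∀ Z ⊆ Ω, Z.card = k - t - 1 → Affected k T D x y (insert x T ∪ Z) := by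
    intro Z hZ hZc
    have hx : x ∈ insert x T ∪ Z := mem_union_left _ (mem_insert_self x T)
    have hy : y ∉ insert x T ∪ Z := by
      rw [mem_union, mem_insert, not_or, not_or]
      exact ⟨⟨hxy.symm, hyT⟩, fun h => ((hmΩ y).1 (hZ h)).1 rfl⟩
    refine ⟨mem_hilt.2 ⟨?_, Or.inl ⟨fun z hz => mem_union_left _ (mem_insert_of_mem hz), x, ?_⟩⟩,
      hx, hy, hnot _ hx hy fun _ z hz => ?_⟩
    · rw [card_union_of_disjoint, card_insert_of_notMem hxT]
      · omega
      · exact disjoint_right.2 fun z hz h => ((hmΩ z).1 (hZ hz)).2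
          (insert_subset hxD hTD h)
    · exact mem_inter.2 ⟨hx, mem_sdiff.2 ⟨hxD, hxT⟩⟩
    · rw [mem_inter, mem_union] at hz
      rcases hz with ⟨hz | hz, hzD⟩
      · exact hz
      · exact absurd hzD ((hmΩ z).1 (hZ hz)).2
  obtain ⟨x₀, hx₀⟩ : T.Nonempty := card_pos.1 (by omega)
  have haff2 : ∀ W ⊆ Ω, W.card = k + 1 - D.card → Affected k T D x y (D.erase x₀ ∪ W) := by
    intro W hW hWc
    have hx : x ∈ D.erase x₀ ∪ W :=
      mem_union_left _ (mem_erase.2 ⟨fun h => hxT (h ▸ hx₀), hxD⟩)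
    have hy : y ∉ D.erase x₀ ∪ W := by
      rw [mem_union, mem_erase, not_or]
      exact ⟨fun h => hyD h.2, fun h => ((hmΩ y).1 (hW h)).1 rfl⟩
    refine ⟨mem_hilt.2 ⟨?_, Or.inr ⟨x₀, hx₀, subset_union_left⟩⟩, hx, hy, hnot _ hx hy fun h => ?_⟩
    · rw [card_union_of_disjoint, card_erase_of_mem (hTD hx₀)]
      · omega
      · exact disjoint_right.2 fun z hz h => ((hmΩ z).1 (hW hz)).2 (mem_of_mem_erase h)
    · have := h hx₀
      rw [mem_union, mem_erase] at this
      rcases this with h1 | h1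
      · exact absurd rfl h1.1
      · exact absurd (hTD hx₀) ((hmΩ x₀).1 (hW h1)).2
  have hcap : ∀ Z ⊆ Ω, ∀ W : Finset α, Disjoint Z W → ∀ x' ∈ T, x' ∉ W → ∀ G : Finset α,
      x' ∉ G → G \ D ⊆ W → (G ∩ (insert x T ∪ Z)).card ≤ t := by
    intro Z hZ W hZW x' hx' hx'W G hx'G hGW
    have h6 : G ∩ (insert x T ∪ Z) ⊆ insert x (T.erase x') := fun z hz => by
      simp only [mem_inter, mem_union, mem_insert] at hz
      rw [mem_insert, mem_erase]
      rcases hz with ⟨hzG, (hz | hz) | hz⟩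
      · exact Or.inl hz
      · exact Or.inr ⟨fun h => hx'G (h ▸ hzG), hz⟩
      · exact absurd (hGW (mem_sdiff.2 ⟨hzG, ((hmΩ z).1 (hZ hz)).2⟩)) (disjoint_left.1 hZW hz)
    have h7 := (card_le_card h6).trans (card_insert_le _ _)
    rw [card_erase_of_mem hx'] at h7
    omega
  have key : ∀ Z Z', Z ⊆ Ω → Z.card = k - t - 1 → Z' ⊆ Ω → Z'.card = k - t - 1 →
      (P (insert x T ∪ Z) ↔ P (insert x T ∪ Z')) := by
    intro Z Z' hZ hZc hZ' hZc'
    refine iff_of_swap (Q := fun Z => P (insert x T ∪ Z)) ?_ hZ hZc hZ' hZc'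
    intro Z hZ hZc a ha b hb hbZ
    have hk := card_pos.2 ⟨a, ha⟩
    obtain ⟨W, hW1, hW2⟩ := exists_subset_card_eq
      (s := Ω \ insert b Z) (n := k + 1 - D.card) (by
        have := le_card_sdiff (insert b Z) Ω
        rw [card_insert_of_notMem hbZ] at this
        omega)
    have hWΩ := hW1.trans sdiff_subset
    have hd : Disjoint (insert b Z) W := disjoint_sdiff.mono_right hW1
    have hd1 : Disjoint Z W := hd.mono_left (subset_insert b Z)
    have hd2 : Disjoint (insert b (Z.erase a)) W :=
      hd.mono_left (insert_subset_insert b (erase_subset a Z))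
    have hx₀W : x₀ ∉ W := fun h => ((hmΩ x₀).1 (hWΩ h)).2 (hTD hx₀)
    have hx₀G : x₀ ∉ D.erase x₀ ∪ W := by
      rw [mem_union, mem_erase, not_or]
      exact ⟨fun h => h.1 rfl, hx₀W⟩
    have hGW : (D.erase x₀ ∪ W) \ D ⊆ W := fun z hz => by
      rw [mem_sdiff, mem_union, mem_erase] at hz
      tauto
    have hZ'Ω : insert b (Z.erase a) ⊆ Ω := insert_subset hb ((erase_subset a Z).trans hZ)
    have hZ'c : (insert b (Z.erase a)).card = k - t - 1 := by
      rw [card_insert_of_notMem fun h => hbZ (mem_of_mem_erase h), card_erase_of_mem ha]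
      omega
    rw [← hP _ _ (haff2 W hWΩ hW2) (haff1 Z hZ hZc) (hcap Z hZ W hd1 x₀ hx₀ hx₀W _ hx₀G hGW),
      ← hP _ _ (haff2 W hWΩ hW2) (haff1 _ hZ'Ω hZ'c)
        (hcap _ hZ'Ω W hd2 x₀ hx₀ hx₀W _ hx₀G hGW)]
  have hrep : ∀ G, Affected k T D x y G →
      ∃ Z, Z ⊆ Ω ∧ Z.card = k - t - 1 ∧ (P G ↔ P (insert x T ∪ Z)) := by
    intro G hG
    have hGc := (mem_hilt.1 hG.1).1
    have h0 : G ∩ D = insert x T →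
        ∃ Z, Z ⊆ Ω ∧ Z.card = k - t - 1 ∧ (P G ↔ P (insert x T ∪ Z)) := fun h => by
      refine ⟨G \ D, fun z hz => ?_, ?_, ?_⟩
      · rw [mem_sdiff] at hz
        exact (hmΩ z).2 ⟨fun h => hG.2.2.1 (h ▸ hz.1), hz.2⟩
      · have := card_sdiff_add_card_inter G D
        rw [h, card_insert_of_notMem hxT] at this
        omega
      · rw [← h, union_comm, sdiff_union_inter]
    rcases (hG.cases_of_notMem hTD (by omega) hxT).2.2 with h | ⟨x', hx', h⟩
    · exact h0 h
    · by_cases hx'G : x' ∈ G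
      · exfalso
        have hDG : D ⊆ G := fun z hz => by
          by_cases hzx : z = x'
          · exact hzx ▸ hx'G
          · exact h (mem_erase.2 ⟨hzx, hz⟩)
        refine hG.2.2.2 (mem_hilt.2 ⟨by rw [card_sw, hGc], Or.inl ⟨fun z hz => ?_, ?_⟩⟩)
        · exact (mem_sw_iff hG.2.1 hG.2.2.1).2 (Or.inr ⟨hDG (hTD hz), fun h => hxT (h ▸ hz)⟩)
        · obtain ⟨z, hz⟩ : (D \ insert x T).Nonempty := by
            rw [← card_pos]
            have := le_card_sdiff (insert x T) D
            have := card_insert_le x T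
            omega
          rw [mem_sdiff, mem_insert, not_or] at hz
          exact ⟨z, mem_inter.2 ⟨(mem_sw_iff hG.2.1 hG.2.2.1).2 (Or.inr ⟨hDG hz.1, hz.2.1⟩),
            mem_sdiff.2 ⟨hz.1, hz.2.2⟩⟩⟩
      · have hW := card_sdiff_le_of_erase_subset hGc (hTD hx') h
        obtain ⟨Z, hZ1, hZ2⟩ := exists_subset_card_eq
          (s := Ω \ (G \ D)) (n := k - t - 1) (by
            have := le_card_sdiff (G \ D) Ω
            omega)
        have hZΩ := hZ1.trans sdiff_subset
        exact ⟨Z, hZΩ, hZ2, hP _ _ hG (haff1 Z hZΩ hZ2)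
          (hcap Z hZΩ (G \ D) (disjoint_sdiff.mono_right hZ1).symm x' hx'
            (fun h => (mem_sdiff.1 h).2 (hTD hx')) G hx'G Subset.rfl)⟩
  obtain ⟨Z, hZ, hZc, h1⟩ := hrep G hG
  obtain ⟨Z', hZ', hZc', h2⟩ := hrep G' hG'
  rw [h1, h2]
  exact key Z Z' hZ hZc hZ' hZc'

end Affected

/-- If the shift of a `t`-intersecting family is of the form `hilt k T D`, so is the family. -/
theorem eq_hilt_of_shiftFam {k t : ℕ} {T D : Finset α} {x y : α} {𝓕 : Finset (Finset α)}
    (ht : 1 ≤ t) (hinter : ∀ A ∈ 𝓕, ∀ B ∈ 𝓕, t ≤ (A ∩ B).card) (hTD : T ⊆ D) (hT : T.card = t)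
    (hD : t + 2 ≤ D.card) (hDk : D.card ≤ k + 1) (hn : 2 * k + 2 ≤ Fintype.card α + t)
    (h : shiftFam x y 𝓕 = hilt k T D) :
    ∃ T' D' : Finset α, T' ⊆ D' ∧ T'.card = t ∧ D'.card = D.card ∧ 𝓕 = hilt k T' D' := by
  have hor : ∀ G, Affected k T D x y G → (G ∈ 𝓕 ↔ sw x y G ∉ 𝓕) := by
    rintro G ⟨h1, hx, hy, h2⟩
    rw [← h, mem_shiftFam_left hx hy] at h1
    rw [← h, mem_shiftFam_right (by rwa [left_mem_sw]) (by rwa [right_mem_sw]), sw_sw] at h2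
    tauto
  have hstep : ∀ G G', Affected k T D x y G → Affected k T D x y G' → (G ∩ G').card ≤ t →
      G ∈ 𝓕 → G' ∈ 𝓕 := by
    intro G G' hG hG' hc hGF
    by_contra hGF'
    have h1 : sw x y G' ∈ 𝓕 := by
      have := hor G' hG'
      tauto
    have h2 := hinter G hGF _ h1
    have h3 : G ∩ sw x y G' ⊆ (G ∩ G').erase x := fun z hz => by
      rw [mem_inter, mem_sw_iff hG'.2.1 hG'.2.2.1] at hz
      rw [mem_erase, mem_inter]
      rcases hz with ⟨h4, rfl | h5⟩
      · exact absurd h4 hG.2.2.1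
      · exact ⟨h5.2, h4, h5.1⟩
    have h4 := card_le_card h3
    have hxx : x ∈ G ∩ G' := mem_inter.2 ⟨hG.2.1, hG'.2.1⟩
    rw [card_erase_of_mem hxx] at h4
    have := card_pos.2 ⟨x, hxx⟩
    omega
  have hP : ∀ G G', Affected k T D x y G → Affected k T D x y G' → (G ∩ G').card ≤ t →
      (G ∈ 𝓕 ↔ G' ∈ 𝓕) := fun G G' hG hG' hc =>
    ⟨hstep G G' hG hG' hc, hstep G' G hG' hG (by rwa [inter_comm])⟩
  have hall : ∀ G G', Affected k T D x y G → Affected k T D x y G' → (G ∈ 𝓕 ↔ G' ∈ 𝓕) := by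
    intro G G' hG hG'
    by_cases hxT : x ∈ T
    · exact Affected.iff_of_mem (P := (· ∈ 𝓕)) hTD hT hD hDk hn hxT hP hG hG'
    · exact Affected.iff_of_notMem (P := (· ∈ 𝓕)) ht hTD hT hD hDk hn hxT hP hG hG'
  have hconst : (∀ G ∈ hilt k T D, x ∈ G → y ∉ G → sw x y G ∉ hilt k T D → G ∈ 𝓕) ∨
      ∀ G ∈ hilt k T D, x ∈ G → y ∉ G → sw x y G ∉ hilt k T D → G ∉ 𝓕 := by
    by_cases hex : ∃ G, Affected k T D x y G ∧ G ∈ 𝓕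
    · obtain ⟨G, hG, hGF⟩ := hex
      exact Or.inl fun G' h1 h2 h3 h4 => (hall G G' hG ⟨h1, h2, h3, h4⟩).1 hGF
    · exact Or.inr fun G' h1 h2 h3 h4 h5 => hex ⟨G', ⟨h1, h2, h3, h4⟩, h5⟩
  rcases eq_of_shiftFam_eq h hconst with h1 | h1
  · exact ⟨T, D, hTD, hT, rfl, ext h1⟩
  · refine ⟨sw x y T, sw x y D, sw_subset_sw.2 hTD, by rw [card_sw, hT], card_sw, ?_⟩
    ext G
    rw [h1, ← sw_mem_hilt (x := x) (y := y), sw_sw]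

section Induction

variable {k t : ℕ} {𝓕 : Finset (Finset α)}

lemma exists_equivFin_of_finset (U : Finset α) :
    ∃ e : α ≃ Fin (Fintype.card α), ∀ z, z ∈ U → (e z : ℕ) < U.card := by
  classical
  set e₀ := Fintype.equivFin α
  have hc : Fintype.card {i : Fin (Fintype.card α) // e₀.symm i ∈ U} =
      Fintype.card {i : Fin (Fintype.card α) // (i : ℕ) < U.card} := by
    rw [Fintype.card_subtype, Fintype.card_subtype, Fin.card_filter_val_lt,
      min_eq_right (card_le_univ U), ← card_map e₀.toEmbedding]
    congr 1
    ext i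
    simp [mem_map_equiv]
  refine ⟨e₀.trans (Fintype.equivOfCardEq hc).extendSubtype, fun z hz => ?_⟩
  exact (Fintype.equivOfCardEq hc).extendSubtype_mem (e₀ z) (by simpa using hz)

omit [Fintype α] in
lemma IsExtremal.shift {x y : α} (h : IsExtremal k t 𝓕)
    (hT : ∀ T : Finset α, T.card = t → ∃ F ∈ shiftFam x y 𝓕, ¬ T ⊆ F) :
    IsExtremal k t (shiftFam x y 𝓕) :=
  ⟨⟨shiftFam_card_eq h.card_eq, shiftFam_inter h.inter, hT⟩, by
    rw [card_shiftFam]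
    exact h.card_le⟩

lemma sw_mem_shiftFam {β : Type*} [DecidableEq β] {x y : β} {F : Finset β} {𝓕 : Finset (Finset β)}
    (hF : F ∈ 𝓕) (h : F ∉ shiftFam x y 𝓕) : y ∈ F ∧ x ∉ F ∧ sw x y F ∈ shiftFam x y 𝓕 := by
  rw [mem_shiftFam] at h
  have h1 : y ∈ F ∧ x ∉ F := by tauto
  refine ⟨h1.1, h1.2, (mem_shiftFam_left (left_mem_sw.2 h1.1) (mt right_mem_sw.1 h1.2)).2 ?_⟩
  rw [sw_sw]
  exact Or.inr hF

omit [Fintype α] in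
lemma IsExtremal.mem_of_superset (h : IsExtremal k t 𝓕) {U A : Finset α} (htk : t ≤ k)
    (hU : ∀ F ∈ 𝓕, t ≤ (F ∩ U).card) (hA : A.card = k) (hUA : U ⊆ A) : A ∈ 𝓕 := by
  by_contra hA𝓕
  have hAF : ∀ F ∈ 𝓕, t ≤ (F ∩ A).card := fun F hF =>
    (hU F hF).trans (card_le_card (inter_subset_inter_left hUA))
  have h1 : IsNontrivialInter k t (insert A 𝓕) := by
    refine ⟨fun F hF => ?_, fun F hF G hG => ?_, fun T hT => ?_⟩
    · rcases mem_insert.1 hF with rfl | hF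
      · exact hA
      · exact h.card_eq F hF
    · rcases mem_insert.1 hF with hFA | hF <;> rcases mem_insert.1 hG with hGA | hG
      · rwa [hFA, hGA, inter_self, hA]
      · rw [inter_comm, hFA]
        exact hAF G hG
      · rw [hGA]
        exact hAF F hF
      · exact h.inter F hF G hG
    · obtain ⟨F, hF, hTF⟩ := h.nontrivial T hT
      exact ⟨F, mem_insert_of_mem hF, hTF⟩
  have h2 := h.card_le _ h1
  rw [card_insert_of_notMem hA𝓕] at h2
  omega

/-- If some `(t - 1)`-set `Y` lies in all members of an extremal family and they all meet a pair
`{i, j}` outside `Y`, then the family is of the form `hilt k T D`. -/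
lemma IsExtremal.eq_hilt_of_pair (ht : 1 ≤ t) (hk : t + 1 ≤ k) (hkn : k + 1 ≤ Fintype.card α)
    (hn : 2 * k + 2 ≤ Fintype.card α + t)
    (hn' : (t + 3) * (k + 1) < 2 * Fintype.card α + (t + 3) * t) {Y : Finset α} {i j : α}
    (hY : Y.card + 1 = t) (hij : i ≠ j) (hi : i ∉ Y) (hj : j ∉ Y) (h : IsExtremal k t 𝓕)
    (hYF : ∀ F ∈ 𝓕, Y ⊆ F ∧ (i ∈ F ∨ j ∈ F)) :
    ∃ T D : Finset α, T ⊆ D ∧ T.card = t ∧ t + 2 ≤ D.card ∧ D.card ≤ k + 1 ∧ 𝓕 = hilt k T D := by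
  set U := insert i (insert j Y) with hU
  have hUc : U.card = t + 1 := by
    rw [hU, card_insert_of_notMem, card_insert_of_notMem hj, hY]
    rw [mem_insert, not_or]
    exact ⟨hij, hi⟩
  obtain ⟨e, he⟩ := exists_equivFin_of_finset U
  induction hw : weight (fun z => (e z : ℕ)) 𝓕 using Nat.strong_induction_on generalizing 𝓕 with
  | _ w ih =>
  have hFU : ∀ F ∈ 𝓕, t ≤ (F ∩ U).card := fun F hF => by
    obtain ⟨h1, h2⟩ := hYF F hF
    have key : ∀ z, z ∈ F → z ∈ U → z ∉ Y → t ≤ (F ∩ U).card := fun z h3 h4 h5 => by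
      rw [← hY, ← card_insert_of_notMem h5]
      refine card_le_card (insert_subset (mem_inter.2 ⟨h3, h4⟩) fun w hw => ?_)
      exact mem_inter.2 ⟨h1 hw, mem_insert_of_mem (mem_insert_of_mem hw)⟩
    rcases h2 with h2 | h2
    · exact key i h2 (mem_insert_self _ _) hi
    · exact key j h2 (mem_insert_of_mem (mem_insert_self _ _)) hj
  have hall : ∀ A : Finset α, A.card = k → U ⊆ A → A ∈ 𝓕 := fun A hA hUA =>
    h.mem_of_superset (by omega) hFU hA hUA
  by_cases hs : ∀ x y, e x < e y → t + 2 ≤ (e y : ℕ) → ∀ F ∈ 𝓕, y ∈ F → x ∉ F →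
      insert x (F.erase y) ∈ 𝓕
  · exact h.eq_hilt_of_ordered ht hk hkn hn hn' e hs
  push Not at hs
  obtain ⟨x, y, hxy, hy, F, hF, hyF, hxF, hnF⟩ := hs
  have hyU : y ∉ U := fun h1 => by
    have := he y h1
    omega
  rw [← sw_eq_insert_erase hyF hxF] at hnF
  have hxU : x ∉ U := fun h1 => by
    refine hnF (hall _ (by rw [card_sw, h.card_eq F hF]) fun z hz => ?_)
    by_cases hzx : z = x
    · rw [hzx, left_mem_sw]
      exact hyF
    rw [mem_sw_of_ne hzx fun (h2 : z = y) => hyU (h2 ▸ hz)]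
    obtain ⟨h2, h3⟩ := hYF F hF
    simp only [hU, mem_insert] at h1 hz
    rcases h1 with rfl | rfl | h1
    · rcases hz with rfl | rfl | hz
      · exact absurd rfl hzx
      · tauto
      · exact h2 hz
    · rcases hz with rfl | rfl | hz
      · tauto
      · exact absurd rfl hzx
      · exact h2 hz
    · exact absurd (h2 h1) hxF
  have hneU : ∀ z ∈ U, z ≠ x ∧ z ≠ y := fun z hz => ⟨fun h => hxU (h ▸ hz), fun h => hyU (h ▸ hz)⟩
  have hswU : ∀ z ∈ U, ∀ G, z ∈ sw x y G ↔ z ∈ G := fun z hz G =>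
    mem_sw_of_ne (hneU z hz).1 (hneU z hz).2
  have hYU : Y ⊆ U := fun z hz => mem_insert_of_mem (mem_insert_of_mem hz)
  have hiU : i ∈ U := mem_insert_self _ _
  have hjU : j ∈ U := mem_insert_of_mem (mem_insert_self _ _)
  have hYS : ∀ G ∈ shiftFam x y 𝓕, Y ⊆ G ∧ (i ∈ G ∨ j ∈ G) := by
    intro G hG
    rcases mem_shiftFam.1 hG with ⟨h1, -⟩ | ⟨-, -, h1⟩
    · exact hYF G h1
    · obtain ⟨h2, h3⟩ := hYF _ h1
      rw [hswU i hiU, hswU j hjU] at h3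
      exact ⟨fun z hz => (hswU z (hYU hz) G).1 (h2 hz), h3⟩
  have hallS : ∀ A : Finset α, A.card = k → U ⊆ A →
      A ∈ shiftFam x y 𝓕 := fun A hA hUA =>
    mem_shiftFam.2 (Or.inl ⟨hall A hA hUA, fun _ _ => hall _ (by rw [card_sw, hA]) fun z hz =>
      (hswU z hz A).2 (hUA hz)⟩)
  have hS : IsExtremal k t (shiftFam x y 𝓕) := by
    refine h.shift fun T hT => ?_
    by_contra! hTS
    have hTU : T ⊆ U := fun z hz => by
      by_contra hzU
      obtain ⟨A, hA1, hA2, hA3⟩ := exists_subsuperset_card_eq (s := U) (t := univ.erase z) (n := k)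
        (fun w hw => mem_erase.2 ⟨fun h => hzU (h ▸ hw), mem_univ w⟩) (by omega) (by
          rw [card_erase_of_mem (mem_univ z), card_univ]
          omega)
      exact (mem_erase.1 (hA2 (hTS A (hallS A hA3 hA1) hz))).1 rfl
    obtain ⟨G, hG, hTG⟩ := h.nontrivial T hT
    refine hTG fun z hz => ?_
    by_cases hGS : G ∈ shiftFam x y 𝓕
    · exact hTS G hGS hz
    · exact (hswU z (hTU hz) G).1 (hTS _ (sw_mem_shiftFam hG hGS).2.2 hz)
  obtain ⟨T, D, hTD, hT, hD, hDk, hSD⟩ := ih _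
    (by rw [← hw]; exact weight_shiftFam_lt hxy hF hyF hxF hnF) hS hYS rfl
  obtain ⟨T', D', h1, h2, h3, h4⟩ := eq_hilt_of_shiftFam ht h.inter hTD hT hD hDk hn hSD
  exact ⟨T', D', h1, h2, by omega, by omega, h4⟩

lemma IsExtremal.eq_hilt (ht : 1 ≤ t) (hk : t + 1 ≤ k) (hkn : k + 1 ≤ Fintype.card α)
    (hn : 2 * k + 2 ≤ Fintype.card α + t)
    (hn' : (t + 3) * (k + 1) < 2 * Fintype.card α + (t + 3) * t) (h : IsExtremal k t 𝓕) :
    ∃ T D : Finset α, T ⊆ D ∧ T.card = t ∧ t + 2 ≤ D.card ∧ D.card ≤ k + 1 ∧ 𝓕 = hilt k T D := by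
  set e := Fintype.equivFin α
  induction hw : weight (fun z => (e z : ℕ)) 𝓕 using Nat.strong_induction_on generalizing 𝓕 with
  | _ w ih =>
  by_cases hs : ∀ x y, e x < e y → t + 2 ≤ (e y : ℕ) → ∀ F ∈ 𝓕, y ∈ F → x ∉ F →
      insert x (F.erase y) ∈ 𝓕
  · exact h.eq_hilt_of_ordered ht hk hkn hn hn' e hs
  push Not at hs
  obtain ⟨x, y, hxy, -, F, hF, hyF, hxF, hnF⟩ := hs
  rw [← sw_eq_insert_erase hyF hxF] at hnF
  by_cases hS : ∀ T : Finset α, T.card = t → ∃ F ∈ shiftFam x y 𝓕, ¬ T ⊆ F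
  · obtain ⟨T, D, hTD, hT, hD, hDk, hSD⟩ := ih _
      (by rw [← hw]; exact weight_shiftFam_lt hxy hF hyF hxF hnF) (h.shift hS) rfl
    obtain ⟨T', D', h1, h2, h3, h4⟩ := eq_hilt_of_shiftFam ht h.inter hTD hT hD hDk hn hSD
    exact ⟨T', D', h1, h2, by omega, by omega, h4⟩
  · push Not at hS
    obtain ⟨T, hT, hTS⟩ := hS
    obtain ⟨G, hG, hTG⟩ := h.nontrivial T hT
    obtain ⟨hyG, hxG, hGS⟩ := sw_mem_shiftFam hG fun h => hTG (hTS G h)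
    have hyT : y ∉ T := fun h => hxG (right_mem_sw.1 (hTS _ hGS h))
    have hxT : x ∈ T := by
      by_contra hxT
      refine hTG fun z hz => ?_
      exact (mem_sw_of_ne (fun (h : z = x) => hxT (h ▸ hz)) fun (h : z = y) => hyT (h ▸ hz)).1 (hTS _ hGS hz)
    refine h.eq_hilt_of_pair ht hk hkn hn hn' (Y := T.erase x) (i := x) (j := y) ?_ ?_
      (notMem_erase x T) (fun h => hyT (mem_of_mem_erase h)) ?_
    · rw [card_erase_of_mem hxT]
      omega
    · rintro rfl
      exact hyT hxT
    · intro A hA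
      by_cases hAS : A ∈ shiftFam x y 𝓕
      · exact ⟨(erase_subset x T).trans (hTS A hAS), Or.inl (hTS A hAS hxT)⟩
      · obtain ⟨h1, -, h2⟩ := sw_mem_shiftFam hA hAS
        refine ⟨fun z hz => ?_, Or.inr h1⟩
        rw [mem_erase] at hz
        exact (mem_sw_of_ne hz.1 fun (h : z = y) => hyT (h ▸ hz.2)).1 (hTS _ h2 hz.2)

/-- The largest nontrivial `t`-intersecting families are the extreme families `hilt k T D`. -/
theorem IsExtremal.exists_eq_hilt (ht : 1 ≤ t) (hk : t + 1 ≤ k) (hkn : k + 1 ≤ Fintype.card α)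
    (hn : (t + 3) * (k + 1) < 2 * Fintype.card α + (t + 3) * t) (h : IsExtremal k t 𝓕) :
    ∃ T D : Finset α, T ⊆ D ∧ T.card = t ∧ (D.card = t + 2 ∨ D.card = k + 1) ∧
      𝓕 = hilt k T D := by
  have hn₂ : 2 * k + 2 ≤ Fintype.card α + t := by
    obtain ⟨m, rfl⟩ := Nat.exists_eq_add_of_le hk
    nlinarith
  obtain ⟨T, D, hTD, hT, hD, hDk, rfl⟩ := h.eq_hilt ht hk hkn hn₂ hn
  exact ⟨T, D, hTD, hT, h.card_eq_or_card_eq ht hk hkn hn₂ hTD hT hD hDk, rfl⟩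

lemma exists_isExtremal (ht : 1 ≤ t) (hk : t + 1 ≤ k) (hkn : k + 1 ≤ Fintype.card α) :
    ∃ 𝓖 : Finset (Finset α), IsExtremal k t 𝓖 := by
  classical
  obtain ⟨D, -, hD⟩ := exists_subset_card_eq (s := (univ : Finset α)) (n := t + 2)
    (by rw [card_univ]; omega)
  obtain ⟨T, hTD, hT⟩ := exists_subset_card_eq (s := D) (n := t) (by omega)
  have h1 : ((univ : Finset (Finset (Finset α))).filter (IsNontrivialInter k t)).Nonempty :=
    ⟨hilt k T D, mem_filter.2 ⟨mem_univ _,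
      isNontrivialInter_hilt ht hTD hT (by omega) (by omega) hkn⟩⟩
  obtain ⟨𝓖, h2, h3⟩ := exists_max_image _ card h1
  rw [mem_filter] at h2
  exact ⟨𝓖, h2.2, fun 𝓗 h => h3 𝓗 (mem_filter.2 ⟨mem_univ _, h⟩)⟩

end Induction

section Transfer

variable {β γ : Type*} [DecidableEq β] [DecidableEq γ]

/-- Membership in `hilt k T D`, without reference to the ground set. -/
def InHilt (k : ℕ) (T D F : Finset β) : Prop :=
  F.card = k ∧ ((T ⊆ F ∧ (F ∩ (D \ T)).Nonempty) ∨ ∃ x ∈ T, D.erase x ⊆ F)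

lemma inHilt_map (f : β ↪ γ) {k : ℕ} {T D F : Finset β} :
    InHilt k (T.map f) (D.map f) (F.map f) ↔ InHilt k T D F := by
  rw [InHilt, InHilt, card_map, map_subset_map, ← Finset.map_sdiff, ← map_inter, map_nonempty]
  simp only [mem_map, exists_exists_and_eq_and, ← map_erase, map_subset_map]

lemma inHilt_iff_of_card_eq_add_two {k : ℕ} {T D F : Finset β} (hTD : T ⊆ D)
    (hD : D.card = T.card + 2) :
    InHilt k T D F ↔ F.card = k ∧ T.card + 1 ≤ (F ∩ D).card := by
  rw [InHilt]
  refine and_congr_right fun _ => ⟨?_, fun h => ?_⟩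
  · rintro (⟨h1, y, hy⟩ | ⟨x, hx, h⟩)
    · rw [mem_inter, mem_sdiff] at hy
      rw [← card_insert_of_notMem hy.2.2]
      exact card_le_card (insert_subset (mem_inter.2 ⟨hy.1, hy.2.1⟩) (subset_inter h1 hTD))
    · have := card_le_card (subset_inter h (erase_subset x D))
      rw [card_erase_of_mem (hTD hx)] at this
      omega
  · have h1 := card_sdiff_add_card_inter D F
    rw [inter_comm] at h1
    by_cases hTF : T ⊆ F
    · refine Or.inl ⟨hTF, ?_⟩
      by_contra h2
      rw [not_nonempty_iff_eq_empty] at h2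
      have h3 : F ∩ D ⊆ T := fun z hz => by
        by_contra hzT
        rw [mem_inter] at hz
        exact notMem_empty z (h2 ▸ mem_inter.2 ⟨hz.1, mem_sdiff.2 ⟨hz.2, hzT⟩⟩)
      have := card_le_card h3
      omega
    · obtain ⟨x, hx, hxF⟩ := not_subset.1 hTF
      refine Or.inr ⟨x, hx, fun z hz => ?_⟩
      rw [mem_erase] at hz
      by_contra hzF
      exact hz.1 (card_le_one.1 (by omega : (D \ F).card ≤ 1) z (mem_sdiff.2 ⟨hz.2, hzF⟩) x
        (mem_sdiff.2 ⟨hTD hx, hxF⟩))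

lemma inHilt_iff_of_card_eq_add_one {k : ℕ} {T D F : Finset β} (hTD : T ⊆ D)
    (hD : D.card = k + 1) : InHilt k T D F ↔
      (F.card = k ∧ T ⊆ F ∧ (F ∩ (D \ T)).Nonempty) ∨ ∃ x ∈ T, D \ {x} = F := by
  rw [InHilt, and_or_left]
  refine or_congr_right ⟨?_, ?_⟩
  · rintro ⟨h1, x, hx, h2⟩
    refine ⟨x, hx, ?_⟩
    rw [sdiff_singleton_eq_erase]
    exact eq_of_subset_of_card_le h2 (by rw [card_erase_of_mem (hTD hx)]; omega)
  · rintro ⟨x, hx, rfl⟩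
    rw [sdiff_singleton_eq_erase, card_erase_of_mem (hTD hx)]
    exact ⟨by omega, x, hx, Subset.rfl⟩

lemma exists_perm_map_eq {A B : Finset β} (h : A.card = B.card) :
    ∃ τ : Equiv.Perm β, A.map τ.toEmbedding = B ∧ ∀ z, z ∉ A → z ∉ B → τ z = z := by
  induction hm : (A \ B).card generalizing A with
  | zero =>
    have h1 : A ⊆ B := by rwa [card_eq_zero, sdiff_eq_empty_iff_subset] at hm
    have h2 := eq_of_subset_of_card_le h1 h.ge
    exact ⟨Equiv.refl β, by rw [h2]; exact map_refl, fun _ _ _ => rfl⟩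
  | succ m ih =>
    obtain ⟨a, ha⟩ : (A \ B).Nonempty := card_pos.1 (by omega)
    obtain ⟨b, hb⟩ : (B \ A).Nonempty := card_pos.1 (by
      rw [card_sdiff_comm h.symm]
      omega)
    have ha' := mem_sdiff.1 ha
    rw [mem_sdiff] at hb
    have hsw : sw b a A = insert b (A.erase a) := sw_eq_insert_erase ha'.1 hb.2
    obtain ⟨τ, h1, h2⟩ := ih (A := sw b a A) (by rw [card_sw, h]) (by
      have h3 : sw b a A \ B = (A \ B).erase a := by
        rw [hsw]
        ext z
        simp only [mem_sdiff, mem_insert, mem_erase]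
        constructor
        · rintro ⟨rfl | hz, hz'⟩
          · exact absurd hb.1 hz'
          · exact ⟨hz.1, hz.2, hz'⟩
        · exact fun hz => ⟨Or.inr ⟨hz.1, hz.2.1⟩, hz.2.2⟩
      rw [h3, card_erase_of_mem ha]
      omega)
    refine ⟨(Equiv.swap b a).trans τ, ?_, fun z hzA hzB => ?_⟩
    · rw [← h1, sw, map_map]
      rfl
    · have hzb : z ≠ b := fun h => hzB (h ▸ hb.1)
      have hza : z ≠ a := fun h => hzA (h ▸ ha'.1)
      rw [Equiv.trans_apply, Equiv.swap_apply_of_ne_of_ne hzb hza]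
      exact h2 z (by rwa [mem_sw_of_ne hzb hza]) hzB

lemma exists_perm_map_eq_of_subset {S T D T₀ D₀ : Finset β} (hTD : T ⊆ D) (hD : D ⊆ S)
    (hTD₀ : T₀ ⊆ D₀) (hD₀ : D₀ ⊆ S) (hT : T₀.card = T.card) (hDc : D₀.card = D.card) :
    ∃ τ : Equiv.Perm β, T₀.map τ.toEmbedding = T ∧ D₀.map τ.toEmbedding = D ∧
      ∀ z, z ∉ S → τ z = z := by
  obtain ⟨τ, h1, h2⟩ := exists_perm_map_eq hT
  set D₁ := D₀.map τ.toEmbedding with hD₁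
  have hTD₁ : T ⊆ D₁ := by
    rw [← h1]
    exact map_subset_map.2 hTD₀
  have hD₁c : D₁.card = D.card := by rw [hD₁, card_map, hDc]
  obtain ⟨ρ, h3, h4⟩ := exists_perm_map_eq (A := D₁ \ T) (B := D \ T) (by
    rw [card_sdiff_of_subset hTD₁, card_sdiff_of_subset hTD, hD₁c])
  have hτS : ∀ z, z ∉ S → τ z = z := fun z hz =>
    h2 z (fun h => hz (hD₀ (hTD₀ h))) fun h => hz (hD (hTD h))
  have hD₁S : D₁ ⊆ S := fun z hz => by
    by_contra hzS
    rw [hD₁, mem_map_equiv] at hz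
    have h5 : τ z = τ (τ.symm z) := by rw [hτS z hzS, Equiv.apply_symm_apply]
    exact hzS (hD₀ (τ.injective h5 ▸ hz))
  have hρT : T.map ρ.toEmbedding = T := by
    ext z
    rw [mem_map]
    have hfix : ∀ w ∈ T, ρ w = w := fun w hw =>
      h4 w (fun h => (mem_sdiff.1 h).2 hw) fun h => (mem_sdiff.1 h).2 hw
    constructor
    · rintro ⟨w, hw, rfl⟩
      rw [Equiv.coe_toEmbedding, hfix w hw]
      exact hw
    · exact fun hz => ⟨z, hz, hfix z hz⟩
  refine ⟨τ.trans ρ, ?_, ?_, fun z hz => ?_⟩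
  · rw [Equiv.trans_toEmbedding, ← map_map, h1, hρT]
  · rw [Equiv.trans_toEmbedding, ← map_map, ← hD₁, ← union_sdiff_of_subset hTD₁, map_union, h3, hρT,
      union_sdiff_of_subset hTD]
  · rw [Equiv.trans_apply, hτS z hz]
    exact h4 z (fun h => hz (hD₁S (mem_sdiff.1 h).1)) fun h => hz (hD (mem_sdiff.1 h).1)

lemma apply_mem_of_fixes_compl {S : Finset β} {τ : Equiv.Perm β} (h : ∀ z, z ∉ S → τ z = z) {z : β}
    (hz : z ∈ S) : τ z ∈ S := by
  by_contra h1
  exact h1 ((τ.injective (h _ h1)).symm ▸ hz)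

lemma exists_perm_hilt_image_eq {S : Finset β} {k : ℕ} {T D : Finset S} {T₀ D₀ : Finset β}
    {𝓗 : Finset (Finset β)} (hTD : T ⊆ D) (hTD₀ : T₀ ⊆ D₀) (hD₀ : D₀ ⊆ S)
    (hT : T₀.card = T.card) (hD : D₀.card = D.card)
    (h𝓗 : ∀ F, F ∈ 𝓗 ↔ F ⊆ S ∧ InHilt k T₀ D₀ F) :
    ∃ τ : Equiv.Perm β, (∀ x ∈ S, τ x ∈ S) ∧
      (hilt k T D).image (fun F => F.map (Function.Embedding.subtype _)) =
        𝓗.image fun F => F.image τ := by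
  have hS : ∀ F : Finset S, F.map (Function.Embedding.subtype _) ⊆ S := fun F z hz => by
    obtain ⟨w, -, rfl⟩ := mem_map.1 hz
    exact w.2
  obtain ⟨τ, h1, h2, h3⟩ := exists_perm_map_eq_of_subset (S := S)
    (map_subset_map.2 hTD) (hS D) hTD₀ hD₀
    (hT.trans (card_map (Function.Embedding.subtype _)).symm)
    (hD.trans (card_map (Function.Embedding.subtype _)).symm)
  have h4 : ∀ F : Finset β, F.image τ = F.map τ.toEmbedding := fun F =>
    (map_eq_image τ.toEmbedding F).symm
  have hmS : ∀ x, τ x ∈ S ↔ x ∈ S := fun x => by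
    refine ⟨fun h => ?_, apply_mem_of_fixes_compl h3⟩
    by_contra hx
    rw [h3 x hx] at h
    exact hx h
  refine ⟨τ, fun x => (hmS x).2, ?_⟩
  ext G
  simp only [mem_image, h4]
  constructor
  · rintro ⟨F, hF, rfl⟩
    have h5 := (inHilt_map (Function.Embedding.subtype _)).2 (mem_hilt.1 hF)
    have h6 : ((F.map (Function.Embedding.subtype _)).map τ.symm.toEmbedding).map τ.toEmbedding =
        F.map (Function.Embedding.subtype _) := by
      rw [map_map, ← Equiv.trans_toEmbedding, Equiv.symm_trans_self]
      exact map_refl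
    rw [← h1, ← h2, ← h6, inHilt_map] at h5
    refine ⟨_, (h𝓗 _).2 ⟨fun z hz => ?_, h5⟩, h6⟩
    rw [mem_map_equiv, Equiv.symm_symm] at hz
    exact (hmS z).1 (hS F hz)
  · rintro ⟨F, hF, rfl⟩
    obtain ⟨hFS, h5⟩ := (h𝓗 F).1 hF
    have h6 : ((F.map τ.toEmbedding).subtype (· ∈ S)).map (Function.Embedding.subtype _) =
        F.map τ.toEmbedding := by
      refine subtype_map_of_mem fun z hz => ?_
      obtain ⟨w, hw, rfl⟩ := mem_map.1 hz
      exact (hmS w).2 (hFS hw)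
    refine ⟨_, mem_hilt.2 ?_, h6⟩
    rw [← inHilt_map τ.toEmbedding, h1, h2, ← h6] at h5
    exact (inHilt_map _).1 h5

lemma card_le_card_inter_of_wise {d t : ℕ} {𝓕 : Finset (Finset β)}
    (hint : ∀ G : Fin (d + 2) → Finset β, (∀ i, G i ∈ 𝓕) → t ≤ (⋂ i, (G i : Set β)).ncard)
    (hnontriv : (⋂ F ∈ (𝓕 : Set (Finset β)), (F : Set β)).ncard < t) {A B : Finset β}
    (hA : A ∈ 𝓕) (hB : B ∈ 𝓕) : t + d ≤ (A ∩ B).card := by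
  have hlist : ∀ (L : List (Finset β)) (X : Finset β), L.length ≤ d + 2 → (∀ F ∈ L, F ∈ 𝓕) →
      (∀ z, (∀ F ∈ L, z ∈ F) → z ∈ X) → t ≤ X.card := by
    intro L X hL hLF hX
    refine (hint (fun i => L.getD i A) fun i => ?_).trans ?_
    · rw [List.getD_eq_getElem?_getD]
      rcases lt_or_ge (i : ℕ) L.length with h | h
      · rw [List.getElem?_eq_getElem h]
        exact hLF _ (List.getElem_mem h)
      · rw [List.getElem?_eq_none h]
        exact hA
    · rw [← Set.ncard_coe_finset]
      refine Set.ncard_le_ncard (fun z hz => hX z fun F hF => ?_) X.finite_toSet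
      obtain ⟨i, hi, rfl⟩ := List.getElem_of_mem hF
      have h1 := Set.mem_iInter.1 hz ⟨i, by omega⟩
      rwa [List.getD_eq_getElem _ _ hi] at h1
  have key : ∀ j ≤ d, ∃ (L : List (Finset β)) (X : Finset β), L.length = j + 2 ∧
      (∀ F ∈ L, F ∈ 𝓕) ∧ (∀ z, (∀ F ∈ L, z ∈ F) → z ∈ X) ∧ X.card + j ≤ (A ∩ B).card ∧ X ⊆ A := by
    intro j
    induction j with
    | zero =>
      intro _
      refine ⟨[A, B], A ∩ B, rfl, ?_, ?_, le_rfl, inter_subset_left⟩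
      · simp [hA, hB]
      · simp
    | succ j ih =>
      intro hj
      obtain ⟨L, X, h1, h2, h3, h4, h5⟩ := ih (by omega)
      have h6 := hlist L X (by omega) h2 h3
      obtain ⟨F, hF, hXF⟩ : ∃ F ∈ 𝓕, ¬ X ⊆ F := by
        by_contra! hall
        refine absurd hnontriv (not_lt.2 (h6.trans ?_))
        rw [← Set.ncard_coe_finset]
        refine Set.ncard_le_ncard (Set.subset_iInter₂ fun F hF => ?_)
          (A.finite_toSet.subset (Set.biInter_subset_of_mem hA))
        exact_mod_cast hall F hF
      refine ⟨F :: L, X ∩ F, by simp [h1], ?_, fun z hz => ?_, ?_, inter_subset_left.trans h5⟩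
      · simpa [hF] using h2
      · exact mem_inter.2 ⟨h3 z fun G hG => hz G (List.mem_cons_of_mem F hG),
          hz F List.mem_cons_self⟩
      · have : X ∩ F ⊂ X := ⟨inter_subset_left, fun h => hXF (h.trans inter_subset_right)⟩
        have := card_lt_card this
        omega
  obtain ⟨L, X, h1, h2, h3, h4, -⟩ := key d le_rfl
  have := hlist L X (by omega) h2 h3
  omega

end Transfer

section Standard

variable {n k s : ℕ} {F : Finset ℕ}

lemma mem_famA : F ∈ famA n k (s + 1) ↔
    F ⊆ Icc 1 n ∧ InHilt k (Icc 1 s) (Icc 1 (s + 2)) F := by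
  rw [inHilt_iff_of_card_eq_add_two (Icc_subset_Icc_right (by omega)) (by simp)]
  simp [famA, mem_powersetCard, and_assoc]

lemma mem_famH (hnk : k + 1 ≤ n) (hs : s ≤ k) : F ∈ famH n k (s + 1) ↔
    F ⊆ Icc 1 n ∧ InHilt k (Icc 1 s) (Icc 1 (k + 1)) F := by
  have h1 : Icc 1 s ⊆ Icc 1 (k + 1) := Icc_subset_Icc_right (by omega)
  have h2 : Icc 1 (k + 1) ⊆ Icc 1 n := Icc_subset_Icc_right hnk
  have h3 : Icc (s + 1) (k + 1) = Icc 1 (k + 1) \ Icc 1 s := by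
    ext z
    simp only [mem_Icc, mem_sdiff]
    omega
  rw [inHilt_iff_of_card_eq_add_one h1 (by simp), famH, mem_union, mem_filter, mem_powersetCard,
    mem_image, Nat.add_sub_cancel, h3, and_or_left]
  refine or_congr (by tauto) ⟨fun h => ⟨?_, h⟩, fun h => h.2⟩
  obtain ⟨x, -, rfl⟩ := h
  exact sdiff_subset.trans h2

/-- A largest nontrivial `s`-intersecting family of `k`-subsets of `[n]` is a copy of
`A(n, k, s + 1)` or of `H(n, k, s + 1)`. -/
lemma IsExtremal.exists_perm {𝓖 : Finset (Finset (Icc 1 n))} (h : IsExtremal k s 𝓖) (hs : 1 ≤ s)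
    (hk : s + 1 ≤ k) (hnk : k + 1 ≤ n) (hn : (s + 3) * (k + 1) < 2 * n + (s + 3) * s) :
    ∃ σ : Equiv.Perm ℕ, (∀ x ∈ Icc 1 n, σ x ∈ Icc 1 n) ∧
      (𝓖.image (fun F => F.map (Function.Embedding.subtype _)) =
          (famA n k (s + 1)).image (fun F => F.image σ) ∨
        𝓖.image (fun F => F.map (Function.Embedding.subtype _)) =
          (famH n k (s + 1)).image (fun F => F.image σ)) := by
  have hc : Fintype.card (Icc 1 n) = n := by simp
  obtain ⟨T, D, hTD, hT, hD, rfl⟩ := h.exists_eq_hilt hs hk (by rwa [hc]) (by rwa [hc])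
  rcases hD with hD | hD
  · obtain ⟨τ, h1, h2⟩ := exists_perm_hilt_image_eq (k := k) (𝓗 := famA n k (s + 1)) hTD
      (Icc_subset_Icc_right (by omega : s ≤ s + 2)) (Icc_subset_Icc_right (by omega))
      (by simp [hT]) (by simp [hD]) fun _ => mem_famA
    exact ⟨τ, h1, Or.inl h2⟩
  · obtain ⟨τ, h1, h2⟩ := exists_perm_hilt_image_eq (k := k) (𝓗 := famH n k (s + 1)) hTD
      (Icc_subset_Icc_right (by omega : s ≤ k + 1)) (Icc_subset_Icc_right (by omega))
      (by simp [hT]) (by simp [hD]) fun _ => mem_famH hnk (by omega)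
    exact ⟨τ, h1, Or.inr h2⟩

lemma map_subtype_injective {β : Type*} (p : β → Prop) : Function.Injective
    fun F : Finset (Subtype p) => F.map (Function.Embedding.subtype p) :=
  map_injective _

lemma IsExtremal.card_eq_or {𝓖 : Finset (Finset (Icc 1 n))} (h : IsExtremal k s 𝓖) (hs : 1 ≤ s)
    (hk : s + 1 ≤ k) (hnk : k + 1 ≤ n) (hn : (s + 3) * (k + 1) < 2 * n + (s + 3) * s) :
    𝓖.card = (famA n k (s + 1)).card ∨ 𝓖.card = (famH n k (s + 1)).card := by
  obtain ⟨σ, -, h1⟩ := h.exists_perm hs hk hnk hn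
  rw [← card_image_of_injective 𝓖 (map_subtype_injective _)]
  refine h1.imp (fun h2 => ?_) fun h2 => ?_
  · rw [h2, card_image_of_injective _ (image_injective σ.injective)]
  · rw [h2, card_image_of_injective _ (image_injective σ.injective)]

theorem card_le_and_exists_perm {𝓕 : Finset (Finset ℕ)} (hs : 1 ≤ s) (hk : s + 1 ≤ k)
    (hnk : k + 1 ≤ n) (hn : (s + 3) * (k + 1) < 2 * n + (s + 3) * s)
    (hsub : ∀ F ∈ 𝓕, F ⊆ Icc 1 n) (h : IsNontrivialInter k s 𝓕) :
    𝓕.card ≤ max (famH n k (s + 1)).card (famA n k (s + 1)).card ∧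
      (𝓕.card = max (famH n k (s + 1)).card (famA n k (s + 1)).card →
        ∃ σ : Equiv.Perm ℕ, (∀ x ∈ Icc 1 n, σ x ∈ Icc 1 n) ∧
          (𝓕 = (famA n k (s + 1)).image (fun F => F.image σ) ∨
            𝓕 = (famH n k (s + 1)).image (fun F => F.image σ))) := by
  have hc : Fintype.card (Icc 1 n) = n := by simp
  set 𝓖 : Finset (Finset (Icc 1 n)) :=
    univ.filter fun F => F.map (Function.Embedding.subtype _) ∈ 𝓕 with h𝓖
  have hmem : ∀ F, F ∈ 𝓖 ↔ F.map (Function.Embedding.subtype _) ∈ 𝓕 := fun F => by simp [h𝓖]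
  have hlift : ∀ F ⊆ Icc 1 n, ((F.subtype (· ∈ Icc 1 n)).map (Function.Embedding.subtype _)) = F :=
    fun F hF => subtype_map_of_mem hF
  have h𝓕 : 𝓖.image (fun F => F.map (Function.Embedding.subtype _)) = 𝓕 := by
    ext F
    rw [mem_image]
    constructor
    · rintro ⟨G, hG, rfl⟩
      exact (hmem G).1 hG
    · intro hF
      refine ⟨_, (hmem _).2 ?_, hlift F (hsub F hF)⟩
      rwa [hlift F (hsub F hF)]
  have hcard : 𝓕.card = 𝓖.card := by
    rw [← h𝓕, card_image_of_injective 𝓖 (map_subtype_injective _)]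
  have h𝓖I : IsNontrivialInter k s 𝓖 := by
    refine ⟨fun F hF => ?_, fun F hF G hG => ?_, fun T hT => ?_⟩
    · rw [← h.card_eq _ ((hmem F).1 hF), card_map]
    · have h1 := h.inter _ ((hmem F).1 hF) _ ((hmem G).1 hG)
      rwa [← map_inter, card_map] at h1
    · obtain ⟨F, hF, hTF⟩ := h.nontrivial (T.map (Function.Embedding.subtype _))
        (by rw [card_map, hT])
      have hFS := hsub F hF
      rw [← hlift F hFS] at hF hTF
      exact ⟨_, (hmem _).2 hF, fun h1 => hTF (map_subset_map.2 h1)⟩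
  obtain ⟨𝓔, h𝓔⟩ := exists_isExtremal (α := Icc 1 n) hs hk (by rwa [hc])
  have hle : 𝓔.card ≤ max (famH n k (s + 1)).card (famA n k (s + 1)).card := by
    rcases h𝓔.card_eq_or hs hk hnk hn with h1 | h1
    · exact h1.le.trans (le_max_right _ _)
    · exact h1.le.trans (le_max_left _ _)
  rw [hcard]
  refine ⟨(h𝓔.card_le 𝓖 h𝓖I).trans hle, fun heq => ?_⟩
  have h𝓖E : IsExtremal k s 𝓖 := ⟨h𝓖I, fun 𝓗 h𝓗 => (h𝓔.card_le 𝓗 h𝓗).trans (heq ▸ hle)⟩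
  have h1 := h𝓖E.exists_perm hs hk hnk hn
  rwa [h𝓕] at h1

end Standard

end NontrivialIntersecting

/-- If `𝓕` is a nonempty nontrivial `d`-wise `t`-intersecting family of `k`-subsets of `[n]`,
with `d ≥ 2`, `t ≥ 1`, `k ≥ t+d-1`, `n ≥ k+1` and `2n > (t+d+1)(k-t-d+3)`, then
`|𝓕| ≤ max {|H(n,k,t+d-1)|, |A(n,k,t+d-1)|}`, with equality only if `𝓕` is the image of
`A(n,k,t+d-1)` or `H(n,k,t+d-1)` under a permutation of `[n]`. -/
theorem stmt_1 (n k d t : ℕ) (hd : 2 ≤ d) (ht : 1 ≤ t) (hk : t + d - 1 ≤ k) (hnk : k + 1 ≤ n)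
    (hn : ((t : ℤ) + d + 1) * ((k : ℤ) - t - d + 3) < 2 * n)
    (𝓕 : Finset (Finset ℕ)) (hne : 𝓕.Nonempty)
    (hunif : ∀ F ∈ 𝓕, F ⊆ Finset.Icc 1 n ∧ F.card = k)
    (hint : ∀ G : Fin d → Finset ℕ, (∀ i, G i ∈ 𝓕) → t ≤ (⋂ i, (G i : Set ℕ)).ncard)
    (hnontriv : (⋂ F ∈ (𝓕 : Set (Finset ℕ)), (F : Set ℕ)).ncard < t) :
    𝓕.card ≤ max (famH n k (t + d - 1)).card (famA n k (t + d - 1)).card ∧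
      (𝓕.card = max (famH n k (t + d - 1)).card (famA n k (t + d - 1)).card →
        ∃ σ : Equiv.Perm ℕ, (∀ x ∈ Finset.Icc 1 n, σ x ∈ Finset.Icc 1 n) ∧
          (𝓕 = (famA n k (t + d - 1)).image (fun F => F.image σ) ∨
            𝓕 = (famH n k (t + d - 1)).image (fun F => F.image σ))) := by
  obtain ⟨d, rfl⟩ := Nat.exists_eq_add_of_le' hd
  have hs : t + (d + 2) - 1 = t + d + 1 := by omega
  rw [hs] at hk ⊢
  refine NontrivialIntersecting.card_le_and_exists_perm (by omega) hk hnk ?_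
    (fun F hF => (hunif F hF).1) ⟨fun F hF => (hunif F hF).2, fun A hA B hB =>
      NontrivialIntersecting.card_le_card_inter_of_wise hint hnontriv hA hB, fun T hT => ?_⟩
  · zify
    push_cast at hn
    linarith
  · by_contra! hall
    obtain ⟨A, hA⟩ := hne
    have h1 : (T : Set ℕ) ⊆ ⋂ F ∈ (𝓕 : Set (Finset ℕ)), (F : Set ℕ) :=
      Set.subset_iInter₂ fun F hF => by exact_mod_cast hall F hF
    have h2 := Set.ncard_le_ncard h1 (A.finite_toSet.subset (Set.biInter_subset_of_mem hA))
    rw [Set.ncard_coe_finset] at h2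
    omega
end

section
/- Let d ≥ 3 and t ≥ 2 be integers, and let β be a real number with 0 < β < 1/2 satisfying (1-β)^{t+d-3} = β^{d-2}. For every real constant c > 1/β there exists n₀ such that for all integers n, k with n ≥ n₀, k ≥ t and n ≥ c·k, every d-wise t-intersecting family 𝓕 of k-element subsets of [n] satisfies |𝓕| ≤ C(n-t, k-t), with equality only if 𝓕 = {F ⊆ [n] : |F| = k, T ⊆ F} for some t-element set T ⊆ [n]. -/
theorem choose_lt_choose_of_pow_le {n k t e : ℕ} (ht : 2 ≤ t) (he : 1 ≤ e) (hk : t + e ≤ k)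
    (hkn : k ≤ n) (h : n ^ (t - 1) * k ^ e ≤ (n - k) ^ (t + e - 1)) :
    (n - 1).choose (k - (t + e)) < (n - t).choose (k - t) := by
  obtain ⟨a, rfl⟩ : ∃ a, k = t + e + a := ⟨k - (t + e), by omega⟩
  obtain ⟨b, rfl⟩ : ∃ b, n = t + e + a + b := ⟨n - (t + e + a), by omega⟩
  obtain ⟨u, rfl⟩ : ∃ u, t = u + 1 := ⟨t - 1, by omega⟩
  have e1 : u + 1 + e + a + b - 1 = u + e + a + b := by omega
  have e2 : u + 1 + e + a - (u + 1 + e) = a := by omega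
  have e3 : u + 1 + e + a + b - (u + 1) = e + a + b := by omega
  have e4 : u + 1 + e + a - (u + 1) = e + a := by omega
  have e5 : u + 1 + e + a + b - (u + 1 + e + a) = b := by omega
  have e6 : u + 1 + e - 1 = u + e := by omega
  rw [e5, e6, Nat.add_sub_cancel] at h
  rw [e1, e2, e3, e4]
  have h1 := Nat.add_choose_mul_factorial_mul_factorial (u + e + b) a
  have h2 := Nat.add_choose_mul_factorial_mul_factorial b (e + a)
  rw [show u + e + b + a = u + e + a + b by ring] at h1
  rw [show b + (e + a) = e + a + b by ring] at h2
  have f1 : (u + e + a + b).factorial ≤ (e + a + b).factorial * (u + 1 + e + a + b) ^ u := by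
    have := Nat.factorial_mul_ascFactorial (e + a + b) u
    rw [show u + e + a + b = e + a + b + u by ring, ← this]
    refine Nat.mul_le_mul_left _ ?_
    calc _ ≤ (e + a + b + u) ^ u := Nat.ascFactorial_le_pow_add _ _
      _ ≤ _ := Nat.pow_le_pow_left (by omega) _
  have f2 : (e + a).factorial ≤ a.factorial * (u + 1 + e + a) ^ e := by
    have := Nat.factorial_mul_ascFactorial a e
    rw [show e + a = a + e by ring, ← this]
    refine Nat.mul_le_mul_left _ ?_
    calc _ ≤ (a + e) ^ e := Nat.ascFactorial_le_pow_add _ _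
      _ ≤ _ := Nat.pow_le_pow_left (by omega) _
  have f3 : b.factorial * b ^ (u + e) < (u + e + b).factorial := by
    have := Nat.factorial_mul_ascFactorial b (u + e)
    rw [show u + e + b = b + (u + e) by ring, ← this]
    refine Nat.mul_lt_mul_of_pos_left ?_ (Nat.factorial_pos _)
    calc _ < (b + 1) ^ (u + e) := Nat.pow_lt_pow_left (by omega) (by omega)
      _ ≤ _ := Nat.pow_succ_le_ascFactorial _ _
  have key : (u + e + a + b).choose a * (a.factorial * (u + e + b).factorial * (e + a + b).factorial)
      < (e + a + b).choose (e + a) * (a.factorial * (u + e + b).factorial * (e + a + b).factorial) := by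
    calc _ = (u + e + a + b).factorial * (e + a + b).factorial := by rw [← h1]; ring
      _ ≤ ((e + a + b).factorial * (u + 1 + e + a + b) ^ u) * (e + a + b).factorial :=
          Nat.mul_le_mul_right _ f1
      _ = ((e + a + b).factorial * (u + 1 + e + a + b) ^ u) *
            ((e + a + b).choose (e + a) * b.factorial * (e + a).factorial) := by rw [h2]
      _ ≤ ((e + a + b).factorial * (u + 1 + e + a + b) ^ u) *
            ((e + a + b).choose (e + a) * b.factorial * (a.factorial * (u + 1 + e + a) ^ e)) := by
          gcongr
      _ = (e + a + b).choose (e + a) * (a.factorial * (e + a + b).factorial * (b.factorial *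
            ((u + 1 + e + a + b) ^ u * (u + 1 + e + a) ^ e))) := by ring
      _ ≤ (e + a + b).choose (e + a) * (a.factorial * (e + a + b).factorial * (b.factorial *
            b ^ (u + e))) := by gcongr
      _ < (e + a + b).choose (e + a) * (a.factorial * (e + a + b).factorial *
            (u + e + b).factorial) := by
          have : 0 < (e + a + b).choose (e + a) := Nat.choose_pos (by omega)
          have := Nat.factorial_pos a
          have := Nat.factorial_pos (e + a + b)
          gcongr
      _ = _ := by ring
  exact lt_of_mul_lt_mul_right key (Nat.zero_le _)

theorem pow_mul_pow_le_of_le {β : ℝ} {t e n k : ℕ} {c : ℝ} (hβ0 : 0 < β) (hβ1 : β < 1)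
    (hβ : (1 - β) ^ (t + e) = β ^ e) (hc : 1 / β < c) (hn : c * k ≤ (n : ℝ)) :
    n ^ t * k ^ e ≤ (n - k) ^ (t + e) := by
  have h1 : (k : ℝ) ≤ β * n := by
    have : 1 < c * β := by rwa [div_lt_iff₀ hβ0] at hc
    have hk : (0 : ℝ) ≤ k := k.cast_nonneg
    nlinarith
  have hkn : k ≤ n := by
    have : (k : ℝ) ≤ n := by nlinarith [(n.cast_nonneg : (0 : ℝ) ≤ n)]
    exact_mod_cast this
  have hn0 : (0 : ℝ) ≤ n := n.cast_nonneg
  have : (n : ℝ) ^ t * (k : ℝ) ^ e ≤ ((n : ℝ) - k) ^ (t + e) := by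
    calc (n : ℝ) ^ t * (k : ℝ) ^ e ≤ (n : ℝ) ^ t * (β * n) ^ e := by gcongr
      _ = ((1 - β) * n) ^ (t + e) := by rw [mul_pow, mul_pow, hβ]; ring
      _ ≤ _ := by
        refine pow_le_pow_left₀ (mul_nonneg (by linarith) hn0) (by linarith) _
  rw [← Nat.cast_sub hkn] at this
  exact_mod_cast this

section Families

open Finset

variable {α : Type*} [DecidableEq α]

theorem compress_singleton (a x : α) (A : Finset α) :
    UV.compress {x} {a} A = if x ∉ A ∧ a ∈ A then insert x A \ {a} else A := by
  simp only [UV.compress, disjoint_singleton_left, singleton_subset_iff,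
    sup_eq_union]
  congr 1
  ext; simp

theorem le_card_inter_of_mem_compression {𝓕 : Finset (Finset α)} {s : ℕ} (a x : α)
    (h𝓕 : ∀ A ∈ 𝓕, ∀ B ∈ 𝓕, s ≤ (A ∩ B).card) :
    ∀ A ∈ UV.compression {x} {a} 𝓕, ∀ B ∈ UV.compression {x} {a} 𝓕, s ≤ (A ∩ B).card := by
  have mixed : ∀ A ∈ 𝓕, UV.compress {x} {a} A ∈ 𝓕 → ∀ B ∈ 𝓕, UV.compress {x} {a} B ≠ B →
      s ≤ (A ∩ UV.compress {x} {a} B).card := by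
    intro A hA hA' B hB hne
    rw [compress_singleton] at hA' hne ⊢
    by_cases hBx : x ∉ B ∧ a ∈ B
    swap
    · simp [hBx] at hne
    rw [if_pos hBx]
    have hax : a ≠ x := fun h => hBx.1 (h ▸ hBx.2)
    by_cases hAa : a ∈ A
    · by_cases hAx : x ∈ A
      · refine (h𝓕 A hA B hB).trans ?_
        have : A ∩ (insert x B \ {a}) = insert x ((A ∩ B).erase a) := by ext y; grind
        rw [this, card_insert_of_notMem (by grind), card_erase_of_mem (by grind)]
        omega
      · rw [if_pos ⟨hAx, hAa⟩] at hA'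
        refine (h𝓕 _ hA' B hB).trans (card_le_card_of_injOn id ?_ (fun _ _ _ _ h => h))
        intro y hy
        simp only [coe_inter, coe_sdiff, coe_insert, coe_singleton, Set.mem_inter_iff,
          Set.mem_sdiff, Set.mem_insert_iff, SetLike.mem_coe, Set.mem_singleton_iff, id] at hy ⊢
        grind
    · refine (h𝓕 A hA B hB).trans (card_le_card ?_)
      intro y hy
      grind
  have both : ∀ A ∈ 𝓕, UV.compress {x} {a} A ≠ A → ∀ B ∈ 𝓕, UV.compress {x} {a} B ≠ B →
      s ≤ (UV.compress {x} {a} A ∩ UV.compress {x} {a} B).card := by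
    intro A hA hA' B hB hB'
    rw [compress_singleton] at hA' hB' ⊢
    rw [compress_singleton]
    split_ifs at hA' hB' ⊢ with h1 h2 <;> try exact absurd rfl (by assumption)
    have hax : a ≠ x := fun h => h1.1 (h ▸ h1.2)
    refine (h𝓕 A hA B hB).trans ?_
    have : (insert x A \ {a}) ∩ (insert x B \ {a}) = insert x ((A ∩ B).erase a) := by
      ext y; grind
    rw [this, card_insert_of_notMem (by grind), card_erase_of_mem (by grind)]
    omega
  intro A hA B hB
  rw [UV.mem_compression] at hA hB
  rcases hA with ⟨hA, hA'⟩ | ⟨hA, A', hA', rfl⟩ <;> rcases hB with ⟨hB, hB'⟩ | ⟨hB, B', hB', rfl⟩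
  · exact h𝓕 A hA B hB
  · exact mixed A hA hA' B' hB' (fun h => hB (by rwa [h]))
  · rw [inter_comm]
    exact mixed B hB hB' A' hA' (fun h => hA (by rwa [h]))
  · exact both A' hA' (fun h => hA (by rwa [h])) B' hB' (fun h => hB (by rwa [h]))

theorem subset_and_card_of_mem_compression {𝓕 : Finset (Finset α)} {k : ℕ} {S : Finset α}
    {a x : α} (hx : x ∈ S) (h𝓕 : ∀ F ∈ 𝓕, F ⊆ S ∧ F.card = k) :
    ∀ F ∈ UV.compression {x} {a} 𝓕, F ⊆ S ∧ F.card = k := by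
  intro F hF
  rw [UV.mem_compression] at hF
  rcases hF with ⟨hF, -⟩ | ⟨-, G, hG, rfl⟩
  · exact h𝓕 F hF
  · refine ⟨?_, (UV.card_compress (by simp) G).trans (h𝓕 G hG).2⟩
    rw [compress_singleton]
    have := (h𝓕 G hG).1
    split_ifs
    · exact sdiff_subset.trans (insert_subset hx this)
    · exact this

/-- Any uniform family with large pairwise intersections can be replaced by one of the same size
in which a prescribed element may be exchanged for any other one. -/
theorem exists_compressed {k s : ℕ} {S : Finset α} (a : α) (𝓕 : Finset (Finset α))
    (h𝓕 : ∀ F ∈ 𝓕, F ⊆ S ∧ F.card = k) (hs : ∀ A ∈ 𝓕, ∀ B ∈ 𝓕, s ≤ (A ∩ B).card) :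
    ∃ 𝓖 : Finset (Finset α), 𝓖.card = 𝓕.card ∧ (∀ F ∈ 𝓖, F ⊆ S ∧ F.card = k) ∧
      (∀ A ∈ 𝓖, ∀ B ∈ 𝓖, s ≤ (A ∩ B).card) ∧
      ∀ A ∈ 𝓖, a ∈ A → ∀ x ∈ S, x ∉ A → insert x A \ {a} ∈ 𝓖 := by
  induction hm : (𝓕.filter (a ∈ ·)).card using Nat.strong_induction_on generalizing 𝓕 with
  | _ m ih =>
    by_cases hstable : ∀ A ∈ 𝓕, a ∈ A → ∀ x ∈ S, x ∉ A → insert x A \ {a} ∈ 𝓕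
    · exact ⟨𝓕, rfl, h𝓕, hs, hstable⟩
    push Not at hstable
    obtain ⟨A, hA, haA, x, hxS, hxA, hA'⟩ := hstable
    have hax : a ≠ x := fun h => hxA (h ▸ haA)
    have hlt : ((UV.compression {x} {a} 𝓕).filter (a ∈ ·)).card < m := by
      rw [← hm]
      refine card_lt_card ⟨?_, fun h => ?_⟩
      · intro B hB
        rw [mem_filter, UV.mem_compression] at hB
        rcases hB with ⟨⟨hB, -⟩ | ⟨hB, C, hC, rfl⟩, haB⟩
        · exact mem_filter.2 ⟨hB, haB⟩
        · rw [compress_singleton] at hB haB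
          split_ifs at hB haB
          · simp at haB
          · exact absurd hC hB
      · have := h (mem_filter.2 ⟨hA, haA⟩)
        rw [mem_filter, UV.mem_compression, compress_singleton, if_pos ⟨hxA, haA⟩] at this
        rcases this with ⟨⟨-, h'⟩ | ⟨h', -⟩, -⟩
        · exact hA' h'
        · exact h' hA
    obtain ⟨𝓖, h1, h2⟩ := ih _ hlt (UV.compression {x} {a} 𝓕)
      (subset_and_card_of_mem_compression hxS h𝓕) (le_card_inter_of_mem_compression a x hs) rfl
    exact ⟨𝓖, h1.trans (UV.card_compression _ _ _), h2⟩

/-- The Erdős–Ko–Rado theorem for families of complements. -/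
theorem card_le_choose_of_union_ne {k n : ℕ} {S : Finset α} {𝓕 : Finset (Finset α)}
    (hS : S.card = n) (hkn : n ≤ 2 * k) (hk : k ≤ n) (h𝓕 : ∀ F ∈ 𝓕, F ⊆ S ∧ F.card = k)
    (hs : ∀ A ∈ 𝓕, ∀ B ∈ 𝓕, (A ∪ B).card < n) :
    𝓕.card ≤ (n - 1).choose (n - k - 1) := by
  let e : Fin n ≃ S := (finCongr hS.symm).trans S.equivFin.symm
  let f : Finset α → Finset (Fin n) := fun A => univ.filter (fun i => (e i : α) ∉ A)
  have hf : ∀ A ⊆ S, ∀ y ∈ S, y ∈ A ↔ ∀ i, (e i : α) = y → i ∉ f A := by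
    intro A _ y hy
    constructor
    · rintro h i rfl
      simpa [f] using h
    · intro h
      simpa [f] using h (e.symm ⟨y, hy⟩) (by simp)
  have hinj : Set.InjOn f 𝓕 := by
    intro A hA B hB hAB
    ext y
    by_cases hy : y ∈ S
    · rw [hf A (h𝓕 A hA).1 y hy, hAB, ← hf B (h𝓕 B hB).1 y hy]
    · exact ⟨fun h => absurd ((h𝓕 A hA).1 h) hy, fun h => absurd ((h𝓕 B hB).1 h) hy⟩
  rw [← card_image_of_injOn hinj]
  refine erdos_ko_rado ?_ ?_ (by omega)
  · intro A hA B hB hdisj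
    simp only [coe_image, Set.mem_image, SetLike.mem_coe] at hA hB
    obtain ⟨A, hA, rfl⟩ := hA
    obtain ⟨B, hB, rfl⟩ := hB
    refine absurd (card_le_card (?_ : S ⊆ A ∪ B)) (by have := hs A hA B hB; omega)
    intro y hy
    by_contra hcon
    rw [mem_union, not_or] at hcon
    refine disjoint_left.1 hdisj (?_ : e.symm ⟨y, hy⟩ ∈ f A) ?_
    · simpa [f] using hcon.1
    · simpa [f] using hcon.2
  · intro A hA
    simp only [coe_image, Set.mem_image, SetLike.mem_coe] at hA
    obtain ⟨A, hA, rfl⟩ := hA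
    have h1 : ((f A).map e.toEmbedding).map (Function.Embedding.subtype _) = S \ A := by
      ext y
      simp only [mem_map, mem_filter, mem_univ, true_and, f, mem_sdiff]
      constructor
      · rintro ⟨_, ⟨i, hi, rfl⟩, rfl⟩
        exact ⟨(e i).2, hi⟩
      · rintro ⟨hy, hyA⟩
        exact ⟨⟨y, hy⟩, ⟨e.symm ⟨y, hy⟩, by simpa using hyA, by simp⟩, rfl⟩
    have h2 := congrArg card h1
    rw [card_map, card_map, card_sdiff_of_subset (h𝓕 A hA).1, hS, (h𝓕 A hA).2] at h2
    exact h2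

/-- Frankl's bound for uniform `s`-intersecting families. -/
theorem card_le_choose_of_le_card_inter {s : ℕ} (hs1 : 1 ≤ s) (n : ℕ) :
    ∀ (k : ℕ) (S : Finset α) (𝓕 : Finset (Finset α)), S.card = n → s ≤ k → 2 * k + 1 ≤ n + s →
      (∀ F ∈ 𝓕, F ⊆ S ∧ F.card = k) → (∀ A ∈ 𝓕, ∀ B ∈ 𝓕, s ≤ (A ∩ B).card) →
      𝓕.card ≤ (n - 1).choose (k - s) := by
  induction n with
  | zero => intros; omega
  | succ n ih =>
    intro k S 𝓕 hS hsk hkn h𝓕 hs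
    have hunion : ∀ A ∈ 𝓕, ∀ B ∈ 𝓕, (A ∪ B).card + s ≤ 2 * k := by
      intro A hA B hB
      have := card_union_add_card_inter A B
      have := hs A hA B hB
      rw [(h𝓕 A hA).2, (h𝓕 B hB).2] at *
      omega
    rcases hsk.eq_or_lt with rfl | hsk
    · rw [Nat.sub_self, Nat.choose_zero_right, card_le_one]
      intro A hA B hB
      have h1 : A ∩ B = A := eq_of_subset_of_card_le inter_subset_left
        ((h𝓕 A hA).2.trans_le (hs A hA B hB))
      have h2 : A ∩ B = B := eq_of_subset_of_card_le inter_subset_right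
        ((h𝓕 B hB).2.trans_le (hs A hA B hB))
      rw [← h1, h2]
    rcases hkn.eq_or_lt with hkn | hkn
    · have := card_le_choose_of_union_ne hS (by omega) (by omega) h𝓕
        (fun A hA B hB => by have := hunion A hA B hB; omega)
      rwa [show n + 1 - k - 1 = k - s by omega] at this
    obtain ⟨a, ha⟩ : S.Nonempty := card_pos.1 (by omega)
    obtain ⟨𝓖, hcard, h𝓖, hs𝓖, hstable⟩ := exists_compressed a 𝓕 h𝓕 hs
    have hSa : (S.erase a).card = n := by rw [card_erase_of_mem ha, hS]; rfl
    have hcard₁ : (𝓖.memberSubfamily a).card ≤ (n - 1).choose (k - 1 - s) := by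
      refine ih (k - 1) (S.erase a) _ hSa (by omega) (by omega) ?_ ?_
      · intro F hF
        rw [mem_memberSubfamily] at hF
        obtain ⟨h1, h2⟩ := h𝓖 _ hF.1
        rw [card_insert_of_notMem hF.2] at h2
        exact ⟨subset_erase.2 ⟨(subset_insert _ _).trans h1, hF.2⟩, by omega⟩
      · intro A hA B hB
        rw [mem_memberSubfamily] at hA hB
        have hA2 := (h𝓖 _ hA.1)
        have hB2 := (h𝓖 _ hB.1)
        rw [card_insert_of_notMem hA.2] at hA2
        rw [card_insert_of_notMem hB.2] at hB2
        have hI := hs𝓖 _ hA.1 _ hB.1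
        rw [← insert_inter_distrib, card_insert_of_notMem (by grind)] at hI
        have hU := card_union_add_card_inter A B
        obtain ⟨x, hxS, hx⟩ : ∃ x ∈ S.erase a, x ∉ A ∪ B := by
          by_contra! hcon
          have := card_le_card (s := S.erase a) (t := A ∪ B) hcon
          omega
        have hstab := hstable _ hA.1 (mem_insert_self _ _) x (mem_of_mem_erase hxS) (by grind)
        refine (hs𝓖 _ hstab _ hB.1).trans (card_le_card ?_)
        intro y hy
        simp only [mem_inter, mem_sdiff, mem_insert, mem_singleton, mem_union, not_or] at hy hx ⊢
        obtain ⟨⟨rfl | h | h, hne⟩, h' | h'⟩ := hy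
        all_goals first | exact ⟨h, h'⟩ | contradiction | exact absurd h' hx.2
    have hcard₂ : (𝓖.nonMemberSubfamily a).card ≤ (n - 1).choose (k - s) := by
      refine ih k (S.erase a) _ hSa (by omega) (by omega) ?_ ?_
      · intro F hF
        rw [mem_nonMemberSubfamily] at hF
        obtain ⟨h1, h2⟩ := h𝓖 _ hF.1
        exact ⟨subset_erase.2 ⟨h1, hF.2⟩, h2⟩
      · intro A hA B hB
        rw [mem_nonMemberSubfamily] at hA hB
        exact hs𝓖 _ hA.1 _ hB.1
    have hsum := card_memberSubfamily_add_card_nonMemberSubfamily a 𝓖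
    obtain ⟨m, rfl⟩ : ∃ m, n = m + 1 := ⟨n - 1, by omega⟩
    obtain ⟨j, hj⟩ : ∃ j, k - s = j + 1 := ⟨k - s - 1, by omega⟩
    rw [show k - 1 - s = j by omega] at hcard₁
    rw [hj] at hcard₂ ⊢
    simp only [Nat.add_sub_cancel] at *
    rw [Nat.choose_succ_succ']
    omega

/-- If no `t`-set is contained in all members of a `d`-wise `t`-intersecting family, then each
decrease in the number of sets increases the size of the intersections by at least one. -/
theorem le_card_of_forall_not_subset {𝓕 : Finset (Finset α)} {d t : ℕ}
    (hint : ∀ G : ℕ → Finset α, (∀ i, G i ∈ 𝓕) → t ≤ ((G 0).filter (∀ i < d, · ∈ G i)).card)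
    (hnon : ∀ T : Finset α, T.card = t → ∃ F ∈ 𝓕, ¬ T ⊆ F) (j : ℕ) (hj : j < d) :
    ∀ G : ℕ → Finset α, (∀ i, G i ∈ 𝓕) →
      t + j ≤ ((G 0).filter (∀ i < d - j, · ∈ G i)).card := by
  induction j with
  | zero => exact hint
  | succ j ih =>
    intro G hG
    set I := (G 0).filter (∀ i < d - (j + 1), · ∈ G i) with hI
    have hIF : ∀ F ∈ 𝓕, t + j ≤ (I ∩ F).card := by
      intro F hF
      refine (ih (by omega) (Function.update G (d - (j + 1)) F) ?_).trans (card_le_card ?_)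
      · intro i
        rcases eq_or_ne i (d - (j + 1)) with rfl | hi
        · simpa using hF
        · simpa [hi] using hG i
      · intro y hy
        rw [mem_filter] at hy
        rw [mem_inter, hI, mem_filter]
        refine ⟨⟨?_, fun i hi => ?_⟩, ?_⟩
        · simpa [Function.update_of_ne (show 0 ≠ d - (j + 1) by omega)] using hy.1
        · simpa [hi.ne] using hy.2 i (by omega)
        · simpa using hy.2 (d - (j + 1)) (by omega)
    by_contra hlt
    have hle : t ≤ I.card := by
      have := hIF _ (hG 0)
      have := card_le_card (inter_subset_left (s₁ := I) (s₂ := G 0))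
      omega
    obtain ⟨T, hTI, hT⟩ := exists_subset_card_eq hle
    obtain ⟨F, hF, hTF⟩ := hnon T hT
    refine hTF (hTI.trans ?_)
    rw [← inter_eq_left]
    exact eq_of_subset_of_card_le inter_subset_left (by have := hIF F hF; omega)

theorem card_filter_powersetCard_of_subset {S T : Finset α} (hT : T ⊆ S) {k : ℕ}
    (hk : T.card ≤ k) :
    ((S.powersetCard k).filter (T ⊆ ·)).card = (S.card - T.card).choose (k - T.card) := by
  rw [← card_sdiff_of_subset hT, ← card_powersetCard]
  refine card_nbij' (· \ T) (· ∪ T) ?_ ?_ ?_ ?_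
  · intro F hF
    simp only [mem_coe, mem_filter, mem_powersetCard] at hF ⊢
    exact ⟨sdiff_subset_sdiff hF.1.1 subset_rfl, by rw [card_sdiff_of_subset hF.2, hF.1.2]⟩
  · intro F hF
    simp only [mem_coe, mem_filter, mem_powersetCard] at hF ⊢
    have hd : Disjoint F T := disjoint_of_subset_left hF.1 sdiff_disjoint
    refine ⟨⟨union_subset (hF.1.trans sdiff_subset) hT, ?_⟩, subset_union_right⟩
    rw [card_union_of_disjoint hd, hF.2]
    omega
  · intro F hF
    simp only [mem_coe, mem_filter] at hF
    exact sdiff_union_of_subset hF.2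
  · intro F hF
    simp only [mem_coe, mem_powersetCard] at hF
    exact union_sdiff_cancel_right (disjoint_of_subset_left hF.1 sdiff_disjoint)

end Families


/-- Improved-range EKR theorem for `d`-wise `t`-intersecting families: for `d ≥ 3`, `t ≥ 2`,
`β ∈ (0, 1/2)` with `(1-β)^(t+d-3) = β^(d-2)`, and any constant `c > 1/β`, there is `n₀`
such that for `n ≥ n₀`, `k ≥ t`, `n ≥ c·k`, every `d`-wise `t`-intersecting family `𝓕` of
`k`-subsets of `[n]` has `|𝓕| ≤ C(n-t, k-t)`, with equality only for a trivial family. -/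
theorem stmt_3 (d t : ℕ) (hd : 3 ≤ d) (ht : 2 ≤ t)
    (β : ℝ) (hβ0 : 0 < β) (hβ2 : β < 1 / 2)
    (hβ : (1 - β) ^ (t + d - 3) = β ^ (d - 2))
    (c : ℝ) (hc : 1 / β < c) :
    ∃ n₀ : ℕ, ∀ n k : ℕ, n₀ ≤ n → t ≤ k → c * k ≤ (n : ℝ) →
      ∀ 𝓕 : Finset (Finset ℕ),
        (∀ F ∈ 𝓕, F ⊆ Finset.Icc 1 n ∧ F.card = k) →
        (∀ G : Fin d → Finset ℕ, (∀ i, G i ∈ 𝓕) → t ≤ (⋂ i, (G i : Set ℕ)).ncard) →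
        𝓕.card ≤ (n - t).choose (k - t) ∧
          (𝓕.card = (n - t).choose (k - t) →
            ∃ T ⊆ Finset.Icc 1 n, T.card = t ∧
              𝓕 = ((Finset.Icc 1 n).powersetCard k).filter (fun F => T ⊆ F)) := by
  refine ⟨0, fun n k _ htk hn 𝓕 h𝓕 hint => ?_⟩
  have h2k : 2 * k ≤ n := by
    have hc2 : 2 < c := lt_trans (by rw [lt_div_iff₀ hβ0]; linarith) hc
    have : (2 : ℝ) * k ≤ n := by nlinarith [(k.cast_nonneg : (0 : ℝ) ≤ k)]
    exact_mod_cast this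
  have hS : (Finset.Icc 1 n).card = n := by simp
  rcases 𝓕.eq_empty_or_nonempty with rfl | ⟨F₀, hF₀⟩
  · refine ⟨Nat.zero_le _, fun h => absurd h.symm ?_⟩
    exact (Nat.choose_pos (by omega)).ne'
  by_cases htriv : ∃ T : Finset ℕ, T.card = t ∧ ∀ F ∈ 𝓕, T ⊆ F
  · obtain ⟨T, hT, hTF⟩ := htriv
    have hTn : T ⊆ Finset.Icc 1 n := (hTF F₀ hF₀).trans (h𝓕 F₀ hF₀).1
    have hsub : 𝓕 ⊆ ((Finset.Icc 1 n).powersetCard k).filter (fun F => T ⊆ F) := fun F hF =>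
      Finset.mem_filter.2 ⟨Finset.mem_powersetCard.2 (h𝓕 F hF), hTF F hF⟩
    have hcard := card_filter_powersetCard_of_subset hTn (k := k) (by omega)
    rw [hS, hT] at hcard
    refine ⟨hcard ▸ Finset.card_le_card hsub, fun h => ⟨T, hTn, hT, ?_⟩⟩
    exact Finset.eq_of_subset_of_card_le hsub (by rw [hcard, h])
  · push Not at htriv
    have hint' : ∀ G : ℕ → Finset ℕ, (∀ i, G i ∈ 𝓕) →
        t ≤ ((G 0).filter (∀ i < d, · ∈ G i)).card := by
      intro G hG
      refine (hint (fun i => G i) (fun i => hG i)).trans_eq ?_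
      rw [← Set.ncard_coe_finset]
      congr 1
      ext y
      simp only [Set.mem_iInter, Finset.mem_coe, Finset.mem_filter]
      exact ⟨fun h => ⟨h ⟨0, by omega⟩, fun i hi => h ⟨i, hi⟩⟩, fun h i => h.2 i i.2⟩
    have hpair : ∀ A ∈ 𝓕, ∀ B ∈ 𝓕, t + (d - 2) ≤ (A ∩ B).card := by
      intro A hA B hB
      refine (le_card_of_forall_not_subset hint' htriv (d - 2) (by omega)
        (fun i => if i = 0 then A else B) (fun i => ?_)).trans (Finset.card_le_card ?_)
      · split_ifs <;> assumption
      · intro y hy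
        rw [Finset.mem_filter] at hy
        exact Finset.mem_inter.2 ⟨hy.1, hy.2 1 (by omega)⟩
    have hsk : t + (d - 2) ≤ k := by
      simpa [(h𝓕 F₀ hF₀).2] using hpair F₀ hF₀ F₀ hF₀
    have hle := card_le_choose_of_le_card_inter (by omega) n k _ 𝓕 hS hsk (by omega) h𝓕 hpair
    have hpow := pow_mul_pow_le_of_le (t := t - 1) (e := d - 2) (n := n) (k := k) hβ0
      (by linarith) (by rw [← hβ]; congr 1; omega) hc hn
    have hlt := choose_lt_choose_of_pow_le (n := n) (k := k) ht (show 1 ≤ d - 2 by omega) hsk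
      (by omega) (by rwa [show t + (d - 2) - 1 = t - 1 + (d - 2) by omega])
    exact ⟨(hle.trans_lt hlt).le, fun h => absurd h (hle.trans_lt hlt).ne⟩
end

section
/- Let d ≥ 3 and t ≥ 2 be integers, let n ≥ t, and let β be a real number with 0 < β < 1/2 satisfying (1-β)^{t+d-3} = β^{d-2}. If 𝓕 ⊆ 2^{[n]} is a d-wise t-intersecting family of subsets of [n], then for every real p with 0 < p < β we have μ_p(𝓕) ≤ p^t. -/
/-- The image of `F` under the `(i, j)`-shift of the family `𝓕`, which replaces `i` by `j`. -/
def shiftSet (𝓕 : Finset (Finset ℕ)) (i j : ℕ) (F : Finset ℕ) : Finset ℕ :=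
  if i ∈ F ∧ j ∉ F ∧ insert j (F.erase i) ∉ 𝓕 then insert j (F.erase i) else F

lemma card_insert_erase_of_mem {F : Finset ℕ} {i j : ℕ} (hi : i ∈ F) (hj : j ∉ F) :
    (insert j (F.erase i)).card = F.card := by
  rw [Finset.card_insert_of_notMem (fun h => hj (Finset.mem_of_mem_erase h)),
    Finset.card_erase_of_mem hi]
  have := Finset.card_pos.2 ⟨i, hi⟩
  omega

lemma card_shiftSet (𝓕 : Finset (Finset ℕ)) (i j : ℕ) (F : Finset ℕ) :
    (shiftSet 𝓕 i j F).card = F.card := by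
  unfold shiftSet
  split_ifs with h
  · exact card_insert_erase_of_mem h.1 h.2.1
  · rfl

lemma shiftSet_injOn (𝓕 : Finset (Finset ℕ)) (i j : ℕ) :
    Set.InjOn (shiftSet 𝓕 i j) 𝓕 := by
  intro F hF G hG h
  unfold shiftSet at h
  split_ifs at h with h1 h2 h2
  · ext x
    have hx := Finset.ext_iff.1 h x
    simp only [Finset.mem_insert, Finset.mem_erase] at hx
    by_cases hxi : x = i
    · subst hxi; simp [h1.1, h2.1]
    by_cases hxj : x = j
    · subst hxj; simp [h1.2.1, h2.2.1]
    simpa [hxi, hxj] using hx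
  · exact absurd (h ▸ hG) h1.2.2
  · exact absurd (h ▸ hF) h2.2.2
  · exact h

lemma le_card_inter_insert_erase {𝓕 : Finset (Finset ℕ)} {s i j : ℕ}
    (hint : ∀ F ∈ 𝓕, ∀ G ∈ 𝓕, s ≤ (F ∩ G).card) {F G : Finset ℕ} (hF : F ∈ 𝓕) (hG : G ∈ 𝓕)
    (hi : i ∈ F) (hj : j ∉ F) (hG' : ¬(i ∈ G ∧ j ∉ G ∧ insert j (G.erase i) ∉ 𝓕)) :
    s ≤ (insert j (F.erase i) ∩ G).card := by
  by_cases hiG : i ∈ G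
  · by_cases hjG : j ∈ G
    · have h : insert j (F.erase i) ∩ G = insert j ((F ∩ G).erase i) := by
        ext x
        simp only [Finset.mem_inter, Finset.mem_insert, Finset.mem_erase]
        grind
      rw [h, card_insert_erase_of_mem (by simp [hi, hiG]) (by simp [hj])]
      exact hint F hF G hG
    · have hmem : insert j (G.erase i) ∈ 𝓕 := by
        by_contra h
        exact hG' ⟨hiG, hjG, h⟩
      have h : insert j (F.erase i) ∩ G = F ∩ insert j (G.erase i) := by
        ext x
        simp only [Finset.mem_inter, Finset.mem_insert, Finset.mem_erase]
        grind
      rw [h]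
      exact hint F hF _ hmem
  · refine (hint F hF G hG).trans (Finset.card_le_card fun x hx => ?_)
    simp only [Finset.mem_inter, Finset.mem_insert, Finset.mem_erase] at hx ⊢
    grind

lemma le_card_shiftSet_inter {𝓕 : Finset (Finset ℕ)} {s : ℕ} (i j : ℕ)
    (hint : ∀ F ∈ 𝓕, ∀ G ∈ 𝓕, s ≤ (F ∩ G).card) {F G : Finset ℕ} (hF : F ∈ 𝓕) (hG : G ∈ 𝓕) :
    s ≤ (shiftSet 𝓕 i j F ∩ shiftSet 𝓕 i j G).card := by
  unfold shiftSet
  split_ifs with h1 h2 h2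
  · have h : insert j (F.erase i) ∩ insert j (G.erase i) = insert j ((F ∩ G).erase i) := by
      ext x
      simp only [Finset.mem_inter, Finset.mem_insert, Finset.mem_erase]
      tauto
    rw [h, card_insert_erase_of_mem (by simp [h1.1, h2.1]) (by simp [h1.2.1])]
    exact hint F hF G hG
  · exact le_card_inter_insert_erase hint hF hG h1.1 h1.2.1 h2
  · rw [Finset.inter_comm]
    exact le_card_inter_insert_erase hint hG hF h2.1 h2.2.1 h1
  · exact hint F hF G hG

/-- Every `s`-intersecting family can be replaced by a shifted one with the same
distribution of cardinalities. -/
lemma exists_shifted (n s : ℕ) (w : ℕ → ℝ) (𝓕 : Finset (Finset ℕ))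
    (hsub : ∀ F ∈ 𝓕, F ⊆ Finset.Icc 1 n) (hint : ∀ F ∈ 𝓕, ∀ G ∈ 𝓕, s ≤ (F ∩ G).card) :
    ∃ 𝓖 : Finset (Finset ℕ), (∀ F ∈ 𝓖, F ⊆ Finset.Icc 1 n) ∧
      (∀ F ∈ 𝓖, ∀ G ∈ 𝓖, s ≤ (F ∩ G).card) ∧
      (∀ F ∈ 𝓖, ∀ i ∈ F, ∀ j ∈ Finset.Icc 1 n, i < j → j ∉ F → insert j (F.erase i) ∈ 𝓖) ∧
      ∑ F ∈ 𝓖, w F.card = ∑ F ∈ 𝓕, w F.card := by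
  classical
  let C := ((Finset.Icc 1 n).powerset.powerset).filter fun 𝓖 : Finset (Finset ℕ) =>
    (∀ F ∈ 𝓖, ∀ G ∈ 𝓖, s ≤ (F ∩ G).card) ∧ ∑ F ∈ 𝓖, w F.card = ∑ F ∈ 𝓕, w F.card
  have hC : ∀ 𝓖, 𝓖 ∈ C ↔ (∀ F ∈ 𝓖, F ⊆ Finset.Icc 1 n) ∧
      (∀ F ∈ 𝓖, ∀ G ∈ 𝓖, s ≤ (F ∩ G).card) ∧
        ∑ F ∈ 𝓖, w F.card = ∑ F ∈ 𝓕, w F.card := by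
    intro 𝓖
    simp only [C, Finset.mem_filter, Finset.mem_powerset, Finset.subset_iff (s₁ := 𝓖)]
  obtain ⟨𝓖, h𝓖, hmax⟩ := Finset.exists_max_image C (fun 𝓖 => ∑ F ∈ 𝓖, ∑ x ∈ F, x)
    ⟨𝓕, (hC 𝓕).2 ⟨hsub, hint, rfl⟩⟩
  obtain ⟨h1, h2, h3⟩ := (hC 𝓖).1 h𝓖
  refine ⟨𝓖, h1, h2, ?_, h3⟩
  intro F hF i hi j hj hij hjF
  by_contra hbad
  have hmem : 𝓖.image (shiftSet 𝓖 i j) ∈ C := by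
    refine (hC _).2 ⟨?_, ?_, ?_⟩
    · intro G hG
      obtain ⟨H, hH, rfl⟩ := Finset.mem_image.1 hG
      unfold shiftSet
      split_ifs
      · exact Finset.insert_subset hj ((Finset.erase_subset _ _).trans (h1 H hH))
      · exact h1 H hH
    · intro G hG G' hG'
      obtain ⟨H, hH, rfl⟩ := Finset.mem_image.1 hG
      obtain ⟨H', hH', rfl⟩ := Finset.mem_image.1 hG'
      exact le_card_shiftSet_inter i j h2 hH hH'
    · rw [Finset.sum_image (shiftSet_injOn 𝓖 i j), ← h3]
      exact Finset.sum_congr rfl fun G _ => by rw [card_shiftSet]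
  have hlt : ∀ G : Finset ℕ, i ∈ G → j ∉ G → ∑ x ∈ G, x < ∑ x ∈ insert j (G.erase i), x := by
    intro G hiG hjG
    rw [Finset.sum_insert (fun h => hjG (Finset.mem_of_mem_erase h)),
      ← Finset.add_sum_erase G (fun x => x) hiG]
    simpa using hij
  have hle := hmax _ hmem
  rw [Finset.sum_image (shiftSet_injOn 𝓖 i j)] at hle
  refine absurd hle (not_le.2 (Finset.sum_lt_sum ?_ ⟨F, hF, ?_⟩))
  · intro G _
    unfold shiftSet
    split_ifs with h
    · exact (hlt G h.1 h.2.1).le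
    · exact le_rfl
  · rw [shiftSet, if_pos ⟨hi, hjF, hbad⟩]
    exact hlt F hi hjF

open Classical in
/-- The `p`-biased measure of the part of `A` inside `2^[n]`. -/
noncomputable def biasedMeasure (p : ℝ) (n : ℕ) (A : Set (Finset ℕ)) : ℝ :=
  ∑ F ∈ (Finset.Icc 1 n).powerset, if F ∈ A then p ^ F.card * (1 - p) ^ (n - F.card) else 0

/-- The trace of `A` on `2^[n]` is increasing, shifted (towards large elements) and
`s`-intersecting. -/
structure IsShiftedIntersecting (n s : ℕ) (A : Set (Finset ℕ)) : Prop where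
  inter : ∀ F ∈ A, F ⊆ Finset.Icc 1 n → ∀ G ∈ A, G ⊆ Finset.Icc 1 n → s ≤ (F ∩ G).card
  up : ∀ F ∈ A, ∀ G, F ⊆ G → G ⊆ Finset.Icc 1 n → G ∈ A
  shifted : ∀ F ∈ A, F ⊆ Finset.Icc 1 n → ∀ i ∈ F, ∀ j ∈ Finset.Icc 1 n, i < j → j ∉ F →
    insert j (F.erase i) ∈ A

lemma Icc_one_succ (n : ℕ) : Finset.Icc 1 (n + 1) = insert (n + 1) (Finset.Icc 1 n) := by
  ext x
  simp only [Finset.mem_Icc, Finset.mem_insert]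
  omega

lemma succ_notMem_of_subset {n : ℕ} {F : Finset ℕ} (hF : F ⊆ Finset.Icc 1 n) : n + 1 ∉ F := by
  intro h
  have := Finset.mem_Icc.1 (hF h)
  omega

lemma biasedMeasure_nonneg {p : ℝ} (hp0 : 0 ≤ p) (hp1 : p ≤ 1) (n : ℕ) (A : Set (Finset ℕ)) :
    0 ≤ biasedMeasure p n A := by
  have : 0 ≤ 1 - p := by linarith
  refine Finset.sum_nonneg fun F _ => ?_
  split_ifs <;> positivity

lemma biasedMeasure_mono {p : ℝ} (hp0 : 0 ≤ p) (hp1 : p ≤ 1) {n : ℕ} {A B : Set (Finset ℕ)}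
    (h : ∀ F ∈ A, F ⊆ Finset.Icc 1 n → F ∈ B) : biasedMeasure p n A ≤ biasedMeasure p n B := by
  have : 0 ≤ 1 - p := by linarith
  refine Finset.sum_le_sum fun F hF => ?_
  by_cases hA : F ∈ A
  · simp [hA, h F hA (Finset.mem_powerset.1 hF)]
  · rw [if_neg hA]
    split_ifs <;> positivity

lemma biasedMeasure_zero (p : ℝ) (A : Set (Finset ℕ)) [Decidable (∅ ∈ A)] :
    biasedMeasure p 0 A = if ∅ ∈ A then 1 else 0 := by
  simp [biasedMeasure]

lemma biasedMeasure_succ (p : ℝ) (n : ℕ) (A : Set (Finset ℕ)) :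
    biasedMeasure p (n + 1) A =
      p * biasedMeasure p n {F | insert (n + 1) F ∈ A} + (1 - p) * biasedMeasure p n A := by
  unfold biasedMeasure
  rw [Icc_one_succ, Finset.sum_powerset_insert (by simp), add_comm, Finset.mul_sum,
    Finset.mul_sum]
  congr 1
  · refine Finset.sum_congr rfl fun F hF => ?_
    rw [Finset.card_insert_of_notMem (succ_notMem_of_subset (Finset.mem_powerset.1 hF))]
    by_cases h : insert (n + 1) F ∈ A
    · simp only [Set.mem_ofPred_eq, h, if_true, Nat.add_sub_add_right]
      ring
    · simp [h]
  · refine Finset.sum_congr rfl fun F hF => ?_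
    have hc : F.card ≤ n := by simpa using Finset.card_le_card (Finset.mem_powerset.1 hF)
    rw [Nat.sub_add_comm hc]
    split_ifs <;> ring

lemma IsShiftedIntersecting.link {n s : ℕ} {A : Set (Finset ℕ)}
    (h : IsShiftedIntersecting (n + 1) s A) :
    IsShiftedIntersecting n (s - 1) {F | insert (n + 1) F ∈ A} := by
  have hins : ∀ F ⊆ Finset.Icc 1 n, insert (n + 1) F ⊆ Finset.Icc 1 (n + 1) := fun F hF => by
    rw [Icc_one_succ]; exact Finset.insert_subset_insert _ hF
  refine ⟨fun F hF hFn G hG hGn => ?_, fun F hF G hFG hGn => ?_,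
    fun F hF hFn i hi j hj hij hjF => ?_⟩
  · have := h.inter _ hF (hins F hFn) _ hG (hins G hGn)
    rw [← Finset.insert_inter_distrib] at this
    have := this.trans (Finset.card_insert_le _ _)
    omega
  · exact h.up _ hF _ (Finset.insert_subset_insert _ hFG) (hins G hGn)
  · have hi' := Finset.mem_Icc.1 (hFn hi)
    have hj' := Finset.mem_Icc.1 hj
    have := h.shifted _ hF (hins F hFn) i (Finset.mem_insert_of_mem hi) j
      (Finset.mem_Icc.2 (by omega)) hij (by simp only [Finset.mem_insert, hjF, or_false]; omega)
    rw [Finset.erase_insert_of_ne (by omega), Finset.insert_comm] at this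
    exact this

lemma IsShiftedIntersecting.restrict {n s : ℕ} {A : Set (Finset ℕ)}
    (h : IsShiftedIntersecting (n + 1) s A) : IsShiftedIntersecting n s A := by
  have hn : Finset.Icc 1 n ⊆ Finset.Icc 1 (n + 1) := Finset.Icc_subset_Icc_right (Nat.le_succ n)
  exact ⟨fun F hF hFn G hG hGn => h.inter F hF (hFn.trans hn) G hG (hGn.trans hn),
    fun F hF G hFG hGn => h.up F hF G hFG (hGn.trans hn),
    fun F hF hFn i hi j hj hij hjF => h.shifted F hF (hFn.trans hn) i hi j (hn hj) hij hjF⟩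

lemma IsShiftedIntersecting.restrict_succ {n s : ℕ} {A : Set (Finset ℕ)}
    (h : IsShiftedIntersecting (n + 1) (s + 1) A) : IsShiftedIntersecting n (s + 2) A := by
  have hn : Finset.Icc 1 n ⊆ Finset.Icc 1 (n + 1) := Finset.Icc_subset_Icc_right (Nat.le_succ n)
  refine ⟨fun F hF hFn G hG hGn => ?_, h.restrict.up, h.restrict.shifted⟩
  have hFG := h.inter F hF (hFn.trans hn) G hG (hGn.trans hn)
  obtain ⟨x, hx⟩ := Finset.card_pos.1 (Nat.lt_of_lt_of_le (Nat.succ_pos s) hFG)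
  obtain ⟨hxF, hxG⟩ := Finset.mem_inter.1 hx
  have hxn := Finset.mem_Icc.1 (hFn hxF)
  have hmem : n + 1 ∈ Finset.Icc 1 (n + 1) := by simp
  have hF' := h.shifted F hF (hFn.trans hn) x hxF (n + 1) hmem (by omega)
    (succ_notMem_of_subset hFn)
  have hcard := h.inter _ hF'
    (Finset.insert_subset hmem ((Finset.erase_subset _ _).trans (hFn.trans hn))) G hG
    (hGn.trans hn)
  rw [Finset.insert_inter_of_notMem (succ_notMem_of_subset hGn), Finset.erase_inter,
    Finset.card_erase_of_mem hx] at hcard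
  omega

/-- Comparison of the measures of a shifted `s`-intersecting family at `p` and `1 - p`. -/
lemma IsShiftedIntersecting.pow_mul_le {p : ℝ} (hp0 : 0 ≤ p) (hp2 : p ≤ 1 / 2) (n : ℕ) :
    ∀ (s : ℕ) (A : Set (Finset ℕ)), IsShiftedIntersecting n s A →
      (1 - p) ^ s * biasedMeasure p n A ≤ p ^ s * biasedMeasure (1 - p) n A := by
  classical
  induction n with
  | zero =>
    intro s A h
    rw [biasedMeasure_zero, biasedMeasure_zero]
    split_ifs with hA
    · have hs := h.inter ∅ hA (by simp) ∅ hA (by simp)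
      simp only [Finset.inter_empty, Finset.card_empty, Nat.le_zero] at hs
      simp [hs]
    · simp
  | succ n ih =>
    intro s A h
    rw [biasedMeasure_succ, biasedMeasure_succ]
    have h1 := ih _ _ h.link
    rcases s with _ | s
    · have h0 := ih _ _ h.restrict
      have hmono : biasedMeasure (1 - p) n A ≤
          biasedMeasure (1 - p) n {F | insert (n + 1) F ∈ A} := by
        refine biasedMeasure_mono (by linarith) (by linarith) fun F hF hFn => ?_
        refine h.up F hF _ (Finset.subset_insert _ _) ?_
        rw [Icc_one_succ]
        exact Finset.insert_subset_insert _ hFn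
      simp only [pow_zero, one_mul, Nat.zero_sub] at h0 h1 ⊢
      have hq : 0 ≤ 1 - p := by linarith
      nlinarith [mul_le_mul_of_nonneg_left h1 hp0, mul_le_mul_of_nonneg_left h0 hq,
        mul_nonneg (show 0 ≤ 1 - 2 * p by linarith) (sub_nonneg.2 hmono)]
    · have h0 := ih _ _ h.restrict_succ
      rw [Nat.add_sub_cancel] at h1
      have hpq : 0 ≤ p * (1 - p) := mul_nonneg hp0 (by linarith)
      have := mul_le_mul_of_nonneg_left h1 hpq
      calc _ = p * (1 - p) * ((1 - p) ^ s * biasedMeasure p n {F | insert (n + 1) F ∈ A}) +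
            (1 - p) ^ (s + 2) * biasedMeasure p n A := by ring
        _ ≤ p * (1 - p) * (p ^ s * biasedMeasure (1 - p) n {F | insert (n + 1) F ∈ A}) +
            p ^ (s + 2) * biasedMeasure (1 - p) n A := add_le_add this h0
        _ = _ := by ring

lemma biasedMeasure_add_le_one {p : ℝ} (hp0 : 0 ≤ p) (hp1 : p ≤ 1) {n : ℕ} {A : Set (Finset ℕ)}
    (h : ∀ F ∈ A, F ⊆ Finset.Icc 1 n → ∀ G ∈ A, G ⊆ Finset.Icc 1 n → 1 ≤ (F ∩ G).card) :
    biasedMeasure p n A + biasedMeasure (1 - p) n A ≤ 1 := by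
  classical
  have hq : 0 ≤ 1 - p := by linarith
  have hcompl : biasedMeasure (1 - p) n A = ∑ F ∈ (Finset.Icc 1 n).powerset,
      if Finset.Icc 1 n \ F ∈ A then p ^ F.card * (1 - p) ^ (n - F.card) else 0 := by
    unfold biasedMeasure
    refine Finset.sum_nbij' (fun F => Finset.Icc 1 n \ F) (fun F => Finset.Icc 1 n \ F)
      (by simp) (by simp) ?_ ?_ ?_
    · intro F hF
      exact Finset.sdiff_sdiff_eq_self (Finset.mem_powerset.1 hF)
    · intro F hF
      exact Finset.sdiff_sdiff_eq_self (Finset.mem_powerset.1 hF)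
    · intro F hF
      have hFn := Finset.mem_powerset.1 hF
      have hc : F.card ≤ n := by simpa using Finset.card_le_card hFn
      rw [Finset.sdiff_sdiff_eq_self hFn, Finset.card_sdiff_of_subset hFn, Nat.card_Icc,
        Nat.add_sub_cancel, Nat.sub_sub_self hc, sub_sub_cancel, mul_comm]
  have htotal : ∑ F ∈ (Finset.Icc 1 n).powerset, p ^ F.card * (1 - p) ^ (n - F.card) = 1 := by
    have := Finset.sum_pow_mul_eq_add_pow p (1 - p) (Finset.Icc 1 n)
    simpa using this
  refine le_trans ?_ htotal.le
  rw [hcompl, biasedMeasure, ← Finset.sum_add_distrib]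
  refine Finset.sum_le_sum fun F hF => ?_
  have hw : 0 ≤ p ^ F.card * (1 - p) ^ (n - F.card) := by positivity
  by_cases h1 : F ∈ A
  · by_cases h2 : Finset.Icc 1 n \ F ∈ A
    · have := h F h1 (Finset.mem_powerset.1 hF) _ h2 Finset.sdiff_subset
      simp at this
    · simp [h1, h2]
  · split_ifs <;> simp [hw]

lemma IsShiftedIntersecting.pow_mul_le_pow {p : ℝ} (hp0 : 0 ≤ p) (hp2 : p ≤ 1 / 2) (n : ℕ) :
    ∀ (s : ℕ) (A : Set (Finset ℕ)), IsShiftedIntersecting n (s + 1) A →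
      (1 - p) ^ s * biasedMeasure p n A ≤ p ^ (s + 1) := by
  classical
  induction n with
  | zero =>
    intro s A h
    rw [biasedMeasure_zero, if_neg]
    · simpa using pow_nonneg hp0 (s + 1)
    · intro hA
      simpa using h.inter ∅ hA (by simp) ∅ hA (by simp)
  | succ n ih =>
    intro s A h
    rcases s with _ | s
    · have h1 := h.pow_mul_le hp0 hp2
      have h2 := biasedMeasure_add_le_one hp0 (by linarith) h.inter
      simp only [zero_add, pow_one, pow_zero, one_mul] at h1 ⊢
      nlinarith
    · rw [biasedMeasure_succ]
      have hpq : 0 ≤ p * (1 - p) := mul_nonneg hp0 (by linarith)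
      have h1 := mul_le_mul_of_nonneg_left (ih s _ h.link) hpq
      have h0 := ih _ _ h.restrict_succ
      calc _ = p * (1 - p) * ((1 - p) ^ s * biasedMeasure p n {F | insert (n + 1) F ∈ A}) +
            (1 - p) ^ (s + 2) * biasedMeasure p n A := by ring
        _ ≤ p * (1 - p) * p ^ (s + 1) + p ^ (s + 2 + 1) := add_le_add h1 h0
        _ = _ := by ring

/-- An `(s+1)`-intersecting family has `p`-biased measure at most `p^(s+1) / (1-p)^s`. -/
lemma pow_mul_sum_le_of_intersecting {p : ℝ} (hp0 : 0 ≤ p) (hp2 : p ≤ 1 / 2) (n s : ℕ)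
    (𝓕 : Finset (Finset ℕ)) (hsub : ∀ F ∈ 𝓕, F ⊆ Finset.Icc 1 n)
    (hint : ∀ F ∈ 𝓕, ∀ G ∈ 𝓕, s + 1 ≤ (F ∩ G).card) :
    (1 - p) ^ s * ∑ F ∈ 𝓕, p ^ F.card * (1 - p) ^ (n - F.card) ≤ p ^ (s + 1) := by
  classical
  have hq : 0 ≤ 1 - p := by linarith
  obtain ⟨𝓖, h1, h2, h3, h4⟩ :=
    exists_shifted n (s + 1) (fun k => p ^ k * (1 - p) ^ (n - k)) 𝓕 hsub hint
  have hA : IsShiftedIntersecting n (s + 1) {F | ∃ G ∈ 𝓖, G ⊆ F} := by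
    refine ⟨?_, ?_, ?_⟩
    · rintro F ⟨F', hF', hFF⟩ - G ⟨G', hG', hGG⟩ -
      exact (h2 F' hF' G' hG').trans (Finset.card_le_card (Finset.inter_subset_inter hFF hGG))
    · rintro F ⟨F', hF', hFF⟩ G hFG -
      exact ⟨F', hF', hFF.trans hFG⟩
    · rintro F ⟨F', hF', hFF⟩ - i - j hj hij hjF
      by_cases hiF' : i ∈ F'
      · exact ⟨_, h3 F' hF' i hiF' j hj hij (fun h => hjF (hFF h)),
          Finset.insert_subset_insert _ (Finset.erase_subset_erase _ hFF)⟩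
      · refine ⟨F', hF', fun x hx => Finset.mem_insert_of_mem (Finset.mem_erase.2 ⟨?_, hFF hx⟩)⟩
        rintro rfl
        exact hiF' hx
  refine le_trans (mul_le_mul_of_nonneg_left ?_ (pow_nonneg hq s)) (hA.pow_mul_le_pow hp0 hp2)
  rw [← h4]
  have hsum : ∑ F ∈ 𝓖, p ^ F.card * (1 - p) ^ (n - F.card) = biasedMeasure p n 𝓖 := by
    simp only [biasedMeasure, Finset.mem_coe]
    rw [← Finset.sum_filter, Finset.filter_mem_eq_inter, Finset.inter_eq_right.2]
    exact fun F hF => Finset.mem_powerset.2 (h1 F hF)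
  rw [hsum]
  exact biasedMeasure_mono hp0 (by linarith) fun F hF _ => ⟨F, hF, subset_rfl⟩

lemma sum_le_pow_card_of_forall_subset {p : ℝ} (hp0 : 0 ≤ p) (hp1 : p ≤ 1) (n : ℕ)
    (𝓕 : Finset (Finset ℕ)) (hsub : ∀ F ∈ 𝓕, F ⊆ Finset.Icc 1 n) (T : Finset ℕ)
    (hT : ∀ F ∈ 𝓕, T ⊆ F) :
    ∑ F ∈ 𝓕, p ^ F.card * (1 - p) ^ (n - F.card) ≤ p ^ T.card := by
  classical
  have hq : 0 ≤ 1 - p := by linarith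
  rcases 𝓕.eq_empty_or_nonempty with rfl | ⟨F₀, hF₀⟩
  · simpa using pow_nonneg hp0 T.card
  have hTn : T ⊆ Finset.Icc 1 n := (hT F₀ hF₀).trans (hsub F₀ hF₀)
  let g : ℕ → ℝ := fun i => if i ∈ T then 0 else 1 - p
  have hg : ∀ i, 0 ≤ g i := fun i => by simp only [g]; split_ifs <;> simp [hq]
  have hprod : ∏ i ∈ Finset.Icc 1 n, (p + g i) = p ^ T.card := by
    have : ∀ i, p + g i = if i ∈ T then p else 1 := fun i => by
      simp only [g]; split_ifs <;> ring
    simp only [this]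
    rw [Finset.prod_ite, Finset.prod_const, Finset.prod_const_one, mul_one,
      Finset.filter_mem_eq_inter, Finset.inter_eq_right.2 hTn]
  rw [← hprod, Finset.prod_add]
  calc _ = ∑ F ∈ 𝓕, (∏ i ∈ F, p) * ∏ i ∈ Finset.Icc 1 n \ F, g i := by
        refine Finset.sum_congr rfl fun F hF => ?_
        have : ∏ i ∈ Finset.Icc 1 n \ F, g i = ∏ i ∈ Finset.Icc 1 n \ F, (1 - p) := by
          refine Finset.prod_congr rfl fun i hi => if_neg fun hiT => ?_
          exact (Finset.mem_sdiff.1 hi).2 (hT F hF hiT)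
        rw [this, Finset.prod_const, Finset.prod_const, Finset.card_sdiff_of_subset (hsub F hF),
          Nat.card_Icc, Nat.add_sub_cancel]
    _ ≤ _ := by
        refine Finset.sum_le_sum_of_subset_of_nonneg
          (fun F hF => Finset.mem_powerset.2 (hsub F hF)) fun F _ _ => ?_
        exact mul_nonneg (Finset.prod_nonneg fun _ _ => hp0) (Finset.prod_nonneg fun i _ => hg i)

/-- A non-trivial `(m+2)`-wise `s`-intersecting family is `(m+1)`-wise `(s+1)`-intersecting. -/
lemma succ_le_ncard_iInter {𝓕 : Finset (Finset ℕ)} {m s : ℕ}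
    (hint : ∀ G : Fin (m + 2) → Finset ℕ, (∀ i, G i ∈ 𝓕) → s ≤ (⋂ i, (G i : Set ℕ)).ncard)
    (hnt : ∀ T : Finset ℕ, T.card = s → ∃ F ∈ 𝓕, ¬T ⊆ F)
    (G : Fin (m + 1) → Finset ℕ) (hG : ∀ i, G i ∈ 𝓕) :
    s + 1 ≤ (⋂ i, (G i : Set ℕ)).ncard := by
  have hfin : (⋂ i, (G i : Set ℕ)).Finite :=
    (G 0).finite_toSet.subset (Set.iInter_subset _ 0)
  have hcons : ∀ F ∈ 𝓕, s ≤ ((F : Set ℕ) ∩ ⋂ i, (G i : Set ℕ)).ncard := by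
    intro F hF
    have h := hint (Fin.cons F G) (Fin.cases hF hG)
    have heq : (⋂ i, ((Fin.cons F G : Fin (m + 2) → Finset ℕ) i : Set ℕ)) =
        (F : Set ℕ) ∩ ⋂ i, (G i : Set ℕ) := by
      ext x
      simp [Fin.forall_fin_succ]
    rwa [heq] at h
  by_contra hlt
  have hle : s ≤ (⋂ i, (G i : Set ℕ)).ncard :=
    (hcons _ (hG 0)).trans (Set.ncard_le_ncard Set.inter_subset_right hfin)
  obtain ⟨F, hF, hTF⟩ := hnt hfin.toFinset (by
    rw [← Set.ncard_eq_toFinset_card _ hfin]; omega)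
  refine hTF fun x hx => ?_
  have heq := Set.eq_of_subset_of_ncard_le (Set.inter_subset_right (s := (F : Set ℕ)))
    (by have := hcons F hF; omega) hfin
  have hx' : x ∈ ⋂ i, (G i : Set ℕ) := hfin.mem_toFinset.1 hx
  rw [← heq] at hx'
  exact hx'.1

lemma le_card_inter_of_nontrivial {𝓕 : Finset (Finset ℕ)} {t : ℕ}
    (hnt : ∀ T : Finset ℕ, T.card = t → ∃ F ∈ 𝓕, ¬T ⊆ F) (m : ℕ) :
    ∀ s, t ≤ s → (∀ G : Fin (m + 2) → Finset ℕ, (∀ i, G i ∈ 𝓕) →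
      s ≤ (⋂ i, (G i : Set ℕ)).ncard) → ∀ F ∈ 𝓕, ∀ G ∈ 𝓕, s + m ≤ (F ∩ G).card := by
  induction m with
  | zero =>
    intro s _ hint F hF G hG
    have h := hint ![F, G] (by simp [Fin.forall_fin_two, hF, hG])
    have heq : (⋂ i, ((![F, G] : Fin 2 → Finset ℕ) i : Set ℕ)) = ((F ∩ G : Finset ℕ) : Set ℕ) := by
      ext x
      simp [Fin.forall_fin_two]
    rwa [heq, Set.ncard_coe_finset] at h
  | succ m ih =>
    intro s hs hint F hF G hG
    have hnt' : ∀ T : Finset ℕ, T.card = s → ∃ F ∈ 𝓕, ¬T ⊆ F := by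
      intro T hT
      obtain ⟨T', hT', hc⟩ := Finset.exists_subset_card_eq (hT ▸ hs)
      obtain ⟨F, hF, hTF⟩ := hnt T' hc
      exact ⟨F, hF, fun h => hTF (hT'.trans h)⟩
    have := ih (s + 1) (by omega) (succ_le_ncard_iInter hint hnt') F hF G hG
    omega

/-- Product-measure EKR theorem for `d`-wise `t`-intersecting families: for `d ≥ 3`, `t ≥ 2`,
`n ≥ t`, `β ∈ (0, 1/2)` with `(1-β)^(t+d-3) = β^(d-2)`, every `d`-wise `t`-intersecting
family `𝓕 ⊆ 2^[n]` satisfies `μ_p(𝓕) ≤ p^t` for all `0 < p < β`. -/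
theorem stmt_4 (n d t : ℕ) (hd : 3 ≤ d) (ht : 2 ≤ t) (hn : t ≤ n)
    (β : ℝ) (hβ0 : 0 < β) (hβ2 : β < 1 / 2)
    (hβ : (1 - β) ^ (t + d - 3) = β ^ (d - 2))
    (𝓕 : Finset (Finset ℕ)) (hsub : ∀ F ∈ 𝓕, F ⊆ Finset.Icc 1 n)
    (hint : ∀ G : Fin d → Finset ℕ, (∀ i, G i ∈ 𝓕) → t ≤ (⋂ i, (G i : Set ℕ)).ncard)
    (p : ℝ) (hp0 : 0 < p) (hpβ : p < β) :
    ∑ F ∈ 𝓕, p ^ F.card * (1 - p) ^ (n - F.card) ≤ p ^ t := by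
  by_cases hnt : ∀ T : Finset ℕ, T.card = t → ∃ F ∈ 𝓕, ¬T ⊆ F
  · obtain ⟨m, rfl⟩ : ∃ m, d = m + 2 := ⟨d - 2, by omega⟩
    have h2 : ∀ F ∈ 𝓕, ∀ G ∈ 𝓕, (t + m - 1) + 1 ≤ (F ∩ G).card := by
      have := le_card_inter_of_nontrivial hnt m t le_rfl hint
      rwa [Nat.sub_add_cancel (by omega)]
    have h3 := pow_mul_sum_le_of_intersecting hp0.le (by linarith) n _ 𝓕 hsub h2
    have hq : 0 < (1 - p) ^ (t + m - 1) := pow_pos (by linarith) _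
    have h4 : p ^ m ≤ (1 - p) ^ (t + m - 1) :=
      calc p ^ m ≤ β ^ m := pow_le_pow_left₀ hp0.le hpβ.le m
        _ = (1 - β) ^ (t + m - 1) := by
          rw [show t + (m + 2) - 3 = t + m - 1 by omega, Nat.add_sub_cancel] at hβ
          exact hβ.symm
        _ ≤ _ := pow_le_pow_left₀ (by linarith) (by linarith) _
    refine le_of_mul_le_mul_left (h3.trans ?_) hq
    rw [Nat.sub_add_cancel (by omega), pow_add, mul_comm]
    exact mul_le_mul_of_nonneg_right h4 (pow_nonneg hp0.le t)
  · push Not at hnt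
    obtain ⟨T, rfl, hT⟩ := hnt
    exact sum_le_pow_card_of_forall_subset hp0.le (by linarith) n 𝓕 hsub T hT
end
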